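/- arXiv:2505.09481 — 11 statements merged into one kernel-verified Lean document; each statement's English description precedes it below -/
import Mathlib

section
/- Let n ≥ 2 be an integer, and for each divisor d > 1 of 2n−1 let ρ_d ∈ ℂ be a primitive 2d-th root of unity and let Ω_d(x) denote the minimal polynomial over ℚ of ρ_d + ρ_d^{−1} + 2. Then, in ℚ[x], w_n(x) = ∏_{d ∣ (2n−1), d > 1} Ω_d(x). -/
open Polynomial IntermediateField

/-- The recurrence sequence `w₀ = 1`, `w₁ = 1`, `wₙ = (x−2)·wₙ₋₁ − wₙ₋₂`. -/
noncomputable def w : ℕ → Polynomial ℤ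
  | 0 => 1
  | 1 => 1
  | n + 2 => (X - C 2) * w (n + 1) - w n

lemma w_key (z : ℂ) (hz : z ≠ 0) (n : ℕ) :
    (z + 1) * z ^ n * aeval (z + z⁻¹ + 2) (w (n + 1)) = z ^ (2 * n + 1) + 1 ∧
    (z + 1) * z ^ n * aeval (z + z⁻¹ + 2) (w n) = z * (z ^ (2 * n) + z) / z := by
  induction n with
  | zero => simp [w]; field_simp; ring
  | succ k ih =>
    obtain ⟨h1, h2⟩ := ih
    rw [mul_div_cancel_left₀ _ hz] at h2 ⊢
    constructor
    · have : w (k + 1 + 1) = (X - C 2) * w (k + 1) - w k := by rw [w]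
      rw [this]
      simp only [map_sub, map_mul, aeval_X, map_ofNat]
      generalize aeval (z + z⁻¹ + 2) (w (k+1)) = a at *
      generalize aeval (z + z⁻¹ + 2) (w k) = b at *
      have : (z + 1) * z ^ (k + 1) * ((z + z⁻¹ + 2 - 2) * a - b)
        = (z ^ 2 + 1) * ((z + 1) * z ^ k * a) - z * ((z + 1) * z ^ k * b) := by
        field_simp; ring
      rw [this, h1, h2]; ring
    · have := congrArg (fun t => z * t) h1
      rw [show (z + 1) * z ^ (k + 1) * aeval (z + z⁻¹ + 2) (w (k+1)) =
        z * ((z + 1) * z ^ k * aeval (z + z⁻¹ + 2) (w (k+1))) by ring, h1]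
      ring

lemma w_deg (n : ℕ) : (w (n + 1)).Monic ∧ (w (n + 1)).natDegree = n ∧
    (w n).natDegree ≤ n := by
  induction n with
  | zero => simp [w]
  | succ k ih =>
    obtain ⟨h1, h2, h3⟩ := ih
    have e : w (k + 1 + 1) = (X - C 2) * w (k + 1) - w k := by rw [w]
    have hm : ((X - C 2) * w (k + 1)).Monic := (monic_X_sub_C 2).mul h1
    have hd : ((X - C 2) * w (k + 1)).natDegree = k + 1 := by
      rw [(monic_X_sub_C 2).natDegree_mul h1, natDegree_X_sub_C, h2, add_comm]
    have hlt : (w k).natDegree < ((X - C 2) * w (k + 1)).natDegree := by omega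
    refine ⟨?_, ?_, by omega⟩
    · rw [e]; exact hm.sub_of_left (degree_lt_degree hlt)
    · rw [e, natDegree_sub_eq_left_of_natDegree_lt hlt, hd]

lemma rho_ne {d : ℕ} (hd : 1 < d) {z : ℂ} (hz : IsPrimitiveRoot z (2 * d)) : z + 1 ≠ 0 := by
  intro h
  have h1 : z = -1 := eq_neg_of_add_eq_zero_left h
  have : z ^ 2 = 1 := by rw [h1]; norm_num
  have := Nat.le_of_dvd (by norm_num) (hz.dvd_of_pow_eq_one _ this)
  omega

lemma pow_d {d : ℕ} (hd : 1 < d) {z : ℂ} (hz : IsPrimitiveRoot z (2 * d)) : z ^ d = -1 := by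
  have h1 : (z ^ d) ^ 2 = 1 := by rw [← pow_mul, mul_comm, hz.pow_eq_one]
  rcases eq_or_eq_neg_of_sq_eq_sq (z ^ d) 1 (by rw [h1, one_pow]) with h | h
  · have := Nat.le_of_dvd (by omega) (hz.dvd_of_pow_eq_one _ h)
    omega
  · exact h

lemma root_iff {d : ℕ} (hd : 1 < d) {z : ℂ} (hz : IsPrimitiveRoot z (2 * d)) (k : ℕ) :
    aeval (z + z⁻¹ + 2) (w (k + 1)) = 0 ↔ z ^ (2 * k + 1) = -1 := by
  have h0 : z ≠ 0 := hz.ne_zero (by omega)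
  have := (w_key z h0 k).1
  rw [eq_neg_iff_add_eq_zero, ← this]
  simp [rho_ne hd hz, h0]

lemma root_of_dvd {d : ℕ} (hd : 1 < d) {z : ℂ} (hz : IsPrimitiveRoot z (2 * d)) (k : ℕ)
    (h : d ∣ 2 * k + 1) : aeval (z + z⁻¹ + 2) (w (k + 1)) = 0 := by
  rw [root_iff hd hz]
  obtain ⟨c, hc⟩ := h
  rw [hc, pow_mul, pow_d hd hz]
  have : Odd (d * c) := ⟨k, hc.symm⟩
  exact (Nat.odd_mul.mp this).2.neg_one_pow

lemma dvd_of_root {d : ℕ} (hd : 1 < d) {z : ℂ} (hz : IsPrimitiveRoot z (2 * d)) (k : ℕ)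
    (h : aeval (z + z⁻¹ + 2) (w (k + 1)) = 0) : d ∣ 2 * k + 1 := by
  rw [root_iff hd hz] at h
  have : z ^ (2 * (2 * k + 1)) = 1 := by rw [mul_comm, pow_mul, h]; norm_num
  exact Nat.dvd_of_mul_dvd_mul_left two_pos (hz.dvd_of_pow_eq_one _ this)

lemma aeval_mapQ (x : ℂ) (p : ℤ[X]) : aeval x (p.map (Int.castRingHom ℚ)) = aeval x p := by
  rw [show Int.castRingHom ℚ = algebraMap ℤ ℚ from rfl, aeval_map_algebraMap]

lemma deg_lower {d : ℕ} (hd : 1 < d) {z : ℂ} (hz : IsPrimitiveRoot z (2 * d))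
    (p : ℚ[X]) (hp : p.Monic) (h : aeval (z + z⁻¹ + 2) p = 0) :
    (2 * d).totient ≤ 2 * p.natDegree := by
  have h0 : z ≠ 0 := hz.ne_zero (by omega)
  set m := p.natDegree with hm
  let P : ℚ[X] := ∑ i ∈ Finset.range (m + 1), C (p.coeff i) * ((X + 1) ^ (2 * i) * X ^ (m - i))
  have hP0 : P ≠ 0 := by
    intro hh
    have : P.eval 0 = 1 := by
      simp only [P, eval_finsetSum]
      rw [Finset.sum_eq_single m]
      · simp [hm, hp]
      · intro b hb hbm
        have : m - b ≠ 0 := by have := Finset.mem_range.mp hb; omega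
        simp [this]
      · simp
    rw [hh] at this; simp at this
  have hPd : P.natDegree ≤ 2 * m := by
    apply natDegree_sum_le_of_forall_le
    intro i hi
    have := Finset.mem_range.mp hi
    have h3 : (C (p.coeff i) * ((X + 1) ^ (2 * i) * X ^ (m - i)) : ℚ[X]).natDegree
      ≤ 0 + (2 * i * 1 + (m - i) * 1) := by
      refine natDegree_mul_le_of_le (by simp) (natDegree_mul_le_of_le ?_ ?_)
      · refine natDegree_pow_le_of_le _ ?_
        rw [← C_1, natDegree_X_add_C]
      · exact natDegree_pow_le_of_le _ (by simp)
    omega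
  have hPz : aeval z P = 0 := by
    have : aeval z P = z ^ m * aeval (z + z⁻¹ + 2) p := by
      rw [aeval_eq_sum_range (p := p), Finset.mul_sum]
      simp only [P, map_sum]
      refine Finset.sum_congr rfl fun i hi => ?_
      have := Finset.mem_range.mp hi
      have e : z + z⁻¹ + 2 = (z + 1) ^ 2 / z := by field_simp; ring
      rw [e, Algebra.smul_def, ← Nat.sub_add_cancel (show i ≤ m by omega)]
      simp only [map_mul, map_pow, map_add, aeval_X, aeval_C, map_one, Nat.add_sub_cancel]
      rw [div_pow, pow_add, pow_mul]
      field_simp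
    rw [this, h, mul_zero]
  have h4 : cyclotomic (2 * d) ℚ = minpoly ℚ z := cyclotomic_eq_minpoly_rat hz (by omega)
  have h5 := natDegree_le_of_dvd (minpoly.dvd ℚ z hPz) hP0
  rw [← h4, natDegree_cyclotomic] at h5
  omega

theorem stmt_0 (n : ℕ) (hn : 2 ≤ n) (ρ : ℕ → ℂ)
    (hρ : ∀ d ∈ (2 * n - 1).divisors, 1 < d → IsPrimitiveRoot (ρ d) (2 * d)) :
    (w n).map (Int.castRingHom ℚ) =
      ∏ d ∈ (2 * n - 1).divisors.filter (fun d => 1 < d),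
        minpoly ℚ (ρ d + (ρ d)⁻¹ + 2) := by
  obtain ⟨k, rfl⟩ : ∃ k, n = k + 1 := ⟨n - 1, by omega⟩
  have e2 : 2 * (k + 1) - 1 = 2 * k + 1 := by omega
  rw [e2] at hρ ⊢
  set S := (2 * k + 1).divisors.filter (fun d => 1 < d) with hS
  have hSmem : ∀ d ∈ S, d ∣ 2 * k + 1 ∧ 1 < d ∧ IsPrimitiveRoot (ρ d) (2 * d) := by
    intro d hd
    obtain ⟨h1, h2⟩ := Finset.mem_filter.mp hd
    exact ⟨Nat.dvd_of_mem_divisors h1, h2, hρ d h1 h2⟩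
  have hWm : ((w (k + 1)).map (Int.castRingHom ℚ)).Monic := (w_deg k).1.map _
  have hroot : ∀ d ∈ S, aeval (ρ d + (ρ d)⁻¹ + 2) ((w (k + 1)).map (Int.castRingHom ℚ)) = 0 := by
    intro d hd
    obtain ⟨h1, h2, h3⟩ := hSmem d hd
    rw [aeval_mapQ]; exact root_of_dvd h2 h3 k h1
  have hint : ∀ d ∈ S, IsIntegral ℚ (ρ d + (ρ d)⁻¹ + 2) := fun d hd => ⟨_, hWm, hroot d hd⟩
  have hdvd1 : ∀ d ∈ S, ∀ e ∈ S,
      minpoly ℚ (ρ d + (ρ d)⁻¹ + 2) = minpoly ℚ (ρ e + (ρ e)⁻¹ + 2) → e ∣ d := by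
    intro d hd e he h
    obtain ⟨h1, h2, h3⟩ := hSmem d hd
    obtain ⟨g1, g2, g3⟩ := hSmem e he
    have hodd : Odd d := Odd.of_dvd_nat ⟨k, rfl⟩ h1
    obtain ⟨j, hj⟩ := hodd
    have h4 : aeval (ρ d + (ρ d)⁻¹ + 2) ((w (j + 1)).map (Int.castRingHom ℚ)) = 0 := by
      rw [aeval_mapQ]; exact root_of_dvd h2 h3 j (by rw [hj])
    have h5 := minpoly.dvd ℚ _ h4
    rw [h] at h5
    have h6 := aeval_eq_zero_of_dvd_aeval_eq_zero h5 (minpoly.aeval ℚ _)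
    rw [aeval_mapQ] at h6
    rw [hj]; exact dvd_of_root g2 g3 j h6
  have hprod : (∏ d ∈ S, minpoly ℚ (ρ d + (ρ d)⁻¹ + 2)) ∣
      (w (k + 1)).map (Int.castRingHom ℚ) := by
    refine Finset.prod_dvd_of_coprime ?_ fun d hd => minpoly.dvd ℚ _ (hroot d hd)
    intro d hd e he hne
    refine ((minpoly.irreducible (hint d hd)).coprime_iff_not_dvd).mpr fun h => hne ?_
    have := eq_of_monic_of_associated (minpoly.monic (hint d hd)) (minpoly.monic (hint e he))
      ((minpoly.irreducible (hint d hd)).associated_of_dvd (minpoly.irreducible (hint e he)) h)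
    exact Nat.dvd_antisymm (hdvd1 e he d hd this.symm) (hdvd1 d hd e he this)
  have hpm : (∏ d ∈ S, minpoly ℚ (ρ d + (ρ d)⁻¹ + 2)).Monic :=
    monic_prod_of_monic _ _ fun d hd => minpoly.monic (hint d hd)
  have hsum : ∑ d ∈ S, (2 * d).totient = 2 * k := by
    have h1 := Nat.sum_totient (2 * k + 1)
    have h2 : (2 * k + 1).divisors = insert 1 S := by
      ext a
      simp only [hS, Finset.mem_insert, Finset.mem_filter, Nat.mem_divisors]
      constructor
      · rintro ⟨h, h'⟩
        have := Nat.pos_of_dvd_of_pos h (by omega)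
        by_cases ha : a = 1
        · exact Or.inl ha
        · exact Or.inr ⟨⟨h, h'⟩, by omega⟩
      · rintro (h | h)
        · subst h; simp
        · exact h.1
    rw [h2, Finset.sum_insert (by simp [hS])] at h1
    have h3 : ∑ d ∈ S, (2 * d).totient = ∑ d ∈ S, d.totient := by
      refine Finset.sum_congr rfl fun d hd => ?_
      have hodd : Odd d := Odd.of_dvd_nat ⟨k, rfl⟩ (hSmem d hd).1
      exact Nat.totient_two_mul_of_odd hodd
    rw [h3]
    rw [Nat.totient_one] at h1
    omega

  refine eq_of_monic_of_dvd_of_natDegree_le hpm hWm hprod ?_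
  rw [natDegree_prod_of_monic _ _ fun d hd => minpoly.monic (hint d hd),
    (w_deg k).1.natDegree_map, (w_deg k).2.1]
  have : ∑ d ∈ S, (2 * d).totient ≤ ∑ d ∈ S, 2 * (minpoly ℚ (ρ d + (ρ d)⁻¹ + 2)).natDegree :=
    Finset.sum_le_sum fun d hd => deg_lower (hSmem d hd).2.1 (hSmem d hd).2.2 _
      (minpoly.monic (hint d hd)) (minpoly.aeval _ _)
  rw [hsum, ← Finset.mul_sum] at this
  omega
end

section
/- Let d ≥ 3 be an odd integer, let ρ ∈ ℂ be a primitive 2d-th root of unity, and set θ = ρ + ρ^{−1} + 2. Then the ring of integers of the number field ℚ(θ) equals ℤ[θ]; that is, the minimal polynomial of θ over ℚ is monogenic. -/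
open Polynomial IntermediateField

theorem aux_mem_adjoin_rho (n : ℕ) (hn : n ≠ 0) (ρ : ℂ) (hρ : IsPrimitiveRoot ρ n) (z : ℂ)
    (hz : z ∈ ℚ⟮ρ⟯) (hi : IsIntegral ℤ z) : z ∈ Algebra.adjoin ℤ {ρ} := by
  have : NeZero n := ⟨hn⟩
  have : IsCyclotomicExtension {n} ℚ ℚ⟮ρ⟯ :=
    by
    change IsCyclotomicExtension {n} ℚ (IntermediateField.adjoin ℚ {ρ}).toSubalgebra
    rw [IntermediateField.adjoin_simple_toSubalgebra_of_isAlgebraic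
      ((hρ.isIntegral (Nat.pos_of_ne_zero hn)).tower_top (A := ℚ)).isAlgebraic]
    exact hρ.adjoin_isCyclotomicExtension ℚ
  have hg : IsPrimitiveRoot (AdjoinSimple.gen ℚ ρ) n :=
    IsPrimitiveRoot.of_map_of_injective (f := algebraMap ℚ⟮ρ⟯ ℂ)
      (by simpa using hρ) (algebraMap ℚ⟮ρ⟯ ℂ).injective
  have h1 := IsCyclotomicExtension.Rat.isIntegralClosure_adjoin_singleton hg
  have h2 : IsIntegral ℤ (⟨z, hz⟩ : ℚ⟮ρ⟯) :=
    (isIntegral_algHom_iff ((Algebra.ofId ℚ⟮ρ⟯ ℂ).restrictScalars ℤ)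
      (algebraMap ℚ⟮ρ⟯ ℂ).injective).1 hi
  obtain ⟨y, hy⟩ := h1.isIntegral_iff.1 h2
  have h3 : (⟨z, hz⟩ : ℚ⟮ρ⟯) ∈ Algebra.adjoin ℤ {AdjoinSimple.gen ℚ ρ} := hy ▸ y.2
  have h4 : z ∈ (Algebra.adjoin ℤ {AdjoinSimple.gen ℚ ρ}).map
      ((Algebra.ofId ℚ⟮ρ⟯ ℂ).restrictScalars ℤ) := Subalgebra.mem_map.2 ⟨_, h3, rfl⟩
  rw [AlgHom.map_adjoin_singleton] at h4
  exact h4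

theorem aux_decomp (ρ : ℂ) (h0 : ρ ≠ 0) (z : ℂ) (hz : z ∈ Algebra.adjoin ℤ {ρ}) :
    ∃ a ∈ Algebra.adjoin ℤ {ρ + ρ⁻¹ + 2}, ∃ b ∈ Algebra.adjoin ℤ {ρ + ρ⁻¹ + 2},
      z = a + b * ρ := by
  have hθ : ρ + ρ⁻¹ ∈ Algebra.adjoin ℤ {ρ + ρ⁻¹ + 2} := by
    have := sub_mem (Algebra.self_mem_adjoin_singleton ℤ (ρ + ρ⁻¹ + 2))
      (ofNat_mem (Algebra.adjoin ℤ {ρ + ρ⁻¹ + 2}) 2)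
    simpa using this
  have hsq : ρ * ρ = (ρ + ρ⁻¹) * ρ - 1 := by field_simp; ring
  induction hz using Algebra.adjoin_induction with
  | mem x hx =>
    rw [Set.mem_singleton_iff] at hx
    exact ⟨0, zero_mem _, 1, one_mem _, by simp [hx]⟩
  | algebraMap r => exact ⟨_, Subalgebra.algebraMap_mem _ r, 0, zero_mem _, by simp⟩
  | add x y _ _ hx hy =>
    obtain ⟨a, ha, b, hb, rfl⟩ := hx
    obtain ⟨c, hc, e, he, rfl⟩ := hy
    exact ⟨_, add_mem ha hc, _, add_mem hb he, by ring⟩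
  | mul x y _ _ hx hy =>
    obtain ⟨a, ha, b, hb, rfl⟩ := hx
    obtain ⟨c, hc, e, he, rfl⟩ := hy
    refine ⟨a * c - b * e, sub_mem (mul_mem ha hc) (mul_mem hb he),
      a * e + b * c + b * e * (ρ + ρ⁻¹),
      add_mem (add_mem (mul_mem ha he) (mul_mem hb hc)) (mul_mem (mul_mem hb he) hθ), ?_⟩
    linear_combination (b * e) * hsq

/-- For odd `d ≥ 3`, `ρ` a primitive `2d`-th root of unity in `ℂ`, and `θ = ρ + ρ⁻¹ + 2`,
the ring of integers of `ℚ(θ)` equals `ℤ[θ]`; i.e. the minimal polynomial of `θ` over `ℚ`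
is monogenic. -/
theorem stmt_2 (d : ℕ) (hd : 3 ≤ d) (hodd : Odd d) (ρ : ℂ)
    (hρ : IsPrimitiveRoot ρ (2 * d)) :
    Algebra.adjoin ℤ {IntermediateField.AdjoinSimple.gen ℚ (ρ + ρ⁻¹ + 2)} =
      integralClosure ℤ ℚ⟮ρ + ρ⁻¹ + 2⟯ := by
  have hn : 2 * d ≠ 0 := by omega
  have h0 : ρ ≠ 0 := hρ.ne_zero hn
  have hconj : (starRingEnd ℂ) ρ = ρ⁻¹ :=
    (Complex.inv_eq_conj (hρ.norm'_eq_one hn)).symm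
  have hne : ρ - ρ⁻¹ ≠ 0 := by
    intro h
    have h2 : ρ ^ 2 = 1 := by
      have h3 : ρ * ρ = ρ * ρ⁻¹ := congrArg (ρ * ·) (sub_eq_zero.1 h)
      rw [pow_two, h3, mul_inv_cancel₀ h0]
    have := Nat.le_of_dvd (by norm_num) (hρ.dvd_of_pow_eq_one _ h2)
    omega
  have hcθ : (starRingEnd ℂ) (ρ + ρ⁻¹ + 2) = ρ + ρ⁻¹ + 2 := by
    simp only [map_add, map_inv₀, hconj, inv_inv, map_ofNat]; ring
  have hiρ : IsIntegral ℤ ρ := hρ.isIntegral (by omega)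
  have hiρ' : IsIntegral ℤ ρ⁻¹ := hρ.inv.isIntegral (by omega)
  set θ := ρ + ρ⁻¹ + 2 with hθ
  have hiθ : IsIntegral ℤ θ := (hiρ.add hiρ').add (by simpa using isIntegral_algebraMap (R := ℤ) (A := ℂ) (x := 2))
  have hinj := (algebraMap ℚ⟮θ⟯ ℂ).injective
  have hreal : ∀ z ∈ Algebra.adjoin ℤ {θ}, (starRingEnd ℂ) z = z := by
    intro z hz
    induction hz using Algebra.adjoin_induction with
    | mem x hx => rw [Set.mem_singleton_iff] at hx; rw [hx, hcθ]
    | algebraMap r => simp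
    | add x y _ _ hx hy => rw [map_add, hx, hy]
    | mul x y _ _ hx hy => rw [map_mul, hx, hy]
  have hrealQ : ∀ z ∈ ℚ⟮θ⟯, (starRingEnd ℂ) z = z := by
    intro z hz
    induction hz using IntermediateField.adjoin_induction with
    | mem x hx => rw [Set.mem_singleton_iff] at hx; rw [hx, hcθ]
    | algebraMap r => simp
    | add x y _ _ hx hy => rw [map_add, hx, hy]
    | mul x y _ _ hx hy => rw [map_mul, hx, hy]
    | inv x _ hx => rw [map_inv₀, hx]
  have hsub : ℚ⟮θ⟯ ≤ ℚ⟮ρ⟯ := by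
    rw [IntermediateField.adjoin_simple_le_iff]
    have hm := IntermediateField.mem_adjoin_simple_self ℚ ρ
    exact add_mem (add_mem hm (inv_mem hm)) (ofNat_mem _ 2)
  apply le_antisymm
  · rw [Algebra.adjoin_le_iff, Set.singleton_subset_iff]
    exact (isIntegral_algHom_iff ((Algebra.ofId ℚ⟮θ⟯ ℂ).restrictScalars ℤ) hinj).1 hiθ
  · intro x hx
    have hx' : IsIntegral ℤ (x : ℂ) :=
      (isIntegral_algHom_iff ((Algebra.ofId ℚ⟮θ⟯ ℂ).restrictScalars ℤ) hinj).2 hx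
    obtain ⟨a, ha, b, hb, hab⟩ := aux_decomp ρ h0 _
      (aux_mem_adjoin_rho _ hn ρ hρ x (hsub x.2) hx')
    have h1 := hrealQ x x.2
    rw [hab, map_add, map_mul, hreal a ha, hreal b hb, hconj] at h1
    have h2 : b * (ρ - ρ⁻¹) = 0 := by linear_combination -h1
    have hb0 : b = 0 := (mul_eq_zero.1 h2).resolve_right hne
    rw [hb0, zero_mul, add_zero] at hab
    have h4 : (x : ℂ) ∈ (Algebra.adjoin ℤ {AdjoinSimple.gen ℚ θ}).map
        ((Algebra.ofId ℚ⟮θ⟯ ℂ).restrictScalars ℤ) := by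
      rw [AlgHom.map_adjoin_singleton, hab]
      exact ha
    obtain ⟨y, hy, hyx⟩ := Subalgebra.mem_map.1 h4
    have : y = x := hinj hyx
    exact this ▸ hy
end

section
/- Let d ≥ 3 be an odd integer and let ρ ∈ ℂ be a primitive 2d-th root of unity. Then the Galois group of ℚ(ρ + ρ^{−1}) over ℚ is cyclic (equivalently, isomorphic to the cyclic group C_{φ(d)/2} of order φ(d)/2) if and only if d satisfies Condition C. -/
open Polynomial IntermediateField

/-- Condition 𝒞: `N` is odd and equals `p^a` or `p^a·q^b` with `gcd(φ(p^a), φ(q^b)) = 2`,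
or `N` is even and equals `2p^a` or `2p^a·q^b` with `gcd(φ(p^a), φ(q^b)) = 2`, where
`p, q` are distinct odd primes and `a, b ≥ 1`. -/
def ConditionC (N : ℕ) : Prop :=
  (Odd N ∧ ((∃ p a : ℕ, p.Prime ∧ Odd p ∧ 0 < a ∧ N = p ^ a) ∨
    (∃ p q a b : ℕ, p.Prime ∧ q.Prime ∧ Odd p ∧ Odd q ∧ p ≠ q ∧ 0 < a ∧ 0 < b ∧
      Nat.gcd (p ^ a).totient (q ^ b).totient = 2 ∧ N = p ^ a * q ^ b))) ∨
  (Even N ∧ ((∃ p a : ℕ, p.Prime ∧ Odd p ∧ 0 < a ∧ N = 2 * p ^ a) ∨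
    (∃ p q a b : ℕ, p.Prime ∧ q.Prime ∧ Odd p ∧ Odd q ∧ p ≠ q ∧ 0 < a ∧ 0 < b ∧
      Nat.gcd (p ^ a).totient (q ^ b).totient = 2 ∧ N = 2 * (p ^ a * q ^ b))))

/-- The kernel of restriction from `F(ζ)` to `F(ζ + ζ⁻¹)` is `{±1}`. -/
theorem aux_gal_L (d : ℕ) [NeZero d] (F L : Type) [Field F] [Field L] [Algebra F L]
    (hirr : Irreducible (cyclotomic d F)) [IsCyclotomicExtension {d} F L] (ζ : L) (hζ : IsPrimitiveRoot ζ d) :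
    ∃ f : (ZMod d)ˣ →* (F⟮ζ + ζ⁻¹⟯ ≃ₐ[F] F⟮ζ + ζ⁻¹⟯), Function.Surjective f ∧
      ∀ u, f u = 1 ↔ u = 1 ∨ u = -1 := by
  have hab : IsAbelianGalois F L := IsCyclotomicExtension.isAbelianGalois {d} F L
  have hN : Normal F F⟮ζ + ζ⁻¹⟯ := inferInstance
  have hNL : Normal F L := inferInstance
  let e := IsCyclotomicExtension.autEquivPow L hirr
  have hζ0 : ζ ≠ 0 := hζ.ne_zero (NeZero.ne d)
  have key : ∀ u : (ZMod d)ˣ, e.symm u ζ = ζ ^ u.val.val := fun u => by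
    have hz := IsCyclotomicExtension.zeta_spec d F L
    obtain ⟨k, -, rfl⟩ := hz.eq_pow_of_pow_eq_one hζ.pow_eq_one
    have h1 := hz.autToPow_spec F (e.symm u)
    have h2 : hz.autToPow F (e.symm u) = u := e.apply_symm_apply u
    rw [h2] at h1
    rw [map_pow, ← h1, pow_right_comm]
  have hinj : ∀ u v : (ZMod d)ˣ, ζ ^ u.val.val = ζ ^ v.val.val → u = v := fun u v h => by
    have := hζ.pow_inj (ZMod.val_lt _) (ZMod.val_lt _) h
    exact Units.ext (ZMod.val_injective d this)
  have h1 : ζ ^ ((1 : (ZMod d)ˣ)).val.val = ζ := by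
    rw [← key]; simp
  have hm1 : ζ ^ ((-1 : (ZMod d)ˣ)).val.val = ζ⁻¹ := by
    apply eq_inv_of_mul_eq_one_left
    rw [← pow_succ, hζ.pow_eq_one_iff_dvd,
      ← ZMod.natCast_eq_zero_iff]
    simp
  refine ⟨(AlgEquiv.restrictNormalHom (F⟮ζ + ζ⁻¹⟯)).comp e.symm.toMonoidHom, ?_, ?_⟩
  · exact (AlgEquiv.restrictNormalHom_surjective L).comp e.symm.surjective
  · intro u
    have hk : (AlgEquiv.restrictNormalHom (F⟮ζ + ζ⁻¹⟯)).comp e.symm.toMonoidHom u = 1 ↔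
        e.symm u ∈ (F⟮ζ + ζ⁻¹⟯).fixingSubgroup := by
      rw [← IntermediateField.restrictNormalHom_ker, MonoidHom.mem_ker]; rfl
    rw [hk, IntermediateField.mem_fixingSubgroup_iff]
    have hfix : (∀ x ∈ F⟮ζ + ζ⁻¹⟯, e.symm u x = x) ↔ e.symm u (ζ + ζ⁻¹) = ζ + ζ⁻¹ := by
      refine ⟨fun h => h _ (IntermediateField.mem_adjoin_simple_self F _), fun h x hx => ?_⟩
      have : F⟮ζ + ζ⁻¹⟯ ≤ IntermediateField.fixedField (Subgroup.zpowers (e.symm u)) := by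
        rw [IntermediateField.adjoin_simple_le_iff, IntermediateField.mem_fixedField_iff]
        intro g hg
        have hs : Subgroup.zpowers (e.symm u) ≤ MulAction.stabilizer (L ≃ₐ[F] L) (ζ + ζ⁻¹) := by
          rw [Subgroup.zpowers_le]; exact h
        exact hs hg
      exact (IntermediateField.mem_fixedField_iff _ _).1 (this hx) _ (Subgroup.mem_zpowers _)
    rw [hfix, map_add, map_inv₀, key]
    constructor
    · intro h
      have hw0 : ζ ^ u.val.val ≠ 0 := pow_ne_zero _ hζ0
      have hcase : ζ ^ u.val.val = ζ ∨ ζ ^ u.val.val = ζ⁻¹ := by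
        generalize ζ ^ u.val.val = w at h hw0
        have : (w - ζ) * (w - ζ⁻¹) = 0 := by
          have h2 : w * (w + w⁻¹) = w * (ζ + ζ⁻¹) := by rw [h]
          rw [mul_add, mul_inv_cancel₀ hw0] at h2
          have h3 := mul_inv_cancel₀ hζ0
          linear_combination h2 + h3
        rcases mul_eq_zero.1 this with h | h
        · exact Or.inl (sub_eq_zero.1 h)
        · exact Or.inr (sub_eq_zero.1 h)
      rcases hcase with h | h
      · exact Or.inl (hinj _ _ (h.trans h1.symm))
      · exact Or.inr (hinj _ _ (h.trans hm1.symm))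
    · rintro (rfl | rfl)
      · rw [h1]
      · rw [hm1, inv_inv, add_comm]

theorem aux_gal (d : ℕ) [NeZero d] (F M : Type) [Field F] [Field M] [Algebra F M]
    (hirr : Irreducible (cyclotomic d F)) (ζ : M) (hζ : IsPrimitiveRoot ζ d) :
    ∃ f : (ZMod d)ˣ →* (F⟮ζ + ζ⁻¹⟯ ≃ₐ[F] F⟮ζ + ζ⁻¹⟯), Function.Surjective f ∧
      ∀ u, f u = 1 ↔ u = 1 ∨ u = -1 := by
  have : IsCyclotomicExtension {d} F F⟮ζ⟯ := by
    change IsCyclotomicExtension {d} F (F⟮ζ⟯).toSubalgebra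
    rw [IntermediateField.adjoin_simple_toSubalgebra_of_isAlgebraic
      (hζ.isIntegral (NeZero.pos d)).tower_top.isAlgebraic]
    exact hζ.adjoin_isCyclotomicExtension F
  let z : F⟮ζ⟯ := IntermediateField.AdjoinSimple.gen F ζ
  have hzc : (F⟮ζ⟯).val z = ζ := rfl
  have hz : IsPrimitiveRoot z d :=
    IsPrimitiveRoot.of_map_of_injective (f := (F⟮ζ⟯).val) hζ (F⟮ζ⟯).val.injective
  obtain ⟨f, hf, hk⟩ := aux_gal_L d F F⟮ζ⟯ hirr z hz
  have hmap : (F⟮z + z⁻¹⟯).map (F⟮ζ⟯).val = F⟮ζ + ζ⁻¹⟯ := by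
    rw [IntermediateField.adjoin_map, Set.image_singleton, map_add, map_inv₀, hzc]
  let E : F⟮z + z⁻¹⟯ ≃ₐ[F] F⟮ζ + ζ⁻¹⟯ :=
    ((F⟮z + z⁻¹⟯).equivMap (F⟮ζ⟯).val).trans (IntermediateField.equivOfEq hmap)
  refine ⟨(AlgEquiv.autCongr E).toMonoidHom.comp f, (AlgEquiv.autCongr E).surjective.comp hf, ?_⟩
  intro u
  rw [← hk]
  exact map_eq_one_iff (AlgEquiv.autCongr E) (AlgEquiv.autCongr E).injective

theorem aux_dvd {d : ℕ} [NeZero d] {G : Type*} [Group G] (hc : IsCyclic G)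
    (f : (ZMod d)ˣ →* G) (hf : Function.Surjective f) (hk : ∀ u, f u = 1 ↔ u = 1 ∨ u = -1)
    (e : ℕ) (he : ∀ u : (ZMod d)ˣ, u ^ e = 1) : d.totient ∣ 2 * e := by
  have h1 : Nat.card G ∣ e := by
    rw [← IsCyclic.exponent_eq_card]
    refine Monoid.exponent_dvd_of_forall_pow_eq_one fun g => ?_
    obtain ⟨u, rfl⟩ := hf g
    rw [← map_pow, he, map_one]
  have h2 : f.ker = Subgroup.zpowers (-1) := by
    ext u
    rw [MonoidHom.mem_ker, hk]
    constructor
    · rintro (rfl | rfl)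
      · exact one_mem _
      · exact Subgroup.mem_zpowers _
    · rintro ⟨k, rfl⟩
      exact (Int.even_or_odd k).imp (fun h => h.neg_one_zpow) (fun h => h.neg_one_zpow)
  have h3 : Nat.card f.ker ∣ 2 := by
    rw [h2, Nat.card_zpowers]
    exact orderOf_dvd_of_pow_eq_one (by simp)
  have h4 := Subgroup.card_eq_card_quotient_mul_card_subgroup f.ker
  rw [Nat.card_congr (QuotientGroup.quotientKerEquivOfSurjective f hf).toEquiv,
    Nat.card_eq_fintype_card, ZMod.card_units_eq_totient] at h4
  rw [h4, mul_comm]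
  exact mul_dvd_mul h3 h1

/-- CRT on unit groups. -/
noncomputable def aux_crt {A B : ℕ} (h : A.Coprime B) :
    (ZMod (A * B))ˣ ≃* (ZMod A)ˣ × (ZMod B)ˣ :=
  (Units.mapEquiv (ZMod.chineseRemainder h).toMulEquiv).trans MulEquiv.prodUnits

theorem aux_crt_neg {A B : ℕ} (h : A.Coprime B) : aux_crt h (-1) = (-1, -1) := by
  ext <;> simp [aux_crt, MulEquiv.prodUnits]

theorem aux_exp {A B : ℕ} (h : A.Coprime B) (a b : ℕ) (ha : ∀ u : (ZMod A)ˣ, u ^ a = 1)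
    (hb : ∀ u : (ZMod B)ˣ, u ^ b = 1) (u : (ZMod (A * B))ˣ) : u ^ (Nat.lcm a b) = 1 := by
  apply (aux_crt h).injective
  rw [map_pow, map_one]
  obtain ⟨s, hs⟩ := Nat.dvd_lcm_left a b
  obtain ⟨t, ht⟩ := Nat.dvd_lcm_right a b
  refine Prod.ext ?_ ?_
  · change ((aux_crt h) u).1 ^ _ = 1
    rw [hs, pow_mul, ha, one_pow]
  · change ((aux_crt h) u).2 ^ _ = 1
    rw [ht, pow_mul, hb, one_pow]

theorem aux_lcm {m n k : ℕ} (hm : 0 < m) (hn : 0 < n) (h : m * n ∣ k * Nat.lcm m n) :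
    Nat.gcd m n ∣ k := by
  rw [← Nat.gcd_mul_lcm] at h
  exact Nat.dvd_of_mul_dvd_mul_right (Nat.lcm_pos hm hn) h

theorem aux_split {d : ℕ} (hd : 3 ≤ d) (hodd : Odd d) :
    ∃ p a B : ℕ, p.Prime ∧ Odd p ∧ 0 < a ∧ Odd B ∧ (p ^ a).Coprime B ∧ d = p ^ a * B := by
  have hp := Nat.minFac_prime (n := d) (by omega)
  have h := Nat.ordProj_mul_ordCompl_eq_self d d.minFac
  refine ⟨d.minFac, d.factorization d.minFac, d / d.minFac ^ d.factorization d.minFac, hp,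
    hodd.of_dvd_nat (Nat.minFac_dvd d),
    hp.factorization_pos_of_dvd (by omega) (Nat.minFac_dvd d), ?_, ?_, h.symm⟩
  · exact hodd.of_dvd_nat (Dvd.intro_left _ h)
  · exact (Nat.coprime_ordCompl hp (by omega)).pow_left _

theorem aux_two_lt {p a : ℕ} (hp : p.Prime) (ho : Odd p) (ha : 0 < a) : 2 < p ^ a := by
  have h2 := hp.two_le
  have h3 : p ≤ p ^ a := Nat.le_self_pow (by omega) p
  rcases ho with ⟨k, hk⟩
  omega

theorem aux_tot (n : ℕ) [NeZero n] (u : (ZMod n)ˣ) : u ^ n.totient = 1 := ZMod.pow_totient u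

theorem aux_conv {d : ℕ} (hd : 3 ≤ d) (hodd : Odd d)
    (H : ∀ e : ℕ, (∀ u : (ZMod d)ˣ, u ^ e = 1) → d.totient ∣ 2 * e) : ConditionC d := by
  refine Or.inl ⟨hodd, ?_⟩
  obtain ⟨p, a, B, hp, hpo, ha, hBo, hco, rfl⟩ := aux_split hd hodd
  have hA2 := aux_two_lt hp hpo ha
  by_cases hB1 : B = 1
  · subst hB1
    exact Or.inl ⟨p, a, hp, hpo, ha, by simp⟩
  have hB3 : 3 ≤ B := by rcases hBo with ⟨k, hk⟩; omega
  obtain ⟨q, b, C, hq, hqo, hb, hCo, hco2, rfl⟩ := aux_split hB3 hBo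
  have hQ2 := aux_two_lt hq hqo hb
  have : NeZero (p ^ a) := ⟨by omega⟩
  have : NeZero (q ^ b) := ⟨by omega⟩
  have hC0 : C ≠ 0 := by rintro rfl; simp at hCo
  have : NeZero C := ⟨hC0⟩
  have hcoq : (p ^ a).Coprime (q ^ b) := hco.coprime_mul_right_right
  have hpq : p ≠ q := by
    rintro rfl
    have := (Nat.coprime_pow_left_iff ha _ _).1 hcoq
    have := (Nat.coprime_pow_right_iff hb _ _).1 this
    rw [Nat.coprime_self] at this
    exact hp.one_lt.ne' this
  have hP : 0 < (p ^ a).totient := Nat.totient_pos.2 (by omega)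
  have hQ : 0 < (q ^ b).totient := Nat.totient_pos.2 (by omega)
  obtain ⟨m, hm⟩ := (Nat.totient_even hA2).two_dvd
  obtain ⟨n, hn⟩ := (Nat.totient_even hQ2).two_dvd
  by_cases hC1 : C = 1
  · subst hC1
    right
    refine ⟨p, q, a, b, hp, hq, hpo, hqo, hpq, ha, hb, ?_, by simp⟩
    rw [mul_one] at H
    have h := H _ (aux_exp hcoq _ _ (aux_tot _) (aux_tot _))
    rw [Nat.totient_mul hcoq] at h
    refine Nat.dvd_antisymm (aux_lcm hP hQ h) (Nat.dvd_gcd ⟨m, hm⟩ ⟨n, hn⟩)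
  · exfalso
    have hC2 : 2 < C := by rcases hCo with ⟨k, hk⟩; omega
    have hC : 0 < C.totient := Nat.totient_pos.2 (by omega)
    obtain ⟨l, hl⟩ := (Nat.totient_even hC2).two_dvd
    have h := H _ (aux_exp hco _ _ (aux_tot _) (aux_exp hco2 _ _ (aux_tot _) (aux_tot _)))
    rw [Nat.totient_mul hco, Nat.totient_mul hco2, hm, hn, hl] at h
    have h2 : Nat.lcm (2 * m) (Nat.lcm (2 * n) (2 * l)) ∣ 2 * (m * n * l) := by
      refine Nat.lcm_dvd ⟨n * l, by ring⟩ (Nat.lcm_dvd ⟨m * l, by ring⟩ ⟨m * n, by ring⟩)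
    have h3 := h.trans (mul_dvd_mul_left 2 h2)
    have hpos : 0 < m * n * l := Nat.mul_pos (Nat.mul_pos (by omega) (by omega)) (by omega)
    have h4 := Nat.le_of_dvd (by omega) h3
    have h5 : 2 * m * (2 * n * (2 * l)) = 8 * (m * n * l) := by ring
    omega

theorem aux_group {P Q G : Type*} [CommGroup P] [CommGroup Q] [Group G] [Finite P] [Finite Q]
    [IsCyclic P] [IsCyclic Q] {m : ℕ} (hP : Nat.card P = 2 * m) (hm : m.Coprime (Nat.card Q))
    (hmo : Odd m) (w : P) (v : Q) (hw : w ^ 2 = 1) (hw1 : w ≠ 1)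
    (f : P × Q →* G) (hf : Function.Surjective f) (hk : f (w, v) = 1) : IsCyclic G := by
  obtain ⟨g, hg⟩ := IsCyclic.exists_monoid_generator (α := P)
  obtain ⟨h, hh⟩ := IsCyclic.exists_monoid_generator (α := Q)
  have hog : orderOf g = 2 * m := by
    rw [← hP]
    exact orderOf_eq_card_of_forall_mem_zpowers fun x => by
      obtain ⟨k, hk⟩ := Submonoid.mem_powers_iff _ _ |>.1 (hg x)
      exact ⟨k, by simpa using hk⟩
  have hoh : orderOf h = Nat.card Q :=
    orderOf_eq_card_of_forall_mem_zpowers fun x => by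
      obtain ⟨k, hk⟩ := Submonoid.mem_powers_iff _ _ |>.1 (hh x)
      exact ⟨k, by simpa using hk⟩
  have even_case : ∀ i y, ∃ k : ℕ, (g ^ 2, h) ^ k = ((g ^ (2 * i), y) : P × Q) := by
    intro i y
    obtain ⟨j, rfl⟩ := hh y
    obtain ⟨k, hk1, hk2⟩ := Nat.chineseRemainder hm i j
    refine ⟨k, Prod.ext ?_ ?_⟩
    · change (g ^ 2) ^ k = _
      rw [← pow_mul, pow_eq_pow_iff_modEq, hog]
      exact hk1.mul_left' 2
    · change h ^ k = h ^ j
      rw [pow_eq_pow_iff_modEq, hoh]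
      exact hk2
  refine ⟨f (g ^ 2, h), fun z => ?_⟩
  obtain ⟨⟨x, y⟩, rfl⟩ := hf z
  obtain ⟨i, rfl⟩ := hg x
  obtain ⟨t, rfl⟩ := hg w
  rcases Nat.even_or_odd i with hi | hi
  · obtain ⟨i', rfl⟩ := hi.two_dvd
    obtain ⟨k, hk⟩ := even_case i' y
    refine ⟨k, ?_⟩
    simp only [zpow_natCast, ← map_pow, hk]
  · have ht : Odd t := by
      by_contra hte
      rw [Nat.not_odd_iff_even] at hte
      obtain ⟨s, rfl⟩ := hte.two_dvd
      apply hw1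
      simp only [← pow_mul] at hw ⊢
      rw [← orderOf_dvd_iff_pow_eq_one, hog] at hw ⊢
      have h1 : m ∣ 2 * s := Nat.dvd_of_mul_dvd_mul_left (k := 2) (by norm_num) (by
        rwa [mul_comm (2 * s)] at hw)
      exact mul_dvd_mul_left 2 ((Nat.Coprime.dvd_of_dvd_mul_left
        (Nat.coprime_two_right.2 hmo)) h1)
    obtain ⟨i', hi'⟩ := (hi.add_odd ht).two_dvd
    obtain ⟨k, hk'⟩ := even_case i' (y * v)
    refine ⟨k, ?_⟩
    simp only [zpow_natCast, ← map_pow, hk', ← hi']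
    have : ((g ^ (i + t), y * v) : P × Q) = (g ^ i, y) * (g ^ t, v) := by
      simp [pow_add]
    rw [this, map_mul, hk, mul_one]

theorem aux_fwd2 {p q a b : ℕ} (hp : p.Prime) (hq : q.Prime) (hpo : Odd p) (hqo : Odd q)
    (ha : 0 < a) (hco : (p ^ a).Coprime (q ^ b)) (hqb : q ^ b ≠ 0)
    {m : ℕ} (hm : (p ^ a).totient = 2 * m) (hmo : Odd m) (hmn : m.Coprime (q ^ b).totient)
    {G : Type*} [Group G]
    (f : (ZMod (p ^ a * q ^ b))ˣ →* G) (hf : Function.Surjective f) (hk : f (-1) = 1) :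
    IsCyclic G := by
  have hA2 := aux_two_lt hp hpo ha
  have : NeZero (p ^ a) := ⟨by omega⟩
  have : NeZero (q ^ b) := ⟨hqb⟩
  have := ZMod.isCyclic_units_of_prime_pow p hp (by rintro rfl; exact absurd hpo (by decide)) a
  have := ZMod.isCyclic_units_of_prime_pow q hq (by rintro rfl; exact absurd hqo (by decide)) b
  refine aux_group (P := (ZMod (p ^ a))ˣ) (Q := (ZMod (q ^ b))ˣ) (m := m) ?_ ?_ hmo (-1) (-1)
    (by simp) ?_ (f.comp (aux_crt hco).symm.toMonoidHom) (hf.comp (aux_crt hco).symm.surjective) ?_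
  · rw [Nat.card_eq_fintype_card, ZMod.card_units_eq_totient, hm]
  · rwa [Nat.card_eq_fintype_card, ZMod.card_units_eq_totient]
  · intro h
    have : Fact (2 < p ^ a) := ⟨hA2⟩
    exact ZMod.neg_one_ne_one (congrArg Units.val h)
  · change f ((aux_crt hco).symm (-1, -1)) = 1
    rw [← aux_crt_neg hco, MulEquiv.symm_apply_apply, hk]

theorem aux_fwd {d : ℕ} (hodd : Odd d) (hC : ConditionC d) {G : Type*} [Group G]
    (f : (ZMod d)ˣ →* G) (hf : Function.Surjective f) (hk : f (-1) = 1) : IsCyclic G := by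
  rcases hC with ⟨_, hC⟩ | ⟨he, _⟩
  swap
  · exact absurd he (Nat.not_even_iff_odd.2 hodd)
  rcases hC with ⟨p, a, hp, hpo, ha, rfl⟩ | ⟨p, q, a, b, hp, hq, hpo, hqo, hpq, ha, hb, hg, rfl⟩
  · have := ZMod.isCyclic_units_of_prime_pow p hp (by rintro rfl; exact absurd hpo (by decide)) a
    exact isCyclic_of_surjective f hf
  · have hA2 := aux_two_lt hp hpo ha
    have hB2 := aux_two_lt hq hqo hb
    have hco : (p ^ a).Coprime (q ^ b) := ((Nat.coprime_primes hp hq).2 hpq).pow a b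
    obtain ⟨m, hm⟩ := (Nat.totient_even hA2).two_dvd
    obtain ⟨n, hn⟩ := (Nat.totient_even hB2).two_dvd
    have hmn : m.Coprime n := by
      rw [hm, hn, Nat.gcd_mul_left] at hg
      exact Nat.coprime_iff_gcd_eq_one.2 (by omega)
    rcases Nat.even_or_odd m with hme | hmo
    · have hno : Odd n := by
        by_contra h
        rw [Nat.not_odd_iff_even] at h
        exact Nat.not_coprime_of_dvd_of_dvd (by norm_num) hme.two_dvd h.two_dvd hmn
      revert f
      rw [mul_comm]
      intro f hf hk
      exact aux_fwd2 hq hp hqo hpo hb hco.symm (by omega) hn hno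
        (hm ▸ Nat.Coprime.mul_right (Nat.coprime_two_right.2 hno) hmn.symm) f hf hk
    · exact aux_fwd2 hp hq hpo hqo ha hco (by omega) hm hmo
        (hn ▸ Nat.Coprime.mul_right (Nat.coprime_two_right.2 hmo) hmn) f hf hk

/-- For odd `d ≥ 3` and `ρ` a primitive `2d`-th root of unity in `ℂ`, the Galois group of
`ℚ(ρ + ρ⁻¹)` over `ℚ` is cyclic if and only if `d` satisfies Condition 𝒞. -/
theorem stmt_3 (d : ℕ) (hd : 3 ≤ d) (hodd : Odd d) (ρ : ℂ)
    (hρ : IsPrimitiveRoot ρ (2 * d)) :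
    IsCyclic (ℚ⟮ρ + ρ⁻¹⟯ ≃ₐ[ℚ] ℚ⟮ρ + ρ⁻¹⟯) ↔ ConditionC d := by
  have : NeZero d := ⟨by omega⟩
  have hpd : ρ ^ d = -1 := by
    have h2 : IsPrimitiveRoot (ρ ^ d) 2 := hρ.pow (by omega) (mul_comm _ _)
    exact h2.eq_neg_one_of_two_right
  have hζ : IsPrimitiveRoot (-ρ) d := by
    refine ⟨by rw [hodd.neg_pow, hpd, neg_neg], fun l hl => ?_⟩
    have h1 : ρ ^ (2 * l) = 1 := by
      rw [mul_comm, pow_mul, ← neg_sq, ← neg_sq (-_ : ℂ), neg_neg, ← pow_mul, mul_comm, pow_mul,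
        ← neg_sq ρ, ← pow_mul, mul_comm, pow_mul, hl, one_pow]
    exact Nat.dvd_of_mul_dvd_mul_left (by norm_num) (hρ.dvd_of_pow_eq_one _ h1)
  have hE : ℚ⟮ρ + ρ⁻¹⟯ = ℚ⟮-ρ + (-ρ)⁻¹⟯ := by
    have h1 : -ρ + (-ρ)⁻¹ = -(ρ + ρ⁻¹) := by rw [inv_neg]; ring
    rw [h1]
    apply le_antisymm
    · rw [IntermediateField.adjoin_simple_le_iff]
      simpa only [neg_neg] using neg_mem (IntermediateField.mem_adjoin_simple_self ℚ (-(ρ + ρ⁻¹)))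
    · rw [IntermediateField.adjoin_simple_le_iff]
      exact neg_mem (IntermediateField.mem_adjoin_simple_self ℚ _)
  rw [hE]
  obtain ⟨f, hf, hk⟩ := aux_gal d ℚ ℂ (cyclotomic.irreducible_rat (NeZero.pos d)) (-ρ) hζ
  constructor
  · intro hc
    exact aux_conv hd hodd fun e he => aux_dvd hc f hf hk e he
  · intro hC
    exact aux_fwd hodd hC f hf ((hk _).2 (Or.inr rfl))
end

section
/- Let N ≥ 3 be an odd integer and let ζ ∈ ℂ be a primitive N-th root of unity. Then the Galois group of the maximal real subfield ℚ(ζ + ζ^{−1}) of ℚ(ζ) over ℚ is cyclic if and only if N satisfies Condition C. -/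
open Polynomial IntermediateField

theorem galAux {k K L : Type*} [Field k] [Field K] [Field L] [Algebra k K] [Algebra k L]
    (N : ℕ) (hN : 3 ≤ N) (hirr : Irreducible (cyclotomic N k)) [NeZero N]
    [IsCyclotomicExtension {N} k K] [IsAbelianGalois k K] (i : K →ₐ[k] L) (z : K)
    (hz : IsPrimitiveRoot z N) :
    ∃ f : (ZMod N)ˣ →* (k⟮i z + (i z)⁻¹⟯ ≃ₐ[k] k⟮i z + (i z)⁻¹⟯), Function.Surjective f ∧
      ∀ u, f u = 1 ↔ u = 1 ∨ u = -1 := by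
  have hz0 : z ≠ 0 := hz.ne_zero (by omega)
  let E : IntermediateField k K := k⟮z + z⁻¹⟯
  have hE : E.map i = k⟮i z + (i z)⁻¹⟯ := by
    simp only [E]
    rw [adjoin_map]
    simp
  let e : E ≃ₐ[k] k⟮i z + (i z)⁻¹⟯ := (E.equivMap i).trans (equivOfEq hE)
  let g := IsCyclotomicExtension.autEquivPow K hirr
  let r : Gal(K/k) →* Gal(E/k) := AlgEquiv.restrictNormalHom E
  have hr : Function.Surjective r := AlgEquiv.restrictNormalHom_surjective _
  have key : ∀ σ : Gal(K/k), r σ = 1 ↔ g σ = 1 ∨ g σ = -1 := by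
    intro σ
    have h1 : r σ = 1 ↔ σ (z + z⁻¹) = z + z⁻¹ := by
      constructor
      · intro h
        have := AlgEquiv.restrictNormalHom_apply E σ (AdjoinSimple.gen k (z + z⁻¹))
        change ((r σ) _ : K) = _ at this
        rw [h] at this
        simpa using this.symm
      · intro h
        have : (r σ).toAlgHom = AlgHom.id k E := by
          refine IntermediateField.algHom_ext_of_eq_adjoin k (S := E) (s := ({z + z⁻¹} : Set K)) rfl ?_
          intro x hx
          rw [Set.mem_singleton_iff] at hx
          subst hx
          apply Subtype.ext
          have := AlgEquiv.restrictNormalHom_apply E σ (AdjoinSimple.gen k (z + z⁻¹))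
          exact this.trans h
        ext x
        exact congrArg Subtype.val (DFunLike.congr_fun this x)
    have h2 : σ z = z ^ (g σ).val.val :=
      by
      obtain ⟨a, -, ha⟩ := (IsCyclotomicExtension.zeta_spec N k K).eq_pow_of_pow_eq_one
        hz.pow_eq_one
      rw [← ha, map_pow, pow_right_comm]
      simp only [g]
      rw [IsCyclotomicExtension.autEquivPow_apply, OneHom.toFun_eq_coe,
        MonoidHom.toOneHom_coe, IsPrimitiveRoot.autToPow_spec]
    have h3 : σ (z + z⁻¹) = z + z⁻¹ ↔ σ z = z ∨ σ z = z⁻¹ := by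
      have hs0 : σ z ≠ 0 := by simpa using hz0
      rw [map_add, map_inv₀]
      constructor
      · intro h
        have : (σ z - z) * (σ z - z⁻¹) = 0 := by
          field_simp at h ⊢
          linear_combination h
        rcases mul_eq_zero.1 this with h | h
        · left; exact sub_eq_zero.1 h
        · right; exact sub_eq_zero.1 h
      · rintro (h | h)
        · rw [h]
        · rw [h, inv_inv, add_comm]
    have h4 : ∀ k : ℕ, z ^ (g σ).val.val = z ^ k ↔ (g σ).val = (k : ZMod N) := by
      intro k
      rw [(hz.isOfFinOrder (NeZero.ne _)).pow_inj_mod, ← hz.eq_orderOf,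
        ← ZMod.natCast_eq_natCast_iff', ZMod.natCast_val, ZMod.cast_id]
    have h5 : z⁻¹ = z ^ (N - 1) := by
      apply inv_eq_of_mul_eq_one_right
      rw [← pow_succ', Nat.sub_add_cancel (by omega), hz.pow_eq_one]
    rw [h1, h3, h2, h5, h4]
    have h6 := h4 1
    rw [pow_one] at h6
    rw [h6, Units.ext_iff, Units.ext_iff]
    have : ((N - 1 : ℕ) : ZMod N) = -1 := by
      rw [Nat.cast_sub (by omega)]; simp
    rw [this]; simp
  refine ⟨(AlgEquiv.autCongr e).toMonoidHom.comp (r.comp g.symm.toMonoidHom), ?_, ?_⟩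
  · exact (AlgEquiv.autCongr e).surjective.comp (hr.comp g.symm.surjective)
  · intro u
    have := key (g.symm u)
    rw [MulEquiv.apply_symm_apply] at this
    rw [← this]
    exact MulEquiv.map_eq_one_iff (AlgEquiv.autCongr e)

theorem galGen {k L : Type*} [Field k] [CharZero k] [Field L] [Algebra k L] [IsAlgClosed L]
    (N : ℕ) (hN : 3 ≤ N) (hirr : Irreducible (cyclotomic N k))
    (ζ : L) (hζ : IsPrimitiveRoot ζ N) :
    ∃ f : (ZMod N)ˣ →* (k⟮ζ + ζ⁻¹⟯ ≃ₐ[k] k⟮ζ + ζ⁻¹⟯), Function.Surjective f ∧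
      ∀ u, f u = 1 ↔ u = 1 ∨ u = -1 := by
  have : NeZero N := ⟨by omega⟩
  have : FiniteDimensional k (CyclotomicField N k) :=
    IsCyclotomicExtension.finiteDimensional {N} k _
  have : IsAbelianGalois k (CyclotomicField N k) :=
    IsCyclotomicExtension.isAbelianGalois {N} k _
  let i : CyclotomicField N k →ₐ[k] L := IsAlgClosed.lift
  have hz := IsCyclotomicExtension.zeta_spec N k (CyclotomicField N k)
  obtain ⟨a, -, ha⟩ := (hz.map_of_injective i.injective).eq_pow_of_pow_eq_one hζ.pow_eq_one
  generalize IsCyclotomicExtension.zeta N k (CyclotomicField N k) = z at *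
  have ha' : i (z ^ a) = ζ := by rw [map_pow]; exact ha
  clear_value i
  subst ha'
  exact galAux N hN hirr i _ (hζ.of_map_of_injective i.injective)

theorem ratAlgTransfer {F : Type*} [Field F] (N : ℕ) (i1 i2 : Algebra ℚ F)
    (h : ∃ f : (ZMod N)ˣ →* (@AlgEquiv ℚ F F _ _ _ i1 i1), Function.Surjective f ∧
      ∀ u, f u = 1 ↔ u = 1 ∨ u = -1) :
    ∃ f : (ZMod N)ˣ →* (@AlgEquiv ℚ F F _ _ _ i2 i2), Function.Surjective f ∧
      ∀ u, f u = 1 ↔ u = 1 ∨ u = -1 := by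
  obtain rfl : i1 = i2 := Subsingleton.elim _ _
  exact h

theorem galA (N : ℕ) (hN : 3 ≤ N) (ζ : ℂ) (hζ : IsPrimitiveRoot ζ N) :
    ∃ f : (ZMod N)ˣ →* (ℚ⟮ζ + ζ⁻¹⟯ ≃ₐ[ℚ] ℚ⟮ζ + ζ⁻¹⟯), Function.Surjective f ∧
      ∀ u, f u = 1 ↔ u = 1 ∨ u = -1 := by
  exact ratAlgTransfer N _ _
    (galGen (k := ℚ) N hN (cyclotomic.irreducible_rat (by omega)) ζ hζ)

section carm
open ArithmeticFunction

theorem cardB {N : ℕ} (hN : 3 ≤ N) {Q : Type*} [Group Q] (f : (ZMod N)ˣ →* Q)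
    (hf : Function.Surjective f) (hk : ∀ u, f u = 1 ↔ u = 1 ∨ u = -1) (hQ : IsCyclic Q) :
    N.totient ≤ 2 * carmichael N := by
  have : NeZero N := ⟨by omega⟩
  obtain ⟨g, hg⟩ := hQ.exists_generator
  have : Finite Q := Finite.of_surjective f hf
  have h1 : Nat.card Q ≤ carmichael N := by
    rw [← orderOf_eq_card_of_forall_mem_zpowers hg]
    have hc : 0 < carmichael N := by
      rw [carmichael_eq_exponent']
      exact Nat.pos_of_ne_zero Monoid.exponent_ne_zero_of_finite
    refine orderOf_le_of_pow_eq_one hc ?_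
    obtain ⟨u, rfl⟩ := hf g
    rw [← map_pow, carmichael_eq_exponent', Monoid.pow_exponent_eq_one, map_one]
  have h2 : Nat.card f.ker ≤ 2 := by
    have : (f.ker : Set (ZMod N)ˣ) = {1, -1} := by
      ext u; simp [MonoidHom.mem_ker, hk]
    have h3 : Nat.card f.ker = Set.ncard ({1, -1} : Set (ZMod N)ˣ) := by
      rw [← this]; rfl
    rw [h3]
    exact (Set.ncard_insert_le _ _).trans (by simp)
  have h3 := Subgroup.card_eq_card_quotient_mul_card_subgroup f.ker
  rw [Nat.card_congr (QuotientGroup.quotientKerEquivOfSurjective f hf).toEquiv] at h3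
  rw [Nat.card_eq_fintype_card, ZMod.card_units_eq_totient] at h3
  rw [h3]
  nlinarith

theorem carm_dvd_lcm {u v : ℕ} (h : u.Coprime v) :
    carmichael (u * v) ∣ Nat.lcm u.totient v.totient := by
  rw [carmichael_mul h]
  exact lcm_dvd_lcm (carmichael_dvd_totient _) (carmichael_dvd_totient _)

theorem gcdTwo {u v : ℕ} (hu : 2 < u) (hv : 2 < v) (h : u.Coprime v)
    (hle : (u * v).totient ≤ 2 * carmichael (u * v)) :
    Nat.gcd u.totient v.totient = 2 := by
  have h1 := Nat.dvd_gcd (Nat.totient_even hu).two_dvd (Nat.totient_even hv).two_dvd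
  have p1 : 0 < u.totient := Nat.totient_pos.2 (by omega)
  have p2 : 0 < v.totient := Nat.totient_pos.2 (by omega)
  have hl : 0 < Nat.lcm u.totient v.totient := Nat.lcm_pos p1 p2
  have h2 := Nat.le_of_dvd hl (carm_dvd_lcm h)
  rw [Nat.totient_mul h, ← Nat.gcd_mul_lcm] at hle
  have : Nat.gcd u.totient v.totient ≤ 2 := by
    by_contra hc
    push Not at hc
    nlinarith
  have := Nat.le_of_dvd (Nat.gcd_pos_of_pos_left _ p1) h1
  omega

theorem noThree {u v w : ℕ} (hu : 2 < u) (hv : 2 < v) (hw : 2 < w) (h : u.Coprime v)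
    (h' : (u * v).Coprime w)
    (hle : (u * v * w).totient ≤ 2 * carmichael (u * v * w)) : False := by
  have p1 : 0 < u.totient := Nat.totient_pos.2 (by omega)
  have p2 : 0 < v.totient := Nat.totient_pos.2 (by omega)
  have p3 : 0 < w.totient := Nat.totient_pos.2 (by omega)
  have e1 := Nat.dvd_gcd (Nat.totient_even hu).two_dvd (Nat.totient_even hv).two_dvd
  have e2 : 2 ∣ Nat.gcd (Nat.lcm u.totient v.totient) w.totient :=
    Nat.dvd_gcd ((Nat.totient_even hu).two_dvd.trans (Nat.dvd_lcm_left _ _))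
      (Nat.totient_even hw).two_dvd
  have g1 := Nat.le_of_dvd (Nat.gcd_pos_of_pos_left _ p1) e1
  have g2 := Nat.le_of_dvd (Nat.gcd_pos_of_pos_right _ p3) e2
  have hl : 0 < Nat.lcm (Nat.lcm u.totient v.totient) w.totient :=
    Nat.lcm_pos (Nat.lcm_pos p1 p2) p3
  have h2 : carmichael (u * v * w) ≤ Nat.lcm (Nat.lcm u.totient v.totient) w.totient := by
    apply Nat.le_of_dvd hl
    rw [carmichael_mul h']
    exact lcm_dvd_lcm (carm_dvd_lcm h) (carmichael_dvd_totient _)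
  rw [Nat.totient_mul h', Nat.totient_mul h, ← Nat.gcd_mul_lcm u.totient v.totient, mul_assoc,
    ← Nat.gcd_mul_lcm (Nat.lcm u.totient v.totient)] at hle
  have := Nat.mul_le_mul g1 (Nat.mul_le_mul_right (Nat.lcm (Nat.lcm u.totient v.totient) w.totient) g2)
  omega

theorem cyclicD {A B Q : Type*} [CommGroup A] [CommGroup B] [Group Q] [Finite A] [Finite B]
    [IsCyclic A] [IsCyclic B] (f : A × B →* Q) (hf : Function.Surjective f) (s : A) (t : B)
    (hst : f (s, t) = 1) (hs : s ≠ 1) (hs2 : s ^ 2 = 1) (m : ℕ) (hm : Odd m)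
    (hA : Nat.card A = 2 * m) (hB : Nat.Coprime m (Nat.card B)) : IsCyclic Q := by
  let H : Subgroup A := (powMonoidHom 2 : A →* A).range
  have hidx : H.index = 2 := by
    simp only [H]
    rw [IsCyclic.index_powMonoidHom_range, hA]
    simp
  have hcard : Nat.card H = m := by
    have := H.card_mul_index
    rw [hidx, hA] at this; omega
  have hsH : s ∉ H := by
    intro h
    have h1 : orderOf s = 2 := orderOf_eq_prime hs2 hs
    have h2 := Subgroup.orderOf_dvd_natCard H h
    rw [h1, hcard] at h2
    exact (Nat.not_even_iff_odd.2 hm) (even_iff_two_dvd.2 h2)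
  have : IsCyclic (H × B) := Group.isCyclic_prod_iff.2 ⟨inferInstance, inferInstance, by rwa [hcard]⟩
  refine isCyclic_of_surjective (f.comp (MonoidHom.prodMap H.subtype (MonoidHom.id B))) ?_
  intro y
  obtain ⟨⟨a, b⟩, rfl⟩ := hf y
  by_cases ha : a ∈ H
  · exact ⟨(⟨a, ha⟩, b), rfl⟩
  · have : a * s ∈ H := by rw [Subgroup.mul_mem_iff_of_index_two hidx]; tauto
    refine ⟨(⟨a * s, this⟩, b * t), ?_⟩
    change f (a * s, b * t) = f (a, b)
    rw [← Prod.mk_mul_mk, map_mul, hst, mul_one]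

theorem cyclicE {u v : ℕ} (hu : 2 < u) (hv : 2 < v) (h : u.Coprime v) (cu : IsCyclic (ZMod u)ˣ)
    (cv : IsCyclic (ZMod v)ˣ) (hg : Nat.gcd u.totient v.totient = 2)
    {Q : Type*} [Group Q] (f : (ZMod (u * v))ˣ →* Q)
    (hf : Function.Surjective f) (hk : f (-1) = 1) : IsCyclic Q := by
  have : NeZero u := ⟨by omega⟩
  have : NeZero v := ⟨by omega⟩
  have : Fact (2 < u) := ⟨hu⟩
  have : Fact (2 < v) := ⟨hv⟩
  let e : (ZMod (u * v))ˣ ≃* (ZMod u)ˣ × (ZMod v)ˣ :=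
    (Units.mapEquiv (ZMod.chineseRemainder h).toMulEquiv).trans MulEquiv.prodUnits
  have he : e (-1) = (-1, -1) := by
    apply Prod.ext <;> apply Units.ext
    · change (ZMod.chineseRemainder h (-1)).1 = -1
      simp
    · change (ZMod.chineseRemainder h (-1)).2 = -1
      simp
  have he' : e.symm (-1, -1) = -1 := by rw [← he, MulEquiv.symm_apply_apply]
  let F : (ZMod u)ˣ × (ZMod v)ˣ →* Q := f.comp e.symm.toMonoidHom
  have hF : Function.Surjective F := hf.comp e.symm.surjective
  have hF1 : F (-1, -1) = 1 := by
    change f (e.symm (-1, -1)) = 1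
    rw [he', hk]
  obtain ⟨m, hm⟩ := (Nat.totient_even hu).two_dvd
  obtain ⟨n, hn⟩ := (Nat.totient_even hv).two_dvd
  have cardu : Nat.card (ZMod u)ˣ = 2 * m := by
    rw [Nat.card_eq_fintype_card, ZMod.card_units_eq_totient, hm]
  have cardv : Nat.card (ZMod v)ˣ = 2 * n := by
    rw [Nat.card_eq_fintype_card, ZMod.card_units_eq_totient, hn]
  have hmn : Nat.Coprime m n := by
    rw [hm, hn, Nat.gcd_mul_left] at hg
    exact Nat.eq_of_mul_eq_mul_left two_pos hg
  have nu : (-1 : (ZMod u)ˣ) ≠ 1 := by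
    intro hh
    exact ZMod.neg_one_ne_one (n := u) (by simpa using congrArg Units.val hh)
  have nv : (-1 : (ZMod v)ˣ) ≠ 1 := by
    intro hh
    exact ZMod.neg_one_ne_one (n := v) (by simpa using congrArg Units.val hh)
  rcases Nat.even_or_odd m with hme | hmo
  · have hno : Odd n := by
      rw [← Nat.not_even_iff_odd]
      intro hne
      have := Nat.dvd_gcd hme.two_dvd hne.two_dvd
      rw [hmn] at this; omega
    refine cyclicD (F.comp (MulEquiv.prodComm (M := (ZMod v)ˣ) (N := (ZMod u)ˣ)).toMonoidHom)
      (hF.comp (MulEquiv.prodComm).surjective) (-1) (-1) hF1 nv (by simp) n hno cardv ?_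
    rw [cardu]
    exact Nat.Coprime.mul_right (Nat.coprime_two_right.2 hno) hmn.symm
  · refine cyclicD F hF (-1) (-1) hF1 nu (by simp) m hmo cardu ?_
    rw [cardv]
    exact Nat.Coprime.mul_right (Nat.coprime_two_right.2 hmo) hmn

end carm

theorem totient_stmt_aux {N : ℕ} (hN : 3 ≤ N) (hodd : Odd N)
    (hle : N.totient ≤ 2 * ArithmeticFunction.carmichael N) : ConditionC N := by
  have odd3 : ∀ {m : ℕ}, Odd m → m ≠ 1 → 2 < m := by
    rintro m ⟨t, rfl⟩ h; omega
  refine Or.inl ⟨hodd, ?_⟩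
  have hp : (N.minFac).Prime := Nat.minFac_prime (by omega)
  have hpd := N.minFac_dvd
  generalize N.minFac = p at *
  have hpo : Odd p := hodd.of_dvd_nat hpd
  obtain ⟨a, m, hpm, hNm⟩ := Nat.exists_eq_pow_mul_and_not_dvd (n := N) (by omega) p hp.ne_one
  have ha : 0 < a := by
    rcases Nat.eq_zero_or_pos a with rfl | h
    · rw [pow_zero, one_mul] at hNm; exact absurd (hNm ▸ hpd) hpm
    · exact h
  have hpa : 2 < p ^ a := odd3 hpo.pow (by simp [hp.ne_one, ha.ne'])
  have hcop : ∀ t, Nat.Coprime p t → Nat.Coprime (p ^ a) t := fun t h => h.pow_left a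
  have hpm' := (Nat.Prime.coprime_iff_not_dvd hp).2 hpm
  by_cases hm1 : m = 1
  · exact Or.inl ⟨p, a, hp, hpo, ha, by rw [hNm, hm1, mul_one]⟩
  have hmo : Odd m := hodd.of_dvd_nat ⟨p ^ a, by rw [hNm, mul_comm]⟩
  have hq : (m.minFac).Prime := Nat.minFac_prime hm1
  have hqd := m.minFac_dvd
  generalize m.minFac = q at *
  have hqo : Odd q := hmo.of_dvd_nat hqd
  have hm3 := odd3 hmo hm1
  obtain ⟨b, w, hqw, hmw⟩ := Nat.exists_eq_pow_mul_and_not_dvd (n := m) (by omega) q hq.ne_one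
  have hb : 0 < b := by
    rcases Nat.eq_zero_or_pos b with rfl | h
    · rw [pow_zero, one_mul] at hmw; exact absurd (hmw ▸ hqd) hqw
    · exact h
  have hqb : 2 < q ^ b := odd3 hqo.pow (by simp [hq.ne_one, hb.ne'])
  have hpq : p ≠ q := fun h => hpm (h ▸ hqd)
  have hqw' := (Nat.Prime.coprime_iff_not_dvd hq).2 hqw
  by_cases hw1 : w = 1
  · rw [hw1, mul_one] at hmw
    subst hmw
    subst hNm
    exact Or.inr ⟨p, q, a, b, hp, hq, hpo, hqo, hpq, ha, hb,
      gcdTwo hpa hqb (hpm'.pow_left a) hle, rfl⟩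
  exfalso
  have hwo : Odd w := hmo.of_dvd_nat ⟨q ^ b, by rw [hmw, mul_comm]⟩
  subst hmw
  have h1 : Nat.Coprime p (q ^ b) := Nat.Coprime.coprime_mul_right_right hpm'
  have h2 : Nat.Coprime p w := Nat.Coprime.coprime_mul_left_right hpm'
  rw [hNm, ← mul_assoc] at hle
  exact noThree hpa hqb (odd3 hwo hw1) (h1.pow_left a)
    (Nat.Coprime.mul_left (h2.pow_left a) (hqw'.pow_left b)) hle

/-- For odd `N ≥ 3` and `ζ` a primitive `N`-th root of unity in `ℂ`, the Galois group of
the maximal real subfield `ℚ(ζ + ζ⁻¹)` of `ℚ(ζ)` over `ℚ` is cyclic if and only if `N`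
satisfies Condition 𝒞. -/
theorem stmt_4 (N : ℕ) (hN : 3 ≤ N) (hodd : Odd N) (ζ : ℂ)
    (hζ : IsPrimitiveRoot ζ N) :
    IsCyclic (ℚ⟮ζ + ζ⁻¹⟯ ≃ₐ[ℚ] ℚ⟮ζ + ζ⁻¹⟯) ↔ ConditionC N := by
  obtain ⟨f, hf, hk⟩ := galA N hN ζ hζ
  constructor
  · intro hQ
    exact totient_stmt_aux hN hodd (cardB hN f hf hk hQ)
  · have hk1 : f (-1) = 1 := (hk _).2 (Or.inr rfl)
    have ne2 : ∀ {p : ℕ}, Odd p → p ≠ 2 := by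
      rintro p ⟨t, rfl⟩; omega
    have gt2 : ∀ {p a : ℕ}, p.Prime → Odd p → 0 < a → 2 < p ^ a := by
      intro p a hp ho ha
      have h1 := hp.two_le
      have h2 := ne2 ho
      have h3 := Nat.le_self_pow ha.ne' p
      omega
    rintro (⟨-, h⟩ | ⟨he, -⟩)
    · rcases h with ⟨p, a, hp, ho, ha, h⟩ | ⟨p, q, a, b, hp, hq, hpo, hqo, hpq, ha, hb, hg, h⟩
      · have := ZMod.isCyclic_units_of_prime_pow p hp (ne2 ho) a
        rw [← h] at this
        exact isCyclic_of_surjective f hf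
      · clear hk
        subst h
        exact cyclicE (gt2 hp hpo ha) (gt2 hq hqo hb)
          (Nat.Coprime.pow _ _ ((Nat.coprime_primes hp hq).2 hpq))
          (ZMod.isCyclic_units_of_prime_pow p hp (ne2 hpo) a)
          (ZMod.isCyclic_units_of_prime_pow q hq (ne2 hqo) b) hg f hf hk1
    · exact absurd he (Nat.not_even_iff_odd.2 hodd)
end

section
/- Let N ≥ 6 be an integer with N ≡ 2 (mod 4) and let ζ ∈ ℂ be a primitive N-th root of unity. Then the Galois group of the maximal real subfield ℚ(ζ + ζ^{−1}) of ℚ(ζ) over ℚ is cyclic if and only if N satisfies Condition C. -/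
open Polynomial IntermediateField

/-- The units are, up to sign, the powers of one element. -/
def CycSign (R : Type*) [CommRing R] : Prop :=
  ∃ g : Rˣ, ∀ u : Rˣ, ∃ k : ℤ, u = g ^ k ∨ u = -(g ^ k)

lemma cycSign_iff {R Q : Type*} [CommRing R] [Group Q] (f : Rˣ →* Q)
    (hf : Function.Surjective f) (hk : ∀ u, f u = 1 ↔ u = 1 ∨ u = -1) :
    IsCyclic Q ↔ CycSign R := by
  constructor
  · rintro ⟨h, hh⟩
    obtain ⟨g, rfl⟩ := hf h
    refine ⟨g, fun u => ?_⟩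
    obtain ⟨k, hk'⟩ := hh (f u)
    refine ⟨k, ?_⟩
    have h1 : f (u * (g ^ k)⁻¹) = 1 := by
      simp only [map_mul, map_inv, map_zpow]
      rw [← hk']; simp
    rcases (hk _).1 h1 with h | h
    · left; exact mul_inv_eq_one.1 h
    · right; rw [mul_inv_eq_iff_eq_mul] at h; rw [h]; simp
  · rintro ⟨g, hg⟩
    refine ⟨f g, fun q => ?_⟩
    obtain ⟨u, rfl⟩ := hf q
    obtain ⟨k, h | h⟩ := hg u
    · exact ⟨k, by simp [h]⟩
    · refine ⟨k, ?_⟩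
      have h1 : f (-1) = 1 := (hk _).2 (Or.inr rfl)
      have h2 : u = (-1) * g ^ k := by rw [h]; simp
      rw [h2, map_mul, h1]; simp

lemma galois_side_aux {k E : Type*} [Field k] [Field E] [Algebra k E] (N : ℕ) (hN : 6 ≤ N)
    (hirr : Irreducible (cyclotomic N k)) (ζ : E) (hζ : IsPrimitiveRoot ζ N) :
    IsCyclic (k⟮ζ + ζ⁻¹⟯ ≃ₐ[k] k⟮ζ + ζ⁻¹⟯) ↔ CycSign (ZMod N) := by
  have : NeZero N := ⟨by omega⟩
  have hcyc : IsCyclotomicExtension {N} k k⟮ζ⟯ :=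
    (IntermediateField.isCyclotomicExtension_singleton_iff_eq_adjoin N k E k⟮ζ⟯ hζ).2 rfl
  have := IsCyclotomicExtension.isAbelianGalois {N} k k⟮ζ⟯
  let z : k⟮ζ⟯ := AdjoinSimple.gen k ζ
  have hz : IsPrimitiveRoot z N := IsPrimitiveRoot.coe_submonoidClass_iff.mp hζ
  let F : IntermediateField k k⟮ζ⟯ := k⟮z + z⁻¹⟯
  have hF : lift F = k⟮ζ + ζ⁻¹⟯ := by
    rw [lift_adjoin_simple]; rfl
  rw [← hF, ← (AlgEquiv.autCongr (liftAlgEquiv F)).isCyclic]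
  let e := IsCyclotomicExtension.autEquivPow k⟮ζ⟯ hirr
  let r := AlgEquiv.restrictNormalHom (F := k) (K₁ := k⟮ζ⟯) F
  have hz0 : z ≠ 0 := hz.ne_zero (by omega)
  have hspec : ∀ σ : k⟮ζ⟯ ≃ₐ[k] k⟮ζ⟯, σ z = z ^ ((e σ : ZMod N).val) := by
    intro σ
    have hs := IsCyclotomicExtension.zeta_spec N k k⟮ζ⟯
    obtain ⟨j, -, hj⟩ := hs.eq_pow_of_pow_eq_one hz.pow_eq_one
    rw [← hj, map_pow, ← hs.autToPow_spec k σ, ← pow_mul, ← pow_mul, mul_comm]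
    rfl
  refine cycSign_iff (r.comp e.symm.toMonoidHom) ?_ ?_
  · exact (AlgEquiv.restrictNormalHom_surjective (F := k) (K₁ := F) (E := k⟮ζ⟯)).comp
      e.symm.surjective
  · intro u
    have h1 : (r.comp e.symm.toMonoidHom) u = 1 ↔ e.symm u ∈ r.ker := by
      rw [MonoidHom.mem_ker]; rfl
    rw [h1, IntermediateField.restrictNormalHom_ker]
    have h2 : e.symm u ∈ F.fixingSubgroup ↔ e.symm u (z + z⁻¹) = z + z⁻¹ := by
      rw [IntermediateField.mem_fixingSubgroup_iff]
      constructor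
      · intro h
        exact h _ (mem_adjoin_simple_self k _)
      · intro h x hx
        have hle : F ≤ IntermediateField.fixedField (Subgroup.zpowers (e.symm u)) := by
          rw [adjoin_simple_le_iff]
          rintro ⟨m, hm⟩
          have : Subgroup.zpowers (e.symm u) ≤ MulAction.stabilizer _ (z + z⁻¹) := by
            rw [Subgroup.zpowers_le]; exact h
          exact this hm
        exact hle hx ⟨_, Subgroup.mem_zpowers _⟩
    rw [h2, map_add, map_inv₀]
    have h3 := hspec (e.symm u)
    rw [MulEquiv.apply_symm_apply] at h3
    have h4 : e.symm u z + (e.symm u z)⁻¹ = z + z⁻¹ ↔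
        e.symm u z = z ∨ e.symm u z = z⁻¹ := by
      have hw0 : e.symm u z ≠ 0 := by simpa using hz0
      generalize e.symm u z = w at *
      constructor
      · intro h
        have : (w - z) * (w - z⁻¹) = 0 := by
          field_simp at h ⊢
          linear_combination h
        rcases mul_eq_zero.1 this with h | h
        · left; exact sub_eq_zero.1 h
        · right; exact sub_eq_zero.1 h
      · rintro (rfl | rfl)
        · rfl
        · rw [inv_inv, add_comm]
    rw [h4, h3]
    have hpow : ∀ v : (ZMod N)ˣ, z ^ ((u : ZMod N).val) = z ^ ((v : ZMod N).val) ↔ u = v := by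
      intro v
      rw [Units.ext_iff]
      constructor
      · intro h
        exact ZMod.val_injective N (hz.pow_inj (ZMod.val_lt _) (ZMod.val_lt _) h)
      · intro h; rw [h]
    refine or_congr ?_ ?_
    · rw [← hpow 1]
      have : Fact (1 < N) := ⟨by omega⟩
      simp [ZMod.val_one]
    · rw [← hpow (-1)]
      have : z ^ (((-1 : (ZMod N)ˣ) : ZMod N).val) = z⁻¹ := by
        obtain ⟨n, rfl⟩ : ∃ n, N = n + 1 := ⟨N - 1, by omega⟩
        simp only [Units.val_neg, Units.val_one, ZMod.val_neg_one]
        exact eq_inv_of_mul_eq_one_left (by rw [← pow_succ, hz.pow_eq_one])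
      rw [this]

lemma galois_side (N : ℕ) (hN : 6 ≤ N) (ζ : ℂ) (hζ : IsPrimitiveRoot ζ N) :
    IsCyclic (ℚ⟮ζ + ζ⁻¹⟯ ≃ₐ[ℚ] ℚ⟮ζ + ζ⁻¹⟯) ↔ CycSign (ZMod N) :=
  galois_side_aux N hN (Polynomial.cyclotomic.irreducible_rat (by omega)) ζ hζ

lemma card_bound (N L : ℕ) (hN : 0 < N) (hL : 0 < L) (hC : CycSign (ZMod N))
    (h : ∀ u : (ZMod N)ˣ, u ^ L = 1) : N.totient ≤ 2 * L := by
  have : NeZero N := ⟨by omega⟩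
  obtain ⟨g, hg⟩ := hC
  rw [← ZMod.card_units_eq_totient]
  have hs : Function.Surjective (fun x : Bool × Fin L =>
      if x.1 then g ^ (x.2 : ℕ) else -(g ^ (x.2 : ℕ))) := by
    intro u
    obtain ⟨k, hk⟩ := hg u
    have hL' : (L : ℤ) ≠ 0 := by omega
    have h0 := Int.emod_nonneg k hL'
    have h1 := Int.emod_lt_of_pos k (show (0 : ℤ) < L by omega)
    have hgk : g ^ k = g ^ (k % L).toNat := by
      rw [← zpow_natCast, Int.toNat_of_nonneg h0]
      conv_lhs => rw [← Int.emod_add_mul_ediv k L, zpow_add, zpow_mul, zpow_natCast, h]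
      simp
    rcases hk with hk | hk
    · exact ⟨(true, ⟨(k % L).toNat, by omega⟩), by simp [hk, hgk]⟩
    · exact ⟨(false, ⟨(k % L).toNat, by omega⟩), by simp [hk, hgk]⟩
  have := Fintype.card_le_of_surjective _ hs
  simpa using this

lemma pow_L_mul (A B L : ℕ) (hAB : A.Coprime B)
    (hA : ∀ x : ℕ, x.Coprime A → x ^ L ≡ 1 [MOD A])
    (hB : ∀ x : ℕ, x.Coprime B → x ^ L ≡ 1 [MOD B]) :
    ∀ x : ℕ, x.Coprime (A * B) → x ^ L ≡ 1 [MOD A * B] := by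
  intro x hx
  rw [Nat.coprime_mul_iff_right] at hx
  exact (Nat.modEq_and_modEq_iff_modEq_mul hAB).1 ⟨hA x hx.1, hB x hx.2⟩

lemma pow_L (A L : ℕ) (h : A.totient ∣ L) :
    ∀ x : ℕ, x.Coprime A → x ^ L ≡ 1 [MOD A] := by
  intro x hx
  obtain ⟨c, rfl⟩ := h
  rw [pow_mul]
  simpa using (Nat.ModEq.pow_totient hx).pow c

lemma card_bound' (N L : ℕ) (hN : 0 < N) (hL : 0 < L) (hC : CycSign (ZMod N))
    (h : ∀ x : ℕ, x.Coprime N → x ^ L ≡ 1 [MOD N]) : N.totient ≤ 2 * L := by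
  have : NeZero N := ⟨by omega⟩
  refine card_bound N L hN hL hC fun u => ?_
  have h1 := h _ (ZMod.val_coe_unit_coprime u)
  rw [← ZMod.natCast_eq_natCast_iff] at h1
  ext
  simpa using h1

lemma two_case (A B : ℕ) (hA : 2 < A) (hB : 2 < B) (hAB : A.Coprime B)
    (h2 : Nat.Coprime 2 (A * B)) (hC : CycSign (ZMod (2 * (A * B)))) :
    Nat.gcd A.totient B.totient = 2 := by
  have eA := (Nat.totient_even hA).two_dvd
  have eB := (Nat.totient_even hB).two_dvd
  have pA := Nat.totient_pos.2 (show 0 < A by omega)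
  have pB := Nat.totient_pos.2 (show 0 < B by omega)
  have pL : 0 < Nat.lcm A.totient B.totient := Nat.lcm_pos pA pB
  have := card_bound' _ (Nat.lcm A.totient B.totient) (by positivity) pL hC
    (pow_L_mul _ _ _ h2 (pow_L _ _ (by simp))
      (pow_L_mul _ _ _ hAB (pow_L _ _ (Nat.dvd_lcm_left _ _)) (pow_L _ _ (Nat.dvd_lcm_right _ _))))
  rw [Nat.totient_mul h2, Nat.totient_mul hAB, Nat.totient_two, one_mul,
    ← Nat.gcd_mul_lcm] at this
  have h3 := Nat.le_of_mul_le_mul_right this pL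
  have h4 : 2 ∣ Nat.gcd A.totient B.totient := Nat.dvd_gcd eA eB
  have h5 := Nat.gcd_pos_of_pos_left B.totient pA
  have := Nat.le_of_dvd h5 h4
  omega

lemma three_case (A B C : ℕ) (hA : 2 < A) (hB : 2 < B) (hC' : 2 < C) (hBC : B.Coprime C)
    (hA' : A.Coprime (B * C))
    (h2 : Nat.Coprime 2 (A * (B * C))) (hC : CycSign (ZMod (2 * (A * (B * C))))) : False := by
  obtain ⟨a, ha⟩ := (Nat.totient_even hA).two_dvd
  obtain ⟨b, hb⟩ := (Nat.totient_even hB).two_dvd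
  obtain ⟨c, hc⟩ := (Nat.totient_even hC').two_dvd
  have pA := Nat.totient_pos.2 (show 0 < A by omega)
  have pB := Nat.totient_pos.2 (show 0 < B by omega)
  have pC := Nat.totient_pos.2 (show 0 < C by omega)
  have pL : 0 < 2 * (a * b * c) := by
    have : 0 < a := by omega
    have : 0 < b := by omega
    have : 0 < c := by omega
    positivity
  have := card_bound' _ (2 * (a * b * c)) (by positivity) pL hC
    (pow_L_mul _ _ _ h2 (pow_L _ _ (by simp))
      (pow_L_mul _ _ _ hA' (pow_L _ _ ⟨b * c, by rw [ha]; ring⟩)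
        (pow_L_mul _ _ _ hBC (pow_L _ _ ⟨a * c, by rw [hb]; ring⟩)
          (pow_L _ _ ⟨a * b, by rw [hc]; ring⟩))))
  rw [Nat.totient_mul h2, Nat.totient_mul hA', Nat.totient_mul hBC, Nat.totient_two, one_mul,
    ha, hb, hc] at this
  nlinarith

lemma forward (N : ℕ) (hN : 6 ≤ N) (hmod : N % 4 = 2) (hC : CycSign (ZMod N)) :
    ConditionC N := by
  right
  refine ⟨by rw [Nat.even_iff]; omega, ?_⟩
  obtain ⟨M, rfl⟩ : ∃ M, N = 2 * M := ⟨N / 2, by omega⟩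
  have hodd : Odd M := by rw [Nat.odd_iff]; omega
  have h2 : Nat.Coprime 2 M := by simpa using hodd
  have split : ∀ n : ℕ, n ≠ 1 → Odd n → ∃ p a m : ℕ, p.Prime ∧ Odd p ∧ 0 < a ∧ 2 < p ^ a ∧
      Odd m ∧ (p ^ a).Coprime m ∧ p.Coprime m ∧ n = p ^ a * m := by
    intro n hn ho
    have hp := Nat.minFac_prime hn
    have hd := Nat.minFac_dvd n
    obtain ⟨a, m, hm, hnm⟩ := Nat.exists_eq_pow_mul_and_not_dvd
      (show n ≠ 0 by rintro rfl; simp at ho) n.minFac hp.ne_one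
    have hop : Odd n.minFac := ho.of_dvd_nat hd
    have ha : 0 < a := by
      rcases Nat.eq_zero_or_pos a with rfl | h
      · rw [pow_zero, one_mul] at hnm
        exact absurd (hnm ▸ hd) hm
      · exact h
    have hc : n.minFac.Coprime m := (Nat.Prime.coprime_iff_not_dvd hp).2 hm
    refine ⟨n.minFac, a, m, hp, hop, ha, ?_, ?_, hc.pow_left _, hc, hnm⟩
    · have h3 : 2 < n.minFac := by
        have := hp.two_le
        rcases hop with ⟨k, hk⟩
        omega
      exact lt_of_lt_of_le h3 (Nat.le_self_pow ha.ne' _)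
    · exact ho.of_dvd_nat ⟨_, by rw [mul_comm]; exact hnm⟩
  obtain ⟨p, a, m, hp, hop, ha, hpa, hom, hcm, hcm', rfl⟩ := split M (by omega) hodd
  by_cases hm : m = 1
  · left; exact ⟨p, a, hp, hop, ha, by rw [hm, mul_one]⟩
  obtain ⟨q, b, m', hq, hoq, hb, hqb, hom', hcq, hcq', rfl⟩ := split m hm hom
  by_cases hm' : m' = 1
  · subst hm'
    right
    rw [mul_one] at *
    refine ⟨p, q, a, b, hp, hq, hop, hoq, ?_, ha, hb, two_case _ _ hpa hqb hcm h2 hC, rfl⟩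
    rintro rfl
    have := Nat.Coprime.coprime_dvd_right (dvd_pow_self p hb.ne') hcm'
    rw [Nat.coprime_self] at this
    exact hp.ne_one this
  · exfalso
    have : 2 < m' := by rcases hom' with ⟨k, hk⟩; omega
    exact three_case _ _ _ hpa hqb this hcq hcm h2 hC

lemma cycSign_of_isCyclic {R : Type*} [CommRing R] [IsCyclic Rˣ] : CycSign R := by
  obtain ⟨g, hg⟩ := IsCyclic.exists_generator (α := Rˣ)
  refine ⟨g, fun u => ?_⟩
  obtain ⟨k, hk⟩ := hg u
  exact ⟨k, Or.inl hk.symm⟩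

lemma cycSign_of_equiv {R S : Type*} [CommRing R] [CommRing S] (e : R ≃+* S)
    (h : CycSign S) : CycSign R := by
  obtain ⟨g, hg⟩ := h
  let f : Rˣ ≃* Sˣ := Units.mapEquiv e.toMulEquiv
  have hneg : ∀ x, f (-x) = -f x := fun x => by ext; simp [f]
  refine ⟨f.symm g, fun u => ?_⟩
  obtain ⟨k, hk⟩ := hg (f u)
  refine ⟨k, hk.imp (fun h => ?_) (fun h => ?_)⟩
  · apply f.injective; rw [h]; simp
  · apply f.injective; rw [h, hneg]; simp

lemma cycSign_two_mul (M : ℕ) (hM : Nat.Coprime 2 M) (h : CycSign (ZMod M)) :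
    CycSign (ZMod (2 * M)) := by
  refine cycSign_of_equiv (ZMod.chineseRemainder hM) ?_
  obtain ⟨g, hg⟩ := h
  refine ⟨MulEquiv.prodUnits.symm (1, g), fun u => ?_⟩
  obtain ⟨⟨v, w⟩, rfl⟩ := MulEquiv.prodUnits.symm.surjective u
  obtain ⟨k, hk⟩ := hg w
  refine ⟨k, hk.imp (fun h => ?_) (fun h => ?_)⟩
  · rw [← map_zpow]; congr 1; ext1
    · exact Subsingleton.elim _ _
    · exact h
  · rw [← map_zpow]; ext1
    refine Prod.ext ?_ ?_
    · have hs : ∀ x y : (ZMod 2)ˣ, (x : ZMod 2) = -y := by decide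
      exact hs _ _
    · change (w : ZMod M) = -((g ^ k : (ZMod M)ˣ) : ZMod M)
      rw [h, Units.val_neg]

lemma cycSign_prod {R S : Type*} [CommRing R] [CommRing S] [Finite Rˣ] [Finite Sˣ]
    [IsCyclic Rˣ] [IsCyclic Sˣ] (hne : (-1 : Rˣ) ≠ 1) (m' : ℕ) (hm : Nat.card Rˣ = 2 * m')
    (hm' : Odd m') (hco : m'.Coprime (Nat.card Sˣ)) : CycSign (R × S) := by
  obtain ⟨x, hx⟩ := IsCyclic.exists_generator (α := Rˣ)
  obtain ⟨y, hy⟩ := IsCyclic.exists_generator (α := Sˣ)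
  have ox : orderOf x = 2 * m' := by rw [← hm]; exact orderOf_eq_card_of_forall_mem_zpowers hx
  have oy : orderOf y = Nat.card Sˣ := orderOf_eq_card_of_forall_mem_zpowers hy
  have hx' : ∀ u, ∃ i : ℕ, x ^ i = u := fun u => by
    have := hx u; rwa [← mem_powers_iff_mem_zpowers] at this
  have hy' : ∀ u, ∃ i : ℕ, y ^ i = u := fun u => by
    have := hy u; rwa [← mem_powers_iff_mem_zpowers] at this
  obtain ⟨t, ht⟩ := hx' (-1)
  have hto : Odd t := by
    have h1 : 2 * m' ∣ t * 2 := by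
      rw [← ox]; apply orderOf_dvd_of_pow_eq_one; rw [pow_mul, ht]; simp
    have h2 : ¬ 2 * m' ∣ t := by
      rw [← ox, orderOf_dvd_iff_pow_eq_one, ht]; exact hne
    rw [mul_comm t 2] at h1
    obtain ⟨s, rfl⟩ := Nat.dvd_of_mul_dvd_mul_left (by norm_num) h1
    refine hm'.mul ?_
    by_contra hs
    rw [Nat.not_odd_iff_even] at hs
    obtain ⟨r, rfl⟩ := hs.two_dvd
    exact h2 ⟨r, by ring⟩
  have key : ∀ (v : Sˣ) (i : ℕ), Even i → ∃ k : ℕ, (x ^ 2) ^ k = x ^ i ∧ y ^ k = v := by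
    intro v i hi
    obtain ⟨j, rfl⟩ := hy' v
    obtain ⟨l, rfl⟩ := hi.two_dvd
    obtain ⟨k, hk1, hk2⟩ := Nat.chineseRemainder hco l j
    refine ⟨k, ?_, ?_⟩
    · rw [← pow_mul, pow_eq_pow_iff_modEq, ox]
      exact Nat.ModEq.mul_left' 2 hk1
    · rw [pow_eq_pow_iff_modEq, oy]; exact hk2
  refine ⟨MulEquiv.prodUnits.symm (x ^ 2, y), fun u => ?_⟩
  obtain ⟨⟨v, w⟩, rfl⟩ := MulEquiv.prodUnits.symm.surjective u
  obtain ⟨i, rfl⟩ := hx' v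
  rcases Nat.even_or_odd i with hi | hi
  · obtain ⟨k, h1, h2⟩ := key w i hi
    refine ⟨k, Or.inl ?_⟩
    rw [zpow_natCast, ← map_pow]; congr 1; ext1
    · exact h1.symm
    · exact h2.symm
  · obtain ⟨k, h1, h2⟩ := key (-w) (i + t) (hi.add_odd hto)
    refine ⟨k, Or.inr ?_⟩
    rw [pow_add, ht] at h1
    have h3 : MulEquiv.prodUnits.symm (x ^ 2, y) ^ k
        = MulEquiv.prodUnits.symm (x ^ i * -1, -w) := by
      rw [← map_pow]; congr 1; ext1
      · exact h1
      · exact h2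
    rw [zpow_natCast, h3]
    ext1
    refine Prod.ext ?_ ?_
    · change ((x ^ i : Rˣ) : R) = -((x ^ i * -1 : Rˣ) : R)
      simp
    · change (w : S) = -((-w : Sˣ) : S)
      simp

lemma odd_prod (p q a b : ℕ) (hp : p.Prime) (hq : q.Prime) (hop : Odd p) (hoq : Odd q)
    (hpq : p ≠ q) (ha : 0 < a)
    (hg : Nat.gcd (p ^ a).totient (q ^ b).totient = 2)
    (h4 : ¬ 4 ∣ (p ^ a).totient) : CycSign (ZMod (p ^ a * q ^ b)) := by
  have hco : (p ^ a).Coprime (q ^ b) := ((Nat.coprime_primes hp hq).2 hpq).pow _ _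
  have hp2 : p ≠ 2 := by rintro rfl; exact absurd hop (by decide)
  have hq2 : q ≠ 2 := by rintro rfl; exact absurd hoq (by decide)
  have := ZMod.isCyclic_units_of_prime_pow p hp hp2 a
  have := ZMod.isCyclic_units_of_prime_pow q hq hq2 b
  have : NeZero (p ^ a) := ⟨(pow_pos hp.pos _).ne'⟩
  have : NeZero (q ^ b) := ⟨(pow_pos hq.pos _).ne'⟩
  have h2 : 2 < p ^ a := by
    have := hp.two_le
    exact lt_of_lt_of_le (by omega) (Nat.le_self_pow ha.ne' _)
  have : Fact (2 < p ^ a) := ⟨h2⟩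
  obtain ⟨m', hm'⟩ : 2 ∣ (p ^ a).totient := hg ▸ Nat.gcd_dvd_left _ _
  have hmo : Odd m' := by
    rw [Nat.odd_iff]; omega
  refine cycSign_of_equiv (ZMod.chineseRemainder hco) (cycSign_prod ?_ m' ?_ hmo ?_)
  · intro h
    exact ZMod.neg_one_ne_one (n := p ^ a) (by simpa using congrArg Units.val h)
  · rw [Nat.card_eq_fintype_card, ZMod.card_units_eq_totient, hm']
  · rw [Nat.card_eq_fintype_card, ZMod.card_units_eq_totient]
    have h1 : Nat.gcd m' (q ^ b).totient ∣ 2 := by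
      rw [← hg]
      exact Nat.gcd_dvd_gcd_of_dvd_left _ ⟨2, by rw [hm']; ring⟩
    rcases (Nat.dvd_prime Nat.prime_two).1 h1 with h | h
    · exact h
    · exfalso
      have := h ▸ Nat.gcd_dvd_left m' (q ^ b).totient
      rcases hmo with ⟨k, hk⟩
      omega

lemma backward (N : ℕ) (hmod : N % 4 = 2) (hC : ConditionC N) : CycSign (ZMod N) := by
  rcases hC with ⟨ho, -⟩ | ⟨-, ⟨p, a, hp, hop, ha, rfl⟩ |
    ⟨p, q, a, b, hp, hq, hop, hoq, hpq, ha, hb, hg, rfl⟩⟩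
  · rw [Nat.odd_iff] at ho; omega
  · have hp2 : p ≠ 2 := by rintro rfl; exact absurd hop (by decide)
    have := ZMod.isCyclic_units_of_prime_pow p hp hp2 a
    exact cycSign_two_mul _ (by simpa using hop.pow) cycSign_of_isCyclic
  · refine cycSign_two_mul _ (by simpa using hop.pow.mul hoq.pow) ?_
    by_cases h4 : 4 ∣ (p ^ a).totient
    · rw [mul_comm]
      refine odd_prod q p b a hq hp hoq hop hpq.symm hb (by rwa [Nat.gcd_comm]) ?_
      intro h4'
      have := Nat.dvd_gcd h4 h4'
      rw [hg] at this
      omega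
    · exact odd_prod p q a b hp hq hop hoq hpq ha hg h4

/-- For `N ≥ 6` with `N ≡ 2 (mod 4)` and `ζ` a primitive `N`-th root of unity in `ℂ`,
the Galois group of the maximal real subfield `ℚ(ζ + ζ⁻¹)` of `ℚ(ζ)` over `ℚ` is cyclic
if and only if `N` satisfies Condition 𝒞. -/
theorem stmt_5 (N : ℕ) (hN : 6 ≤ N) (hmod : N % 4 = 2) (ζ : ℂ)
    (hζ : IsPrimitiveRoot ζ N) :
    IsCyclic (ℚ⟮ζ + ζ⁻¹⟯ ≃ₐ[ℚ] ℚ⟮ζ + ζ⁻¹⟯) ↔ ConditionC N := by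
  rw [galois_side N hN ζ hζ]
  exact ⟨forward N hN hmod, backward N hmod⟩
end

section
/- Let p ≥ 3 be a prime, let k ≥ 1, let N = p^k or N = 2p^k, let ζ ∈ ℂ be a primitive N-th root of unity, and let K = ℚ(ζ + ζ^{−1}). Then the discriminant of the number field K equals p^{(p^{k−1}(pk−k−1)−1)/2}. -/
open Polynomial IntermediateField

open NumberField in
theorem core (p k : ℕ) [hp : Fact p.Prime] (hp2 : p ≠ 2) (K L : Type) [Field K] [NumberField K]
    [Field L] [NumberField L] [Algebra K L] [IsCyclotomicExtension {p ^ (k + 1)} ℚ L]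
    (z : L) (hz : IsPrimitiveRoot z (p ^ (k + 1))) (a : K)
    (ha : algebraMap K L a = z + z⁻¹) (hK : ∀ f g : K →+* ℂ, f a = g a → f = g) :
    NumberField.discr K = (p : ℤ) ^ ((p ^ k * (p * (k + 1) - (k + 1) - 1) - 1) / 2) := by
  have hz0 : z ≠ 0 := hz.ne_zero (pow_pos hp.out.pos _).ne'
  have hp3 : 3 ≤ p := by have := hp.out.two_le; omega
  have hodd : Odd p := hp.out.odd_of_ne_two hp2
  have hconj : ∀ ψ : L →+* ℂ, (starRingEnd ℂ) (ψ z) = (ψ z)⁻¹ := by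
    intro ψ
    have h1 : ‖ψ z‖ = 1 := by
      apply Complex.norm_eq_one_of_pow_eq_one (n := p ^ (k + 1))
      · rw [← map_pow, hz.pow_eq_one, map_one]
      · exact (pow_pos hp.out.pos _).ne'
    rw [Complex.inv_def, Complex.normSq_eq_norm_sq, h1]; simp
  have hreal : ∀ φ : K →+* ℂ, ComplexEmbedding.IsReal φ := by
    intro φ
    rw [ComplexEmbedding.isReal_iff]
    apply hK
    have h1 : φ a = ComplexEmbedding.lift L φ z + (ComplexEmbedding.lift L φ z)⁻¹ := by
      rw [← ComplexEmbedding.lift_algebraMap_apply L φ a, ha, map_add, map_inv₀]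
    rw [ComplexEmbedding.conjugate_coe_eq, h1, map_add, map_inv₀, hconj, inv_inv, add_comm]
  have hnot : z ∉ (algebraMap K L).range := by
    rintro ⟨c, hc⟩
    let ψ : L →+* ℂ := Classical.choice inferInstance
    have h1 := hreal (ψ.comp (algebraMap K L))
    have h2 : (starRingEnd ℂ) (ψ z) = ψ z := by
      have := RingHom.congr_fun (ComplexEmbedding.isReal_iff.mp h1) c
      simpa [hc] using this
    rw [hconj ψ, ← map_inv₀] at h2
    have h3 := ψ.injective h2
    have h4 : z ^ 2 = 1 := by
      rw [pow_two]; nth_rewrite 1 [← h3]; exact inv_mul_cancel₀ hz0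
    have h5 := Nat.le_of_dvd (by norm_num) (hz.dvd_of_pow_eq_one _ h4)
    have : p ^ 1 ≤ p ^ (k + 1) := Nat.pow_le_pow_right hp.out.pos (by omega)
    rw [pow_one] at this
    omega
  have hTR : IsTotallyReal K := ⟨fun v => by
    rw [← InfinitePlace.mk_embedding v, InfinitePlace.isReal_mk_iff]
    exact hreal _⟩
  have hpos : 0 < discr K := by
    have := sign_discr K
    rw [IsTotallyReal.nrComplexPlaces_eq_zero K, pow_zero] at this
    exact Int.sign_eq_one_iff_pos.mp this
  -- integers
  let x : 𝓞 L := hz.toInteger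
  have hxL : algebraMap (𝓞 L) L x = z := rfl
  have haint : IsIntegral ℤ a := by
    rw [← isIntegral_algebraMap_iff (FaithfulSMul.algebraMap_injective K L), ha]
    exact (hz.isIntegral (pow_pos hp.out.pos _)).add (hz.inv.isIntegral (pow_pos hp.out.pos _))
  let b : 𝓞 K := ⟨a, haint⟩
  have hb : algebraMap (𝓞 K) K b = a := rfl
  let q : (𝓞 K)[X] := X ^ 2 - C b * X + 1
  have hq2 : q.natDegree = 2 := by simp only [q]; compute_degree!
  have hqm : q.Monic := by simp only [q]; monicity!
  let Q : K[X] := q.map (algebraMap (𝓞 K) K)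
  have hQm : Q.Monic := hqm.map _
  have hQ2 : Q.natDegree = 2 := by rw [hqm.natDegree_map, hq2]
  have hQz : aeval z Q = 0 := by
    simp [Q, q, hb, ha]
    field_simp
    ring
  have hzint : IsIntegral K z := Algebra.IsIntegral.isIntegral z
  have hmin : minpoly K z = Q := by
    symm
    apply Polynomial.eq_of_monic_of_dvd_of_natDegree_le (minpoly.monic hzint) hQm
    · exact minpoly.dvd _ _ hQz
    · rw [hQ2]; exact (minpoly.two_le_natDegree_iff hzint).mpr hnot
  have hminx : minpoly (𝓞 K) x = q := by
    have h1 := minpoly.isIntegrallyClosed_eq_field_fractions K L (R := 𝓞 K) (s := x)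
      (Algebra.IsIntegral.isIntegral x)
    rw [hxL, hmin] at h1
    exact (Polynomial.map_injective _ (FaithfulSMul.algebraMap_injective (𝓞 K) K) h1).symm
  have hadjK : Algebra.adjoin K {z} = ⊤ := by
    have h := IsCyclotomicExtension.adjoin_primitive_root_eq_top (A := ℚ) hz
    rw [eq_top_iff]
    intro y _
    have : y ∈ Algebra.adjoin ℚ {z} := h ▸ Algebra.mem_top
    have hle : Algebra.adjoin ℚ {z} ≤ (Algebra.adjoin K {z}).restrictScalars ℚ :=
      Algebra.adjoin_le (by simp)
    exact hle this
  have hfin : Module.finrank K L = 2 := by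
    have h := (IntermediateField.adjoin.finrank hzint)
    have h2 : K⟮z⟯ = ⊤ := by
      rw [← IntermediateField.toSubalgebra_injective.eq_iff,
        IntermediateField.adjoin_simple_toSubalgebra_of_isAlgebraic hzint.isAlgebraic, hadjK]; rfl
    rw [h2, IntermediateField.finrank_top', hmin, hQ2] at h
    exact h
  have hadjx : Algebra.adjoin (𝓞 K) {x} = ⊤ := by
    have h : Algebra.adjoin ℤ {x} = ⊤ := by
      have := hz.integralPowerBasisOfPrimePow.adjoin_gen_eq_top
      rwa [hz.integralPowerBasisOfPrimePow_gen] at this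
    rw [eq_top_iff]
    intro y _
    have : y ∈ Algebra.adjoin ℤ {x} := h ▸ Algebra.mem_top
    have hle : Algebra.adjoin ℤ {x} ≤ (Algebra.adjoin (𝓞 K) {x}).restrictScalars ℤ :=
      Algebra.adjoin_le (by simp)
    exact hle this
  have hdiff : differentIdeal (𝓞 K) (𝓞 L) = Ideal.span {x ^ 2 - 1} := by
    have h := conductor_mul_differentIdeal (𝓞 K) K L x (by rw [hxL]; exact hadjK)
    rw [conductor_eq_top_of_adjoin_eq_top hadjx, Ideal.top_mul, hminx] at h
    rw [h]
    have hxu : IsUnit x := hz.toInteger_isPrimitiveRoot.isUnit (pow_pos hp.out.pos _).ne'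
    rw [← Ideal.span_singleton_mul_left_unit hxu]
    congr 2
    apply RingOfIntegers.ext
    have hb' : algebraMap (𝓞 L) L (algebraMap (𝓞 K) (𝓞 L) b) = z + z⁻¹ := by
      rw [← IsScalarTower.algebraMap_apply, IsScalarTower.algebraMap_apply (𝓞 K) K L, hb, ha]
    simp [q, hxL, hb']
    field_simp
    ring
  have hnorm : Ideal.absNorm (differentIdeal (𝓞 K) (𝓞 L)) = p := by
    have h2 : IsPrimitiveRoot (z ^ 2) (p ^ (k + 1)) :=
      hz.pow_of_coprime 2 ((Nat.coprime_two_left.mpr (hodd.pow)))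
    have h3 : x ^ 2 = h2.toInteger := by apply RingOfIntegers.ext; simp only [map_pow, hxL]; rfl
    rw [hdiff, Ideal.absNorm_span_singleton, h3, h2.norm_toInteger_sub_one_of_prime_ne_two hp2]
    simp
  have htower := natAbs_discr_eq_absNorm_differentIdeal_mul_natAbs_discr_pow K (𝓞 K) L (𝓞 L)
  have hdL : (discr L).natAbs = p ^ (p ^ k * ((p - 1) * (k + 1) - 1)) := by
    have := IsCyclotomicExtension.Rat.discr_prime_pow p (k + 1) L
    rw [this]
    simp [Int.natAbs_mul, Int.natAbs_pow]
  rw [hdL, hnorm, hfin] at htower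
  have hexp : p * (k + 1) - (k + 1) - 1 = (p - 1) * (k + 1) - 1 := by
    rw [Nat.sub_mul, one_mul]
  rw [hexp]
  have hE : ∃ m, p ^ k * ((p - 1) * (k + 1) - 1) = 2 * m + 1 := by
    have : Odd (p ^ k * ((p - 1) * (k + 1) - 1)) := by
      apply hodd.pow.mul
      apply Nat.Even.sub_odd
      · have : 1 ≤ p - 1 := by omega
        exact Nat.mul_pos this (by omega)
      · exact (Nat.Odd.sub_odd hodd odd_one).mul_right _
      · exact odd_one
    exact this
  obtain ⟨m, hm⟩ := hE
  rw [hm] at htower ⊢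
  have h1 : (2 * m + 1 - 1) / 2 = m := by omega
  rw [h1]
  have h2 : (discr K).natAbs = p ^ m := by
    have : (p ^ m) ^ 2 = (discr K).natAbs ^ 2 := by
      apply Nat.eq_of_mul_eq_mul_left hp.out.pos
      rw [← htower]; ring
    exact (Nat.pow_left_injective (by norm_num : 2 ≠ 0) this).symm
  have h3 := Int.natAbs_of_nonneg hpos.le
  rw [← h3, h2]; simp

theorem core2 (p k : ℕ) (hp : p.Prime) (hp3 : 3 ≤ p) (ζ : ℂ)
    (hζ : IsPrimitiveRoot ζ (p ^ (k + 1))) [NumberField ↥ℚ⟮ζ + ζ⁻¹⟯] :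
    NumberField.discr ℚ⟮ζ + ζ⁻¹⟯ =
      (p : ℤ) ^ ((p ^ k * (p * (k + 1) - (k + 1) - 1) - 1) / 2) := by
  have : Fact p.Prime := ⟨hp⟩
  have : NeZero (p ^ (k + 1)) := ⟨(pow_pos hp.pos _).ne'⟩
  have hLe : ℚ⟮ζ + ζ⁻¹⟯ ≤ ℚ⟮ζ⟯ := by
    rw [IntermediateField.adjoin_simple_le_iff]
    exact add_mem (mem_adjoin_simple_self ℚ ζ) (inv_mem (mem_adjoin_simple_self ℚ ζ))
  let : Algebra ℚ⟮ζ + ζ⁻¹⟯ ℚ⟮ζ⟯ := (IntermediateField.inclusion hLe).toAlgebra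
  have : IsCyclotomicExtension {p ^ (k + 1)} ℚ ℚ⟮ζ⟯ :=
(IntermediateField.isCyclotomicExtension_singleton_iff_eq_adjoin _ _ _ _ hζ).mpr rfl
  have : NumberField ℚ⟮ζ⟯ := IsCyclotomicExtension.numberField {p ^ (k + 1)} ℚ _
  refine core p k (by omega) ℚ⟮ζ + ζ⁻¹⟯ ℚ⟮ζ⟯ (AdjoinSimple.gen ℚ ζ) ?_
    (AdjoinSimple.gen ℚ (ζ + ζ⁻¹)) ?_ ?_
  · exact IsPrimitiveRoot.of_map_of_injective (f := ℚ⟮ζ⟯.val) hζ Subtype.val_injective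
  · apply Subtype.ext
    rfl
  · intro f g hfg
    have key : f.toRatAlgHom = g.toRatAlgHom := by
      apply IntermediateField.algHom_ext_of_eq_adjoin _ rfl
      intro y hy
      obtain rfl : y = ζ + ζ⁻¹ := hy
      exact hfg
    exact congrArg (fun f : ℚ⟮ζ + ζ⁻¹⟯ →ₐ[ℚ] ℂ => (f : ℚ⟮ζ + ζ⁻¹⟯ →+* ℂ)) key

/-- For a prime `p ≥ 3`, `k ≥ 1`, `N = p^k` or `N = 2p^k`, and `ζ` a primitive `N`-th root
of unity in `ℂ`, the discriminant of the number field `K = ℚ(ζ + ζ⁻¹)` equals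
`p^((p^(k−1)(pk−k−1)−1)/2)`. -/
theorem stmt_8 (p k N : ℕ) (hp : p.Prime) (hp3 : 3 ≤ p) (hk : 1 ≤ k)
    (hN : N = p ^ k ∨ N = 2 * p ^ k) (ζ : ℂ) (hζ : IsPrimitiveRoot ζ N)
    [NumberField ↥ℚ⟮ζ + ζ⁻¹⟯] :
    NumberField.discr ℚ⟮ζ + ζ⁻¹⟯ =
      (p : ℤ) ^ ((p ^ (k - 1) * (p * k - k - 1) - 1) / 2) := by
  obtain ⟨k, rfl⟩ : ∃ j, k = j + 1 := ⟨k - 1, by omega⟩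
  rw [Nat.add_sub_cancel]
  rcases hN with rfl | rfl
  · exact core2 p k hp hp3 ζ hζ
  · have hodd : Odd (p ^ (k + 1)) := (hp.odd_of_ne_two (by omega)).pow
    have hpos : 0 < p ^ (k + 1) := pow_pos hp.pos _
    have h2 : IsPrimitiveRoot (-ζ) (p ^ (k + 1)) := by
      have hh : IsPrimitiveRoot (ζ ^ p ^ (k + 1)) 2 := hζ.pow (by omega) (by ring)
      have hm := hh.eq_neg_one_of_two_right
      refine ⟨by rw [hodd.neg_pow, hm, neg_neg], fun l hl => ?_⟩
      have : ζ ^ (2 * l) = 1 := by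
        rw [mul_comm, pow_mul, ← one_pow 2, ← hl, ← pow_mul, ← pow_mul, mul_comm l 2,
          (even_two_mul l).neg_pow]
      exact Nat.dvd_of_mul_dvd_mul_left (by norm_num) (hζ.dvd_of_pow_eq_one _ this)
    have hE : ℚ⟮ζ + ζ⁻¹⟯ = ℚ⟮-ζ + (-ζ)⁻¹⟯ := by
      have h0 : -ζ + (-ζ)⁻¹ = -(ζ + ζ⁻¹) := by rw [inv_neg]; ring
      rw [h0]
      apply le_antisymm <;> rw [IntermediateField.adjoin_simple_le_iff]
      · simpa using neg_mem (mem_adjoin_simple_self ℚ (-(ζ + ζ⁻¹)))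
      · exact neg_mem (mem_adjoin_simple_self ℚ (ζ + ζ⁻¹))
    have : NumberField ↥ℚ⟮-ζ + (-ζ)⁻¹⟯ := hE ▸ inferInstance
    have key := core2 p k hp hp3 (-ζ) h2
    rw [← key]
    exact NumberField.discr_eq_discr_of_algEquiv _ (IntermediateField.equivOfEq hE)
end

section
/- Let k ≥ 2, let N = 2^k, let ζ ∈ ℂ be a primitive N-th root of unity, and let K = ℚ(ζ + ζ^{−1}). Then the discriminant of the number field K equals 2^{2^{k−2}(k−1)−1}. -/
open Polynomial IntermediateField

/-- The iterated polynomials `X, X^2-2, (X^2-2)^2-2, ...`. -/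
noncomputable def itP : ℕ → ℤ[X]
  | 0 => X
  | (m+1) => (itP m)^2 - C 2

lemma itP_monic_natDegree (m : ℕ) : (itP m).Monic ∧ (itP m).natDegree = 2 ^ m := by
  induction m with
  | zero => simp [itP]
  | succ m ih =>
    obtain ⟨h1, h2⟩ := ih
    have h3 : ((itP m)^2).Monic := h1.pow 2
    have h4 : ((itP m)^2).natDegree = 2^(m+1) := by
      rw [h1.natDegree_pow, h2]; ring
    have h5 : (C (2:ℤ)).degree < ((itP m)^2).degree := by
      refine lt_of_le_of_lt degree_C_le ?_
      rw [← natDegree_pos_iff_degree_pos, h4]; positivity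
    refine ⟨h3.sub_of_left h5, ?_⟩
    rw [itP, natDegree_sub_C, h4]

lemma itP_add {A : Type*} [CommRing A] (x : A) (i j : ℕ) :
    aeval x (itP (i + j)) = aeval (aeval x (itP j)) (itP i) := by
  induction i with
  | zero => simp [itP]
  | succ i ih => rw [show i + 1 + j = (i + j) + 1 by ring]; simp only [itP, ih, map_sub, map_pow, aeval_C]

lemma itP_mod (m : ℕ) : (itP m).map (Int.castRingHom (ZMod 2)) = X ^ (2 ^ m) := by
  induction m with
  | zero => simp [itP]
  | succ m ih =>
    have : (C (2:ZMod 2)) = 0 := by rw [show (2:ZMod 2) = 0 from rfl, C_0]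
    rw [itP, Polynomial.map_sub, Polynomial.map_pow, ih, map_C]
    simp only [eq_intCast, Int.cast_ofNat, this]
    ring

lemma itP_coeff_zero (m : ℕ) : (itP 0).coeff 0 = 0 ∧ (itP 1).coeff 0 = -2 ∧
    (itP (m+2)).coeff 0 = 2 := by
  have h1 : (itP 1).coeff 0 = -2 := by simp [itP, coeff_zero_eq_eval_zero]
  refine ⟨by simp [itP], h1, ?_⟩
  induction m with
  | zero => rw [itP]; rw [coeff_zero_eq_eval_zero] at *; simp [h1]
  | succ m ih => rw [itP]; rw [coeff_zero_eq_eval_zero] at *; simp [ih]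

lemma itP_eis (m : ℕ) : (itP (m+1)).IsEisensteinAt (Submodule.span ℤ {((2:ℕ) : ℤ)}) := by
  obtain ⟨h1, h2⟩ := itP_monic_natDegree (m+1)
  refine ⟨?_, ?_, ?_⟩
  · rw [h1.leadingCoeff]
    intro h
    rw [Ideal.submodule_span_eq, Ideal.mem_span_singleton] at h
    norm_num at h
  · intro n hn
    rw [h2] at hn
    have := congrArg (fun p => coeff p n) (itP_mod (m+1))
    simp only [coeff_map, coeff_X_pow, hn.ne, if_false, eq_intCast] at this
    rw [Ideal.submodule_span_eq, Ideal.mem_span_singleton]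
    exact (ZMod.intCast_zmod_eq_zero_iff_dvd _ 2).1 this
  · rw [Ideal.submodule_span_eq, Ideal.span_singleton_pow, Ideal.mem_span_singleton]
    rcases m with _ | m
    · rw [(itP_coeff_zero 0).2.1]; decide
    · rw [(itP_coeff_zero m).2.2]; decide

lemma itP_irred (m : ℕ) : Irreducible (itP (m+1)) := by
  obtain ⟨h1, h2⟩ := itP_monic_natDegree (m+1)
  refine (itP_eis m).irreducible ?_ h1.isPrimitive (by rw [h2]; positivity)
  rw [Ideal.submodule_span_eq, Ideal.span_singleton_prime (by norm_num)]
  exact Nat.prime_iff_prime_int.1 Nat.prime_two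

lemma itP_minpoly_rat {L : Type*} [Field L] [CharZero L] (x : L) (m : ℕ)
    (hx : aeval x (itP (m+1)) = 0) :
    minpoly ℚ x = (itP (m+1)).map (algebraMap ℤ ℚ) := by
  obtain ⟨h1, h2⟩ := itP_monic_natDegree (m+1)
  symm
  refine minpoly.eq_of_irreducible_of_monic ?_ ?_ (h1.map _)
  · exact (h1.irreducible_iff_irreducible_map_fraction_map).1 (itP_irred m)
  · rw [aeval_map_algebraMap]; exact hx

lemma itP_isIntegral {L : Type*} [Field L] [CharZero L] (x : L) (m : ℕ)
    (hx : aeval x (itP (m+1)) = 0) : IsIntegral ℤ x :=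
  ⟨itP (m+1), (itP_monic_natDegree (m+1)).1, by simpa [aeval_def] using hx⟩

lemma itP_minpoly_int {L : Type*} [Field L] [CharZero L] (x : L) (m : ℕ)
    (hx : aeval x (itP (m+1)) = 0) : minpoly ℤ x = itP (m+1) := by
  have h := minpoly.isIntegrallyClosed_eq_field_fractions' ℚ (itP_isIntegral x m hx)
  rw [itP_minpoly_rat x m hx] at h
  exact (map_injective (algebraMap ℤ ℚ) (algebraMap ℤ ℚ).injective_int h).symm

lemma itP_norm {L : Type*} [Field L] [NumberField L] (x : L) (i j : ℕ)
    (hL : Module.finrank ℚ L = 2 ^ (i + 1 + j))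
    (hx : aeval x (itP (i+1)) = 0) :
    Algebra.norm ℚ x = ((itP (i+1)).coeff 0 : ℚ) ^ (2 ^ j) := by
  have hi : IsIntegral ℚ x := Algebra.IsIntegral.isIntegral x
  obtain ⟨h1, h2⟩ := itP_monic_natDegree (i+1)
  have hmin := itP_minpoly_rat x i hx
  have hdeg : (minpoly ℚ x).natDegree = 2 ^ (i+1) := by
    rw [hmin, h1.natDegree_map, h2]
  have hf := Module.finrank_mul_finrank ℚ ℚ⟮x⟯ L
  rw [adjoin.finrank hi, hdeg, hL, pow_add _ (i+1) j] at hf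
  have hf' := Nat.eq_of_mul_eq_mul_left (by positivity) hf
  rw [Algebra.norm_eq_norm_adjoin, hf']
  congr 1
  have := Algebra.PowerBasis.norm_gen_eq_coeff_zero_minpoly (adjoin.powerBasis hi)
  rw [adjoin.powerBasis_gen, minpoly_gen, adjoin.powerBasis_dim, hdeg, hmin] at this
  rw [this, Even.neg_one_pow (by simp [Nat.even_pow])]
  simp

lemma itP_derivative (m : ℕ) :
    derivative (itP m) = C (2 ^ m) * ∏ j ∈ Finset.range m, itP j := by
  induction m with
  | zero => simp [itP]
  | succ m ih =>
    rw [itP, derivative_sub, derivative_C, derivative_sq, ih, Finset.prod_range_succ, pow_succ,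
      C_mul]
    ring

lemma itP_c_pow (m : ℕ) (j : ℕ) (hj : j < m + 2) :
    ((itP (m + 2 - j)).coeff 0 : ℚ) ^ (2 ^ j) = 2 ^ (2 ^ j) := by
  rcases Nat.lt_or_ge j (m+1) with h | h
  · obtain ⟨l, hl⟩ : ∃ l, m + 2 - j = l + 2 := ⟨m - j, by omega⟩
    rw [hl, (itP_coeff_zero l).2.2]; norm_num
  · obtain rfl : j = m + 1 := by omega
    rw [show m + 2 - (m+1) = 1 by omega, (itP_coeff_zero 0).2.1]
    push_cast
    rw [Even.neg_pow (by simp [Nat.even_pow])]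

lemma itP_discr {L : Type*} [Field L] [NumberField L] (B : PowerBasis ℚ L) (m : ℕ)
    (hx : aeval B.gen (itP (m+1)) = 0) :
    Algebra.discr ℚ B.basis = 2 ^ (2 ^ (m+1) * (m + 2) - 1) := by
  have hint := itP_isIntegral _ m hx
  obtain ⟨h1, h2⟩ := itP_monic_natDegree (m+1)
  have hmin := itP_minpoly_rat _ m hx
  have hdim : B.dim = 2 ^ (m+1) := by
    rw [← B.natDegree_minpoly, hmin, h1.natDegree_map, h2]
  have hfin : Module.finrank ℚ L = 2 ^ (m+1) := by rw [B.finrank, hdim]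
  have hnorm : ∀ j ∈ Finset.range (m+1), Algebra.norm ℚ (aeval B.gen (itP j)) =
      ((itP (m + 1 - j)).coeff 0 : ℚ) ^ (2 ^ j) := by
    intro j hj
    rw [Finset.mem_range] at hj
    obtain ⟨i, rfl⟩ : ∃ i, m = i + j := ⟨m - j, by omega⟩
    rw [show i + j + 1 - j = i + 1 by omega]
    apply itP_norm _ i j
    · rw [hfin]; congr 1; omega
    · rw [← itP_add, ← hx]; congr 2; omega
  rw [Algebra.discr_powerBasis_eq_norm, hmin, derivative_map, aeval_map_algebraMap, itP_derivative,
    map_mul, map_mul, aeval_C, map_prod, map_prod, Finset.prod_congr rfl hnorm, hfin]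
  have h2m : Algebra.norm ℚ (algebraMap ℤ L (2 ^ (m+1))) = (2 ^ (m+1)) ^ (2 ^ (m+1)) := by
    rw [IsScalarTower.algebraMap_apply ℤ ℚ L, Algebra.norm_algebraMap, hfin]
    simp
  rw [h2m]
  rcases m with _ | m
  · have := (itP_coeff_zero 0).2.1
    simp [this]; norm_num
  · rw [Finset.prod_congr rfl (fun j hj => itP_c_pow m j (Finset.mem_range.1 hj)),
      Finset.prod_pow_eq_pow_sum, Nat.geomSum_eq le_rfl]
    have he : Even (2 ^ (m + 1 + 1) * (2 ^ (m + 1 + 1) - 1) / 2) := by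
      rw [show 2 ^ (m + 1 + 1) * (2 ^ (m + 1 + 1) - 1) = 2 * (2 * (2 ^ m * (2 ^ (m+1+1) - 1))) by
        ring, Nat.mul_div_cancel_left _ (by norm_num)]
      exact even_two_mul _
    rw [he.neg_one_pow, one_mul, ← pow_mul, ← pow_add]
    congr 1
    have : 1 ≤ 2 ^ (m+1+1) := Nat.one_le_two_pow
    rw [show m + 1 + 2 = (m + 1 + 1) + 1 by ring, mul_add, mul_comm (m+1+1), mul_one,
      Nat.add_sub_assoc this]
    simp

lemma itP_main {L : Type*} [Field L] [NumberField L] (x : L) (m : ℕ)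
    (hx : aeval x (itP (m+1)) = 0) (htop : Algebra.adjoin ℚ {x} = ⊤) :
    NumberField.discr L = 2 ^ (2 ^ (m+1) * (m + 2) - 1) := by
  have hint := itP_isIntegral _ m hx
  let B : PowerBasis ℚ L := PowerBasis.ofAdjoinEqTop (Algebra.IsIntegral.isIntegral x) htop
  have hB : B.gen = x := rfl
  have hd := itP_discr B m hx
  have key : ∀ z : L, IsIntegral ℤ z → z ∈ Algebra.adjoin ℤ {x} := by
    intro z hz
    have H := Algebra.discr_mul_isIntegral_mem_adjoin ℚ (B := B) hint hz
    rw [hd] at H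
    refine mem_adjoin_of_smul_prime_pow_smul_of_minpoly_isEisensteinAt (B := B) (K := ℚ)
      (n := 2 ^ (m+1) * (m + 2) - 1)
      (Nat.prime_iff_prime_int.1 Nat.prime_two) hint hz ?_ ?_
    · convert H using 1
      simp [Algebra.smul_def]
    · rw [hB, itP_minpoly_int x m hx]; exact itP_eis m
  let y : NumberField.RingOfIntegers L := ⟨x, hint⟩
  have hy : IsIntegral ℤ y := NumberField.RingOfIntegers.isIntegral y
  have hytop : Algebra.adjoin ℤ {y} = ⊤ := by
    rw [eq_top_iff]
    intro z _
    have := key (z : L) (NumberField.RingOfIntegers.isIntegral_coe z)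
    rw [Algebra.adjoin_singleton_eq_range_aeval] at this ⊢
    obtain ⟨p, hp⟩ := this
    refine ⟨p, ?_⟩
    apply NumberField.RingOfIntegers.ext
    rw [← hp]
    exact (aeval_algebraMap_apply L y p).symm
  let B' : PowerBasis ℤ (NumberField.RingOfIntegers L) := PowerBasis.ofAdjoinEqTop' hy hytop
  have hB' : B'.gen = y := PowerBasis.ofAdjoinEqTop'_gen hy hytop
  apply (algebraMap ℤ ℚ).injective_int
  rw [← NumberField.discr_eq_discr _ B'.basis,
    ← Algebra.discr_localizationLocalization ℤ (nonZeroDivisors ℤ) L]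
  have hdim : B.dim = B'.dim := by
    rw [← B.finrank, ← B'.finrank, NumberField.RingOfIntegers.rank]
  trans Algebra.discr ℚ B.basis
  · rw [← Algebra.discr_reindex _ _ (finCongr hdim)]
    congr 1
    ext i
    simp [hB, hB', Module.Basis.localizationLocalization_apply]
    rfl
  · rw [hd]; simp

theorem stmt_9 (k N : ℕ) (hk : 2 ≤ k) (hN : N = 2 ^ k) (ζ : ℂ)
    (hζ : IsPrimitiveRoot ζ N) [NumberField ↥ℚ⟮ζ + ζ⁻¹⟯] :
    NumberField.discr ℚ⟮ζ + ζ⁻¹⟯ = 2 ^ (2 ^ (k - 2) * (k - 1) - 1) := by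
  have hζ0 : ζ ≠ 0 := hζ.ne_zero (by rw [hN]; positivity)
  have hz : ∀ j : ℕ, aeval (ζ + ζ⁻¹) (itP j) = ζ ^ (2 ^ j) + (ζ ^ (2 ^ j))⁻¹ := by
    intro j
    induction j with
    | zero => simp [itP]
    | succ j ih =>
      have : ζ ^ (2 ^ j) ≠ 0 := pow_ne_zero _ hζ0
      rw [itP, map_sub, map_pow, ih, pow_succ 2 j, pow_mul]
      simp only [map_ofNat]
      field_simp
      ring
  obtain ⟨m, rfl⟩ : ∃ m, k = m + 2 := ⟨k - 2, by omega⟩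
  have hroot : aeval (ζ + ζ⁻¹) (itP m) = 0 := by
    have h4 : IsPrimitiveRoot (ζ ^ (2 ^ m)) 4 :=
      hζ.pow (by rw [hN]; positivity) (by rw [hN]; ring)
    have h2 : (ζ ^ (2 ^ m)) ^ 2 = -1 :=
      (h4.pow (by norm_num) (show 4 = 2 * 2 by norm_num)).eq_neg_one_of_two_right
    have : ζ ^ (2 ^ m) ≠ 0 := pow_ne_zero _ hζ0
    rw [hz]
    field_simp
    rw [h2]; ring
  rcases m with _ | m
  · have h0 : ζ + ζ⁻¹ = 0 := by simpa [itP] using hroot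
    have hbot : ℚ⟮ζ + ζ⁻¹⟯ = ⊥ := by rw [h0]; exact adjoin_zero
    rw [NumberField.discr_eq_discr_of_algEquiv _
      ((equivOfEq hbot).trans (botEquiv ℚ ℂ)), NumberField.discr_rat]
    norm_num
  · have hint : IsIntegral ℚ (ζ + ζ⁻¹) := (itP_isIntegral _ m hroot).tower_top
    have := itP_main (AdjoinSimple.gen ℚ (ζ + ζ⁻¹)) m ?_ ?_
    · rw [this]; rfl
    · apply (algebraMap ℚ⟮ζ + ζ⁻¹⟯ ℂ).injective
      rw [← aeval_algebraMap_apply, AdjoinSimple.algebraMap_gen, hroot, map_zero]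
    · have := (adjoin.powerBasis hint).adjoin_gen_eq_top
      rwa [adjoin.powerBasis_gen] at this
end

section
/- Let N ≥ 3 be an integer that has at least two distinct prime factors and is not of the form 2p^k with p an odd prime. Let ζ ∈ ℂ be a primitive N-th root of unity and let K = ℚ(ζ + ζ^{−1}). Then the discriminant of the number field K equals N^{φ(N)/2} / ∏_{p ∣ N, p prime} p^{φ(N)/(2(p−1))}. -/
open Polynomial IntermediateField

lemma aux_unit {R : Type*} [CommRing R] [IsDomain R] [CharZero R] {M : ℕ} (hM : 1 < M)
    (hp : ¬ IsPrimePow M) {η : R} (hη : IsPrimitiveRoot η M) : IsUnit (η - 1) := by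
  have h1 : (cyclotomic M R).eval 1 = 1 := by
    apply eval_one_cyclotomic_not_prime_pow
    intro p hpp k hk
    rcases Nat.eq_zero_or_pos k with rfl | hk0
    · simp at hk; omega
    · exact hp (hk ▸ hpp.isPrimePow.pow hk0.ne')
  have h0 : (cyclotomic M R).eval η = 0 := hη.isRoot_cyclotomic (by omega)
  have := sub_dvd_eval_sub η 1 (cyclotomic M R)
  rw [h1, h0, zero_sub] at this
  exact isUnit_of_dvd_unit this isUnit_one.neg

lemma aux_npp {N : ℕ} (hfac : 2 ≤ N.primeFactors.card) : ¬ IsPrimePow N := by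
  intro h
  obtain ⟨p, k, hp, hk, rfl⟩ := h
  rw [Nat.primeFactors_prime_pow hk.ne' hp.nat_prime] at hfac
  simp at hfac

lemma aux_unit2 {R : Type*} [CommRing R] [IsDomain R] [CharZero R] {N : ℕ} (hN : 3 ≤ N)
    (hfac : 2 ≤ N.primeFactors.card)
    (hform : ¬ ∃ p k : ℕ, p.Prime ∧ Odd p ∧ 1 ≤ k ∧ N = 2 * p ^ k)
    {ζ : R} (hζ : IsPrimitiveRoot ζ N) : IsUnit (ζ ^ 2 - 1) := by
  rcases Nat.even_or_odd' N with ⟨m, rfl | rfl⟩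
  · refine aux_unit (M := m) (by omega) ?_ (hζ.pow (by omega) rfl)
    rintro ⟨p, k, hp, hk, rfl⟩
    have hp := hp.nat_prime
    rcases hp.eq_two_or_odd' with rfl | ho
    · apply aux_npp hfac
      rw [← pow_succ']
      exact Nat.prime_two.isPrimePow.pow (by omega)
    · exact hform ⟨p, k, hp, ho, hk, rfl⟩
  · exact aux_unit (by omega) (aux_npp hfac)
      (hζ.pow_of_coprime 2 (by simp))

lemma aux_even {N : ℕ} (hN : 3 ≤ N)
    (hfac : 2 ≤ N.primeFactors.card)
    (hform : ¬ ∃ p k : ℕ, p.Prime ∧ Odd p ∧ 1 ≤ k ∧ N = 2 * p ^ k)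
    {p : ℕ} (hp : p ∈ N.primeFactors) :
    N.totient / (2 * (p - 1)) * 2 = N.totient / (p - 1) := by
  have hpp := Nat.prime_of_mem_primeFactors hp
  obtain ⟨a, m, hpm, h⟩ := Nat.exists_eq_pow_mul_and_not_dvd (n := N) (by omega) p hpp.ne_one
  have ha : 0 < a := by
    rcases Nat.eq_zero_or_pos a with rfl | h0
    · exact absurd (Nat.dvd_of_mem_primeFactors hp) (by simpa [h] using hpm)
    · exact h0
  have hm : 2 < m := by
    by_contra! hm
    interval_cases m
    · simp at hpm
    · exact aux_npp hfac (by rw [h, mul_one]; exact hpp.isPrimePow.pow ha.ne')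
    · refine hform ⟨p, a, hpp, hpp.odd_of_ne_two ?_, ha, by rw [h, mul_comm]⟩
      rintro rfl
      simp at hpm
  obtain ⟨t, ht⟩ := Nat.totient_even hm
  have hp1 : 0 < p - 1 := by have := hpp.two_le; omega
  have hφ : N.totient = p ^ (a - 1) * t * (2 * (p - 1)) := by
    rw [h, Nat.totient_mul ((hpp.coprime_iff_not_dvd.2 hpm).pow_left a),
      Nat.totient_prime_pow hpp ha, ht]; ring
  rw [hφ, Nat.mul_div_cancel _ (by omega), ← mul_assoc, Nat.mul_div_cancel _ hp1]


section
variable {L : Type*} [Field L] [NumberField L] {ζ : L} {N : ℕ}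
open NumberField

lemma aux_real (hN : 3 ≤ N) (hζ : IsPrimitiveRoot ζ N)
    (φ : ℚ⟮ζ + ζ⁻¹⟯ →+* ℂ) : ComplexEmbedding.IsReal φ := by
  let ψ : L →+* ℂ := ComplexEmbedding.lift L φ
  have hψ : ∀ x : ℚ⟮ζ + ζ⁻¹⟯, ψ (x : L) = φ x := fun x =>
    ComplexEmbedding.lift_algebraMap_apply L φ x
  have h1 : (starRingEnd ℂ) (ψ ζ) = (ψ ζ)⁻¹ := by
    have h2 : ‖ψ ζ‖ = 1 := by
      have : (ψ ζ) ^ N = 1 := by rw [← map_pow, hζ.pow_eq_one, map_one]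
      exact Complex.norm_eq_one_of_pow_eq_one this (by omega)
    rw [Complex.inv_def, Complex.normSq_eq_norm_sq, h2]; simp
  have : (ComplexEmbedding.conjugate φ).toRatAlgHom = φ.toRatAlgHom := by
    apply IntermediateField.algHom_ext_of_eq_adjoin ℚ rfl
    intro x hx
    simp only [Set.mem_singleton_iff] at hx
    subst hx
    change (starRingEnd ℂ) (φ _) = φ _
    rw [← hψ]
    simp [h1, add_comm]
  rw [ComplexEmbedding.isReal_iff]
  ext x
  simpa using DFunLike.congr_fun this x

lemma aux_adjoin [NeZero N] [IsCyclotomicExtension {N} ℚ L] (hζ : IsPrimitiveRoot ζ N) :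
    Algebra.adjoin ℚ⟮ζ + ζ⁻¹⟯ {ζ} = ⊤ := by
  have h := IsCyclotomicExtension.adjoin_primitive_root_eq_top (A := ℚ) hζ
  rw [eq_top_iff]
  intro y _
  have hy : y ∈ Algebra.adjoin ℚ {ζ} := h ▸ Algebra.mem_top
  have : Algebra.adjoin ℚ {ζ} ≤ (Algebra.adjoin ℚ⟮ζ + ζ⁻¹⟯ {ζ}).restrictScalars ℚ := by
    rw [Algebra.adjoin_le_iff]
    exact Algebra.subset_adjoin
  exact this hy

lemma aux_finrank (hN : 3 ≤ N) [IsCyclotomicExtension {N} ℚ L] (hζ : IsPrimitiveRoot ζ N) :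
    Module.finrank ℚ⟮ζ + ζ⁻¹⟯ L = 2 := by
  have : NeZero N := ⟨by omega⟩
  set E := ℚ⟮ζ + ζ⁻¹⟯ with hE
  have h0 : ζ ≠ 0 := hζ.ne_zero (by omega)
  have hadj := aux_adjoin hζ
  have hint : IsIntegral E ζ := Algebra.IsIntegral.isIntegral ζ
  have htop : E⟮ζ⟯ = ⊤ := by
    rw [← IntermediateField.toSubalgebra_inj, 
      IntermediateField.adjoin_simple_toSubalgebra_of_isAlgebraic hint.isAlgebraic]
    simpa using hadj
  have hdeg : Module.finrank E L = (minpoly E ζ).natDegree := by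
    rw [← IntermediateField.adjoin.finrank hint, htop, IntermediateField.finrank_top']
  have hle : (minpoly E ζ).natDegree ≤ 2 := by
    have hd := minpoly.min E ζ (p := X ^ 2 - C (AdjoinSimple.gen ℚ (ζ + ζ⁻¹)) * X + 1)
      (by monicity!) (by simp; field_simp; ring)
    refine (natDegree_le_natDegree hd).trans ?_
    compute_degree
  have hne : Module.finrank E L ≠ 1 := by
    intro h1
    have : E = ⊤ := IntermediateField.finrank_eq_one_iff_eq_top.1 h1
    let ψ : L →+* ℂ := Classical.choice (inferInstance : Nonempty (L →+* ℂ))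
    have hr := aux_real hN hζ (ψ.comp (algebraMap E L))
    rw [ComplexEmbedding.isReal_iff] at hr
    have hz : ζ ∈ E := this ▸ IntermediateField.mem_top
    have hr2 := RingHom.congr_fun hr ⟨ζ, hz⟩
    simp only [ComplexEmbedding.conjugate_coe_eq, RingHom.comp_apply] at hr2
    change (starRingEnd ℂ) (ψ ζ) = ψ ζ at hr2
    have hp : IsPrimitiveRoot (ψ ζ) N := hζ.map_of_injective ψ.injective
    have hn : ‖ψ ζ‖ = 1 := Complex.norm_eq_one_of_pow_eq_one hp.pow_eq_one (by omega)
    have hsq : (ψ ζ) ^ 2 = 1 := by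
      have := Complex.mul_conj (ψ ζ)
      rw [hr2, Complex.normSq_eq_norm_sq, hn] at this
      rw [sq, this]; simp
    have := Nat.le_of_dvd (by norm_num) (hp.dvd_of_pow_eq_one 2 hsq)
    omega
  have := Module.finrank_pos (R := E) (M := L)
  omega

lemma aux_diff (hN : 3 ≤ N) (hfac : 2 ≤ N.primeFactors.card)
    (hform : ¬ ∃ p k : ℕ, p.Prime ∧ Odd p ∧ 1 ≤ k ∧ N = 2 * p ^ k)
    [IsCyclotomicExtension {N} ℚ L] (hζ : IsPrimitiveRoot ζ N) :
    differentIdeal (𝓞 ℚ⟮ζ + ζ⁻¹⟯) (𝓞 L) = ⊤ := by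
  have : NeZero N := ⟨by omega⟩
  set E := ℚ⟮ζ + ζ⁻¹⟯ with hE
  have h0 : ζ ≠ 0 := hζ.ne_zero (by omega)
  let z : 𝓞 L := hζ.toInteger
  have hz : IsPrimitiveRoot z N := hζ.toInteger_isPrimitiveRoot
  have hmem := aeval_derivative_mem_differentIdeal (𝓞 E) E L z (aux_adjoin hζ)
  apply Ideal.eq_top_of_isUnit_mem _ hmem
  have hxint : IsIntegral ℤ (AdjoinSimple.gen ℚ (ζ + ζ⁻¹)) := by
    have : IsIntegral ℤ (ζ + ζ⁻¹) :=
      (hζ.isIntegral (by omega)).add (hζ.inv.isIntegral (by omega))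
    exact (isIntegral_algHom_iff (E.val.restrictScalars ℤ) Subtype.val_injective).1 this
  let x : 𝓞 E := ⟨_, hxint⟩
  let f : (𝓞 E)[X] := X ^ 2 - C x * X + 1
  have hx : algebraMap (𝓞 E) (𝓞 L) x * z = z ^ 2 + 1 := by
    apply RingOfIntegers.ext
    change (ζ + ζ⁻¹) * ζ = ζ ^ 2 + 1
    field_simp
  have hf : aeval z f = 0 := by
    simp only [f, map_add, map_sub, map_mul, map_pow, aeval_X, aeval_C, map_one, hx]; ring
  obtain ⟨g, hg⟩ := minpoly.isIntegrallyClosed_dvd (Algebra.IsIntegral.isIntegral (R := 𝓞 E) z) hf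
  have h1 : aeval z (derivative f) = aeval z (derivative (minpoly (𝓞 E) z)) * aeval z g := by
    rw [hg, derivative_mul]; simp
  have h2 : z * aeval z (derivative f) = z ^ 2 - 1 := by
    have : aeval z (derivative f) = 2 * z - algebraMap (𝓞 E) (𝓞 L) x := by
      simp only [f, derivative_add, derivative_sub, derivative_X_pow, derivative_C_mul, derivative_X,
        derivative_one]
      simp
      exact Or.inl (map_ofNat _ 2)
    rw [this, mul_sub, mul_comm z (algebraMap _ _ _), hx]; ring
  have hu : IsUnit (z ^ 2 - 1) := aux_unit2 hN hfac hform hz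
  rw [← h2] at hu
  refine isUnit_of_dvd_unit ?_ hu
  rw [h1]
  exact Dvd.intro_left _ (by ring : z * aeval z g * _ = _)

lemma aux_main (hN : 3 ≤ N) (hfac : 2 ≤ N.primeFactors.card)
    (hform : ¬ ∃ p k : ℕ, p.Prime ∧ Odd p ∧ 1 ≤ k ∧ N = 2 * p ^ k)
    [IsCyclotomicExtension {N} ℚ L] (hζ : IsPrimitiveRoot ζ N) :
    (NumberField.discr ℚ⟮ζ + ζ⁻¹⟯ : ℚ) =
      (N : ℚ) ^ (N.totient / 2) /
        ∏ p ∈ N.primeFactors, (p : ℚ) ^ (N.totient / (2 * (p - 1))) := by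
  have : NeZero N := ⟨by omega⟩
  set E := ℚ⟮ζ + ζ⁻¹⟯ with hE
  have key := natAbs_discr_eq_absNorm_differentIdeal_mul_natAbs_discr_pow E (𝓞 E) L (𝓞 L)
  rw [aux_diff hN hfac hform hζ, aux_finrank hN hζ, Ideal.absNorm_top, one_mul] at key
  have hL := IsCyclotomicExtension.Rat.natAbs_discr N L
  have hreal : IsTotallyReal E := ⟨fun v => by
    rw [← InfinitePlace.mk_embedding v]
    exact ⟨_, aux_real hN hζ _, rfl⟩⟩
  have hpos : 0 < discr E := by
    rw [← Int.sign_eq_one_iff_pos, sign_discr, IsTotallyReal.nrComplexPlaces_eq_zero, pow_zero]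
  have hsq : (discr E : ℚ) ^ 2 = (N : ℚ) ^ N.totient /
      ∏ p ∈ N.primeFactors, (p : ℚ) ^ (N.totient / (p - 1)) := by
    have h3 : ((discr L).natAbs : ℚ) = (discr E : ℚ) ^ 2 := by
      rw [key]; push_cast
      rw [Nat.cast_natAbs, Int.cast_abs, sq_abs]
    rw [← h3, hL, Nat.cast_div (Nat.prod_primeFactors_pow_totient_ediv_dvd (by omega))]
    · push_cast; rfl
    · simp only [Nat.cast_ne_zero, Finset.prod_ne_zero_iff]
      intro p hp
      exact pow_ne_zero _ (Nat.prime_of_mem_primeFactors hp).ne_zero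
  have hD : (0 : ℚ) ≤ (N : ℚ) ^ (N.totient / 2) /
        ∏ p ∈ N.primeFactors, (p : ℚ) ^ (N.totient / (2 * (p - 1))) := by positivity
  refine (pow_left_inj₀ (by exact_mod_cast hpos.le) hD two_ne_zero).1 ?_
  rw [hsq, div_pow, ← pow_mul, Nat.div_mul_cancel (Nat.totient_even (by omega)).two_dvd,
    ← Finset.prod_pow]
  congr 1
  refine Finset.prod_congr rfl fun p hp => ?_
  rw [← pow_mul, aux_even hN hfac hform hp]

end

theorem stmt_10 (N : ℕ) (hN : 3 ≤ N) (hfac : 2 ≤ N.primeFactors.card)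
    (hform : ¬ ∃ p k : ℕ, p.Prime ∧ Odd p ∧ 1 ≤ k ∧ N = 2 * p ^ k)
    (ζ : ℂ) (hζ : IsPrimitiveRoot ζ N) [NumberField ↥ℚ⟮ζ + ζ⁻¹⟯] :
    (NumberField.discr ℚ⟮ζ + ζ⁻¹⟯ : ℚ) =
      (N : ℚ) ^ (N.totient / 2) /
        ∏ p ∈ N.primeFactors, (p : ℚ) ^ (N.totient / (2 * (p - 1))) := by
  have : NeZero N := ⟨by omega⟩
  have hcyc : IsCyclotomicExtension {N} ℚ (CyclotomicField N ℚ) := by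
    have h := CyclotomicField.isCyclotomicExtension N ℚ
    have h2 : CyclotomicField.algebra N ℚ = DivisionRing.toRatAlgebra := Subsingleton.elim _ _
    rw [h2] at h
    exact h
  have h0 := IsCyclotomicExtension.zeta_spec N ℚ (CyclotomicField N ℚ)
  let φ : CyclotomicField N ℚ →ₐ[ℚ] ℂ := IsAlgClosed.lift
  have h1 := h0.map_of_injective φ.injective
  obtain ⟨i, -, hi⟩ := h1.eq_pow_of_pow_eq_one hζ.pow_eq_one
  obtain ⟨z, hz⟩ : ∃ z : CyclotomicField N ℚ, φ z = ζ := ⟨_, by rw [map_pow]; exact hi⟩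
  have hzp : IsPrimitiveRoot z N := by
    rw [← hz] at hζ
    exact hζ.of_map_of_injective φ.injective
  have hmap : ℚ⟮z + z⁻¹⟯.map φ = ℚ⟮ζ + ζ⁻¹⟯ := by
    rw [IntermediateField.adjoin_map, Set.image_singleton, map_add, map_inv₀, hz]
  let e : ℚ⟮z + z⁻¹⟯ ≃ₐ[ℚ] ℚ⟮ζ + ζ⁻¹⟯ :=
    (ℚ⟮z + z⁻¹⟯.equivMap φ).trans (IntermediateField.equivOfEq hmap)
  rw [← NumberField.discr_eq_discr_of_algEquiv _ e]
  exact aux_main hN hfac hform hzp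
end

section
/- For every integer n ≥ 2, the polynomial discriminant of w_n(x) equals (2n−1)^{n−2}, and the polynomial discriminant of w_n(x²) equals 2^{2n−2}·(2n−1)^{2n−3}. -/
open Polynomial

/-- The discriminant of a monic polynomial `f ∈ ℤ[x]` of degree `m`, computed via its
complex roots: `disc f = (−1)^(m(m−1)/2) · ∏_{f(r) = 0} f'(r)`, which for monic `f` equals
`(−1)^(m(m−1)/2) · Res(f, f')` and also `∏_{i<j} (rᵢ − rⱼ)²`. -/
noncomputable def polyDisc (f : Polynomial ℤ) : ℂ :=
  (-1) ^ (f.natDegree * (f.natDegree - 1) / 2) *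
    (((f.map (Int.castRingHom ℂ)).roots).map
      fun r => Polynomial.eval r (Polynomial.derivative (f.map (Int.castRingHom ℂ)))).prod

noncomputable def wc (n : ℕ) : Polynomial ℂ := (w n).map (Int.castRingHom ℂ)

lemma wc_zero : wc 0 = 1 := by simp [wc, w]
lemma wc_one : wc 1 = 1 := by simp [wc, w]
lemma wc_rec (n : ℕ) : wc (n+2) = (X - C 2) * wc (n+1) - wc n := by
  simp [wc, w, show (C 2 : ℂ[X]) = 2 from rfl]

lemma w_monic_deg (n : ℕ) : ((w n).Monic ∧ (w n).natDegree = n - 1) ∧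
    ((w (n+1)).Monic ∧ (w (n+1)).natDegree = n) := by
  induction n with
  | zero => simp [w]
  | succ n ih =>
    refine ⟨ih.2, ?_⟩
    obtain ⟨⟨h1, h2⟩, h3, h4⟩ := ih
    have hm : ((X - C 2 : ℤ[X]) * w (n+1)).Monic := (monic_X_sub_C 2).mul h3
    have hd : ((X - C 2 : ℤ[X]) * w (n+1)).natDegree = n + 1 := by
      rw [(monic_X_sub_C 2).natDegree_mul h3, natDegree_X_sub_C, h4, add_comm]
    have hlt : (w n).natDegree < ((X - C 2 : ℤ[X]) * w (n+1)).natDegree := by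
      rw [hd, h2]; omega
    have hlt' : (w n).degree < ((X - C 2 : ℤ[X]) * w (n+1)).degree := degree_lt_degree hlt
    have e : w (n+1+1) = (X - C 2) * w (n+1) - w n := by rw [w]
    rw [e]
    exact ⟨hm.sub_of_left hlt', by rw [natDegree_sub_eq_left_of_natDegree_lt hlt, hd]⟩

lemma wc_monic (n : ℕ) : (wc n).Monic := (w_monic_deg n).1.1.map _
lemma wc_deg (n : ℕ) : (wc (n+1)).natDegree = n := by
  rw [wc, (w_monic_deg n).2.1.natDegree_map, (w_monic_deg n).2.2]

lemma wc_deriv (n : ℕ) :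
    (X * (X - 4) * derivative (wc (n+1)) =
      - (2 * (n : ℂ[X]) + 1) * wc n + ((n : ℂ[X]) * X + 1 - 2 * (n : ℂ[X])) * wc (n+1)) ∧
    (X * (X - 4) * derivative (wc (n+2)) =
      - (2 * (n : ℂ[X]) + 3) * wc (n+1) + (((n : ℂ[X])+1) * X - 1 - 2 * (n : ℂ[X])) * wc (n+2)) := by
  have hC : (C 2 : ℂ[X]) = 2 := rfl
  induction n with
  | zero =>
    constructor
    · simp [wc_zero, wc_one]
    · rw [wc_rec, wc_one, wc_zero, hC]; simp; ring
  | succ n ih =>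
    obtain ⟨h1, h2⟩ := ih
    have hd : derivative (wc (n+3)) = wc (n+2) + (X - 2) * derivative (wc (n+2))
        - derivative (wc (n+1)) := by
      rw [wc_rec (n+1), hC]; simp
    have r3 := wc_rec (n+1)
    have r2 := wc_rec n
    rw [hC] at r3 r2
    push_cast
    constructor
    · linear_combination h2
    · change X * (X - 4) * derivative (wc (n+3)) = _ * wc (n+2) + _ * wc (n+3)
      change wc (n+3) = _ * wc (n+2) - wc (n+1) at r3
      rw [hd, r3]
      linear_combination (X - 2) * h2 - h1 + (2 * n + 1 : ℂ[X]) * r2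

noncomputable def PP (f g : ℂ[X]) : ℂ := (f.roots.map fun r => g.eval r).prod

lemma PP_res (f g : ℂ[X]) (hf : f.Monic) : PP f g = resultant f g := by
  rw [resultant_eq_prod_eval f g _ le_rfl (IsAlgClosed.splits f)]
  simp [PP, hf.leadingCoeff]

lemma PP_comm (f g : ℂ[X]) (hf : f.Monic) (hg : g.Monic) :
    PP f g = (-1) ^ (f.natDegree * g.natDegree) * PP g f := by
  rw [PP_res f g hf, PP_res g f hg, resultant_comm]

lemma PP_wc (n : ℕ) : PP (wc (n+1)) (wc n) = (-1) ^ (n * (n - 1) / 2) := by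
  induction n with
  | zero => simp [PP, wc_zero]
  | succ n ih =>
    rw [PP_comm _ _ (wc_monic _) (wc_monic _), wc_deg, wc_deg]
    have : PP (wc (n+1)) (wc (n+1+1)) = (-1) ^ n * PP (wc (n+1)) (wc n) := by
      have hc : (wc (n+1)).roots.card = n := by
        rw [← (IsAlgClosed.splits (wc (n+1))).natDegree_eq_card_roots, wc_deg]
      have hc2 : ((wc (n+1)).roots.map fun r => eval r (wc n)).card = n := by simp [hc]
      have hn := Multiset.prod_map_neg ((wc (n+1)).roots.map fun r => eval r (wc n))
      rw [hc2] at hn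
      unfold PP
      rw [← hn, Multiset.map_map]
      congr 1
      apply Multiset.map_congr rfl
      intro r hr
      have := isRoot_of_mem_roots hr
      rw [wc_rec]
      simp [this.eq_zero]
    rw [this, ih, (by rw [mul_comm]; exact Nat.even_mul_succ_self n : Even ((n+1)*n)).neg_one_pow,
      one_mul, ← pow_add]
    congr 1
    have := Nat.triangle_succ n
    simp only [Nat.add_sub_cancel] at this ⊢
    omega

lemma wc_eval_zero (n : ℕ) : (wc (n+1)).eval 0 = (-1)^n * (2 * n + 1) ∧
    (wc (n+2)).eval 0 = (-1)^(n+1) * (2 * n + 3) := by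
  induction n with
  | zero => constructor <;> simp [wc_rec, wc_one, wc_zero]; norm_num
  | succ n ih =>
    refine ⟨by rw [ih.2]; push_cast; ring, ?_⟩
    rw [wc_rec]
    simp only [eval_sub, eval_mul, eval_X, eval_C]
    rw [show n + 1 + 1 = n + 2 from rfl, ih.1, ih.2]; push_cast; ring

lemma wc_eval_four (n : ℕ) : (wc n).eval 4 = 1 ∧ (wc (n+1)).eval 4 = 1 := by
  induction n with
  | zero => simp [wc_one, wc_zero]
  | succ n ih =>
    refine ⟨ih.2, ?_⟩
    rw [wc_rec]
    simp only [eval_sub, eval_mul, eval_X, eval_C]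
    rw [ih.1, ih.2]; norm_num

lemma PP_X_sub (f : ℂ[X]) (hf : f.Monic) (a : ℂ) :
    PP f (X - C a) = (-1) ^ f.natDegree * f.eval a := by
  rw [PP_comm _ _ hf (monic_X_sub_C a)]
  simp [PP, -map_sub]

lemma PP_mul (f g h : ℂ[X]) : PP f (g * h) = PP f g * PP f h := by
  simp [PP, Multiset.prod_map_mul]

lemma PP_C (f : ℂ[X]) (a : ℂ) : PP f (C a) = a ^ f.natDegree := by
  simp [PP, (IsAlgClosed.splits f).natDegree_eq_card_roots]

lemma PP_add_mul (f g h : ℂ[X]) : PP f (g + h * f) = PP f g := by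
  unfold PP
  congr 1
  apply Multiset.map_congr rfl
  intro r hr
  simp [(isRoot_of_mem_roots hr).eq_zero]

lemma PP_deriv (n : ℕ) (hn : 1 ≤ n) : PP (wc (n+1)) (derivative (wc (n+1))) =
    (-1) ^ (n * (n - 1) / 2) * (2 * n + 1) ^ (n - 1) := by
  have h := congrArg (PP (wc (n+1))) (wc_deriv n).1
  have e0 : PP (wc (n+1)) X = 2 * n + 1 := by
    have := PP_X_sub (wc (n+1)) (wc_monic _) 0
    rw [wc_deg, (wc_eval_zero n).1, ← mul_assoc, ← pow_add, Even.neg_one_pow ⟨n, rfl⟩] at this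
    simpa using this
  have e4 : PP (wc (n+1)) (X - 4) = (-1)^n := by
    have := PP_X_sub (wc (n+1)) (wc_monic _) 4
    rw [wc_deg, (wc_eval_four n).2, mul_one] at this
    exact this
  have e5 : PP (wc (n+1)) (-(2 * n + 1 : ℂ[X])) = (-1)^n * (2*n+1)^n := by
    have := PP_C (wc (n+1)) (-(2*n+1))
    rw [wc_deg, neg_pow] at this
    rw [← this]
    simp [show (C 2 : ℂ[X]) = 2 from rfl]
  rw [PP_add_mul, PP_mul, PP_mul, PP_mul, e0, e4, e5, PP_wc] at h
  have hne : (2 * n + 1 : ℂ) ≠ 0 := by exact_mod_cast (by omega : 2 * n + 1 ≠ 0)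
  have hne' : ((-1) ^ n : ℂ) ≠ 0 := by simp
  obtain ⟨m, rfl⟩ : ∃ m, n = m + 1 := ⟨n - 1, by omega⟩
  apply mul_left_cancel₀ (mul_ne_zero hne hne')
  rw [h, Nat.add_sub_cancel]
  ring

lemma PP_sq (f g : ℂ[X]) (hf : f.Monic) :
    PP (f.comp (X ^ 2)) (g.comp (X ^ 2)) = PP f g ^ 2 := by
  have hs : f.comp (X^2) = (f.roots.map fun r => X ^ 2 - C r).prod := by
    conv_lhs => rw [(IsAlgClosed.splits f).eq_prod_roots_of_monic hf]
    rw [multiset_prod_comp, Multiset.map_map]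
    simp
  have hne : ∀ r : ℂ, (X ^ 2 - C r : ℂ[X]) ≠ 0 := fun r => X_pow_sub_C_ne_zero (by norm_num) r
  rw [hs]
  unfold PP
  rw [roots_multiset_prod]
  · rw [Multiset.map_bind, Multiset.prod_bind, Multiset.map_map, ← Multiset.prod_map_pow]
    congr 1
    apply Multiset.map_congr rfl
    intro r _
    obtain ⟨s, hs⟩ := IsAlgClosed.exists_pow_nat_eq r (n := 2) (by norm_num)
    have hfac : (X ^ 2 - C r : ℂ[X]) = (X - C s) * (X - C (-s)) := by
      rw [← hs]; simp; ring
    have hr : (X ^ 2 - C r : ℂ[X]).roots = {s} + {-s} := by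
      rw [hfac, roots_mul (by rw [← hfac]; exact hne r), roots_X_sub_C, roots_X_sub_C]
    simp only [Function.comp, hr]
    simp [hs, sq]
    rw [← hs, sq]
  · simp [hne]

lemma PP_deriv_sq (f : ℂ[X]) (hf : f.Monic) :
    PP (f.comp (X ^ 2)) (derivative (f.comp (X ^ 2))) =
      4 ^ f.natDegree * f.eval 0 * PP f (derivative f) ^ 2 := by
  have hm : (f.comp (X^2)).Monic := hf.comp (monic_X_pow 2) (by simp)
  have hd : (f.comp (X^2)).natDegree = 2 * f.natDegree := by
    rw [natDegree_comp, natDegree_X_pow, mul_comm]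
  have hx := PP_X_sub _ hm 0
  rw [derivative_comp, PP_mul, PP_sq _ _ hf]
  have : (derivative (X ^ 2 : ℂ[X])) = C 2 * (X - C 0) := by
    simp [show (C 2 : ℂ[X]) = 2 from rfl, one_add_one_eq_two]
  rw [this, PP_mul, PP_C, hx, hd, pow_mul, pow_mul]
  simp
  left; norm_num

theorem stmt_16 (n : ℕ) (hn : 2 ≤ n) :
    polyDisc (w n) = ((2 * n - 1 : ℕ) : ℂ) ^ (n - 2) ∧
    polyDisc ((w n).comp (X ^ 2)) =
      2 ^ (2 * n - 2) * ((2 * n - 1 : ℕ) : ℂ) ^ (2 * n - 3) := by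
  obtain ⟨m, rfl⟩ : ∃ m, n = m + 1 + 1 := ⟨n - 2, by omega⟩
  have key := PP_deriv (m+1) (by omega)
  have hdeg : (w (m+1+1)).natDegree = m + 1 := (w_monic_deg (m+1)).2.2
  have hcast : ((2 * (m+1+1) - 1 : ℕ) : ℂ) = 2 * (m + 1 : ℕ) + 1 := by
    rw [show 2 * (m+1+1) - 1 = 2 * (m + 1) + 1 by omega]; push_cast; ring
  have hsq : ∀ k : ℕ, ((-1 : ℂ) ^ k) * (-1)^k = 1 := fun k => by
    rw [← pow_add, Even.neg_one_pow ⟨k, rfl⟩]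
  rw [hcast]
  constructor
  · change (-1) ^ _ * PP (wc (m+1+1)) (derivative (wc (m+1+1))) = _
    rw [key, hdeg, ← mul_assoc, hsq, one_mul]
    rfl
  · have hmap : ((w (m+1+1)).comp (X^2)).map (Int.castRingHom ℂ) = (wc (m+1+1)).comp (X^2) := by
      rw [map_comp]; simp [wc]
    unfold polyDisc
    rw [hmap]
    change _ * PP ((wc (m+1+1)).comp (X^2)) (derivative ((wc (m+1+1)).comp (X^2))) = _
    rw [PP_deriv_sq _ (wc_monic _), key, wc_deg, (wc_eval_zero (m+1)).1, natDegree_comp, hdeg,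
      natDegree_X_pow]
    have he : (m+1) * 2 * ((m+1) * 2 - 1) / 2 = 2 * ((m+1) * m) + (m + 1) := by
      rw [show (m+1) * 2 - 1 = 2 * m + 1 by omega]
      apply Nat.div_eq_of_eq_mul_left (by norm_num)
      ring
    rw [he, mul_pow, ← pow_mul, mul_comm _ 2, pow_mul (-1 : ℂ) 2 ]
    rw [pow_add, pow_mul (-1 : ℂ) 2]
    rw [show 2 * (m+1+1) - 2 = 2 * (m+1) by omega, show 2 * (m+1+1) - 3 = 2 * m + 1 by omega,
      Nat.add_sub_cancel, pow_mul (2:ℂ) 2]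
    norm_num
    have := hsq (m+1)
    generalize (2 * ((m : ℂ) + 1) + 1) = t
    linear_combination (4 ^ (m+1) * t * (t ^ m)^2) * this
end

section
/- Let n ≥ 2 be an integer such that 2n−1 satisfies Condition C. Then every monic irreducible factor g(x) ∈ ℤ[x] of w_n(x) is monogenic and has cyclic Galois group over ℚ. -/
open Polynomial IntermediateField

theorem w_eval_aux (z : ℂ) (hz : z ≠ 0) (n : ℕ) :
    aeval (z + z⁻¹ + 2) (w n) * ((z + 1) * z ^ n) = z ^ (2 * n) + z := by
  induction n using Nat.twoStepInduction with
  | zero => simp [w]; ring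
  | one => simp [w]; ring
  | more n h1 h2 =>
    have e : aeval (z + z⁻¹ + 2) (w (n + 2)) =
        (z + z⁻¹) * aeval (z + z⁻¹ + 2) (w (n + 1)) - aeval (z + z⁻¹ + 2) (w n) := by
      rw [w]; simp only [map_sub, map_mul, aeval_X, aeval_C]; simp
    have e2 : aeval (z + z⁻¹ + 2) (w (n + 2)) * ((z + 1) * z ^ (n + 2)) =
        (z ^ 2 + 1) * (aeval (z + z⁻¹ + 2) (w (n + 1)) * ((z + 1) * z ^ (n + 1))) -
        z ^ 2 * (aeval (z + z⁻¹ + 2) (w n) * ((z + 1) * z ^ n)) := by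
      rw [e]; field_simp; ring
    rw [e2, h1, h2]; ring

theorem w_zero_aux (n : ℕ) : aeval (0 : ℂ) (w n) = (-1) ^ (n + 1) * (2 * n - 1) := by
  induction n using Nat.twoStepInduction with
  | zero => simp [w]
  | one => simp [w]; norm_num
  | more n h1 h2 =>
    have e : aeval (0 : ℂ) (w (n + 2)) =
        (0 - 2) * aeval (0 : ℂ) (w (n + 1)) - aeval (0 : ℂ) (w n) := by
      rw [w]; simp only [map_sub, map_mul, aeval_X, aeval_C]; simp
    rw [e, h1, h2]; push_cast; ring

/-- Roots of `w n` come from roots of unity. -/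
theorem w_root (n : ℕ) (hn : 2 ≤ n) (θ : ℂ) (h : aeval θ (w n) = 0) :
    ∃ ζ : ℂ, ζ ^ (2 * n - 1) = 1 ∧ ζ ≠ 1 ∧ θ = 2 - (ζ + ζ⁻¹) := by
  obtain ⟨z, hz⟩ := IsAlgClosed.exists_root (k := ℂ)
    (X ^ 2 - C (θ - 2) * X + C 1) (by
      have : (X ^ 2 - C (θ - 2) * X + C 1 : ℂ[X]).degree = 2 := by compute_degree!
      rw [this]; decide)
  simp at hz
  have hz0 : z ≠ 0 := by rintro rfl; simp at hz
  have hθ : θ = z + z⁻¹ + 2 := by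
    field_simp; linear_combination -hz
  have h1 := w_eval_aux z hz0 n
  rw [← hθ, h, zero_mul] at h1
  have h2 : z * (z ^ (2 * n - 1) + 1) = 0 := by
    have : z * z ^ (2 * n - 1) = z ^ (2 * n) := by
      rw [← pow_succ']; congr 1; omega
    linear_combination this - h1
  have h3 : z ^ (2 * n - 1) + 1 = 0 := (mul_eq_zero.1 h2).resolve_left hz0
  have hodd : Odd (2 * n - 1) := ⟨n - 1, by omega⟩
  refine ⟨-z, ?_, ?_, ?_⟩
  · rw [hodd.neg_pow]; linear_combination -h3
  · intro h4
    have hz1 : z = -1 := by linear_combination -h4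
    have : θ = 0 := by rw [hθ, hz1]; norm_num
    rw [this, w_zero_aux] at h
    have h5 : (2 * n - 1 : ℂ) = 0 := by simpa using h
    have h6 : (2 * n : ℂ) = 1 := by linear_combination h5
    have : 2 * n = 1 := by exact_mod_cast h6
    omega
  · rw [hθ, inv_neg]; ring

theorem cyc_of_coprime {A B G : Type*} [CommGroup A] [CommGroup B] [Group G] [IsCyclic A]
    [IsCyclic B] [Finite A] [Finite B] (f : A × B →* G) (hf : Function.Surjective f) (s : A) (t : B)
    (hst : f (s, t) = 1) (ht2 : t ^ 2 = 1) (ht : t ≠ 1) (k : ℕ) (hB : Nat.card B = 2 * k)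
    (hk : Odd k) (hc : (Nat.card A).Coprime k) : IsCyclic G := by
  obtain ⟨a, ha⟩ := IsCyclic.exists_generator (α := A)
  obtain ⟨h, hh⟩ := IsCyclic.exists_generator (α := B)
  have hoh : orderOf h = 2 * k := by rw [← hB]; exact orderOf_eq_card_of_forall_mem_zpowers hh
  have hoa : orderOf a = Nat.card A := orderOf_eq_card_of_forall_mem_zpowers ha
  have hh2k : h ^ (2 * k) = 1 := by rw [← hoh]; exact pow_orderOf_eq_one h
  -- the element of order two
  have hkt : h ^ k = t := by
    obtain ⟨j, rfl⟩ := (mem_powers_iff_mem_zpowers (x := h)).2 (hh t)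
    simp only at ht2 ht
    have h1 : 2 * k ∣ j * 2 := by
      rw [← hoh]; apply orderOf_dvd_of_pow_eq_one; rw [pow_mul]; exact ht2
    have h2 : k ∣ j := by
      rw [mul_comm j] at h1; exact Nat.dvd_of_mul_dvd_mul_left (by norm_num) h1
    obtain ⟨c, rfl⟩ := h2
    rcases Nat.even_or_odd' c with ⟨e, rfl | rfl⟩
    · exfalso; apply ht
      rw [show k * (2 * e) = (2 * k) * e by ring, pow_mul, hh2k, one_pow]
    · show _ = h ^ (k * (2 * e + 1))
      rw [show k * (2 * e + 1) = (2 * k) * e + k by ring, pow_add, pow_mul, hh2k, one_pow, one_mul]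
  set H : Subgroup G := Subgroup.zpowers (f (a, h ^ 2)) with hH
  have m0 : f (a, h ^ 2) ∈ H := Subgroup.mem_zpowers _
  have m1 : f (a, 1) ^ k ∈ H := by
    have : f (a, 1) ^ k = f (a, h ^ 2) ^ k := by
      rw [← map_pow, ← map_pow]; congr 1
      ext <;> simp [← pow_mul, hh2k]
    rw [this]; exact pow_mem m0 k
  have m2 : f (a, 1) ^ (Nat.card A) ∈ H := by
    have : f (a, 1) ^ (Nat.card A) = 1 := by
      rw [← map_pow, ← hoa]
      have : ((a, 1) : A × B) ^ orderOf a = 1 := by ext <;> simp [pow_orderOf_eq_one]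
      rw [this, map_one]
    rw [this]; exact one_mem _
  have key : ∀ (x : G) (u v : ℕ), u.Coprime v → x ^ u ∈ H → x ^ v ∈ H → x ∈ H := by
    intro x u v huv hu hv
    have hb := Nat.gcd_eq_gcd_ab u v
    rw [huv] at hb
    have : x = (x ^ u) ^ (u.gcdA v) * (x ^ v) ^ (u.gcdB v) := by
      rw [← zpow_natCast x u, ← zpow_natCast x v, ← zpow_mul, ← zpow_mul, ← zpow_add, ← hb]; simp
    rw [this]
    exact mul_mem (zpow_mem hu _) (zpow_mem hv _)
  have ma : f (a, 1) ∈ H := key _ _ _ hc m2 m1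
  have mA : ∀ x : A, f (x, 1) ∈ H := by
    intro x
    obtain ⟨i, rfl⟩ := ha x
    have : f (a ^ i, 1) = f (a, 1) ^ i := by rw [← map_zpow]; congr 1; ext <;> simp
    simp only [this]; exact zpow_mem ma i
  have m3 : f (1, h) ^ 2 ∈ H := by
    have : f (1, h) ^ 2 = f (a⁻¹, 1) * f (a, h ^ 2) := by
      rw [← map_pow, ← map_mul]; congr 1; ext <;> simp
    rw [this]; exact mul_mem (mA _) m0
  have m4 : f (1, h) ^ k ∈ H := by
    have : f (1, h) ^ k = f (s⁻¹, 1) * f (s, t) := by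
      rw [← map_pow, ← map_mul]; congr 1; ext <;> simp [hkt]
    rw [this, hst, mul_one]; exact mA _
  have mh : f (1, h) ∈ H := key _ _ _ (Nat.coprime_two_left.2 hk) m3 m4
  refine ⟨f (a, h ^ 2), fun g => ?_⟩
  obtain ⟨⟨x, y⟩, rfl⟩ := hf g
  obtain ⟨i, rfl⟩ := hh y
  have : f (x, h ^ i) = f (x, 1) * f (1, h) ^ i := by
    rw [← map_zpow, ← map_mul]; congr 1; ext <;> simp
  simp only [this]
  exact mul_mem (mA x) (zpow_mem mh i)

theorem neg_one_ne_one_units (p a : ℕ) (hp : p.Prime) (ho : Odd p) (ha : 0 < a) :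
    (-1 : (ZMod (p ^ a))ˣ) ≠ 1 := by
  intro h
  have h1 : (-1 : ZMod (p ^ a)) = 1 := by simpa using congrArg Units.val h
  have h2 : 2 < p ^ a := by
    have : 2 < p := by
      rcases hp.two_le.lt_or_eq with h | h
      · exact h
      · rw [← h] at ho; exact absurd ho (by decide)
    exact lt_of_lt_of_le this (Nat.le_self_pow ha.ne' p)
  haveI : Fact (2 < p ^ a) := ⟨h2⟩
  exact ZMod.neg_one_ne_one h1

theorem cyc_units {N : ℕ} (hN : Odd N) (hC : ConditionC N) {G : Type*} [Group G]
    (f : (ZMod N)ˣ →* G) (hf : Function.Surjective f) (h1 : f (-1) = 1) : IsCyclic G := by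
  rcases hC with ⟨-, h⟩ | ⟨h, -⟩
  swap
  · exact absurd h (Nat.not_even_iff_odd.2 hN)
  rcases h with ⟨p, a, hp, ho, ha, rfl⟩ | ⟨p, q, a, b, hp, hq, hop, hoq, hpq, ha, hb, hg, rfl⟩
  · haveI := ZMod.isCyclic_units_of_prime_pow p hp (by rintro rfl; exact absurd ho (by decide)) a
    exact isCyclic_of_surjective f hf
  · haveI := ZMod.isCyclic_units_of_prime_pow p hp (by rintro rfl; exact absurd hop (by decide)) a
    haveI := ZMod.isCyclic_units_of_prime_pow q hq (by rintro rfl; exact absurd hoq (by decide)) b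
    haveI : NeZero (p ^ a) := ⟨(pow_pos hp.pos a).ne'⟩
    haveI : NeZero (q ^ b) := ⟨(pow_pos hq.pos b).ne'⟩
    have hcop : (p ^ a).Coprime (q ^ b) :=
      Nat.Coprime.pow _ _ ((Nat.coprime_primes hp hq).2 hpq)
    let e : (ZMod (p ^ a * q ^ b))ˣ ≃* (ZMod (p ^ a))ˣ × (ZMod (q ^ b))ˣ :=
      (Units.mapEquiv (ZMod.chineseRemainder hcop).toMulEquiv).trans .prodUnits
    have he : e (-1) = (-1, -1) := by
      ext <;> simp [e, MulEquiv.prodUnits]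
    have he' : e.symm (-1, -1) = -1 := by rw [← he, e.symm_apply_apply]
    have hcA : Nat.card (ZMod (p ^ a))ˣ = (p ^ a).totient := by
      rw [Nat.card_eq_fintype_card, ZMod.card_units_eq_totient]
    have hcB : Nat.card (ZMod (q ^ b))ˣ = (q ^ b).totient := by
      rw [Nat.card_eq_fintype_card, ZMod.card_units_eq_totient]
    obtain ⟨u, v, huv, hu, hv⟩ : ∃ u v : ℕ, u.Coprime v ∧ (p ^ a).totient = 2 * u ∧
        (q ^ b).totient = 2 * v := by
      obtain ⟨u, v, huv, hu, hv⟩ := Nat.exists_coprime (p ^ a).totient (q ^ b).totient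
      rw [hg] at hu hv
      exact ⟨u, v, huv, by omega, by omega⟩
    by_cases hvo : Odd v
    · refine cyc_of_coprime (f.comp e.symm.toMonoidHom) (hf.comp e.symm.surjective) (-1) (-1)
        (by simpa [he'] using h1) (by simp) (neg_one_ne_one_units q b hq hoq hb) v (by omega) hvo ?_
      rw [hcA, hu]
      exact Nat.Coprime.mul_left (Nat.coprime_two_left.2 hvo) huv
    · have huo : Odd u := by
        by_contra hue
        rw [Nat.not_odd_iff_even] at hue hvo
        have := Nat.dvd_gcd hue.two_dvd hvo.two_dvd
        rw [huv] at this
        omega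
      let c : (ZMod (q ^ b))ˣ × (ZMod (p ^ a))ˣ ≃* (ZMod (p ^ a))ˣ × (ZMod (q ^ b))ˣ :=
        MulEquiv.prodComm
      refine cyc_of_coprime ((f.comp e.symm.toMonoidHom).comp c.toMonoidHom)
        ((hf.comp e.symm.surjective).comp c.surjective) (-1) (-1)
        (by simpa [c, he'] using h1) (by simp) (neg_one_ne_one_units p a hp hop ha) u (by omega) huo ?_
      rw [hcB, hv]
      exact Nat.Coprime.mul_left (Nat.coprime_two_left.2 huo) huv.symm

theorem cyc_ext {d : ℕ} [NeZero d] {ζ : ℂ} (hζ : IsPrimitiveRoot ζ d) :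
    IsCyclotomicExtension {d} ℚ ℚ⟮ζ⟯ := by
  have hi : IsIntegral ℚ ζ := (hζ.isIntegral (NeZero.pos d)).tower_top
  change IsCyclotomicExtension {d} ℚ (ℚ⟮ζ⟯).toSubalgebra
  rw [IntermediateField.adjoin_simple_toSubalgebra_of_isAlgebraic hi.isAlgebraic]
  exact hζ.adjoin_isCyclotomicExtension ℚ

theorem int_mem {d : ℕ} [NeZero d] {ζ : ℂ} (hζ : IsPrimitiveRoot ζ d) (x : ℂ) (hx : x ∈ ℚ⟮ζ⟯)
    (hi : IsIntegral ℤ x) : x ∈ Algebra.adjoin ℤ {ζ} := by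
  haveI := cyc_ext hζ
  have hg : IsPrimitiveRoot (AdjoinSimple.gen ℚ ζ) d := IsPrimitiveRoot.coe_submonoidClass_iff.mp hζ
  have hc := IsCyclotomicExtension.Rat.isIntegralClosure_adjoin_singleton hg
  have hi' : IsIntegral ℤ (⟨x, hx⟩ : ℚ⟮ζ⟯) :=
    (isIntegral_algHom_iff ((ℚ⟮ζ⟯).val.restrictScalars ℤ) Subtype.val_injective).1 hi
  obtain ⟨y, hy⟩ := hc.isIntegral_iff.1 hi'
  have h2 : ((ℚ⟮ζ⟯).val.restrictScalars ℤ) y.1 ∈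
      (Algebra.adjoin ℤ {AdjoinSimple.gen ℚ ζ}).map ((ℚ⟮ζ⟯).val.restrictScalars ℤ) :=
    ⟨y.1, y.2, rfl⟩
  rw [AlgHom.map_adjoin, Set.image_singleton] at h2
  have h3 : ((ℚ⟮ζ⟯).val.restrictScalars ℤ) y.1 = x := congrArg Subtype.val hy
  rw [h3] at h2
  exact h2

theorem adjoin_decomp (ζ θ : ℂ) (h0 : ζ ≠ 0) (hθ : θ = 2 - (ζ + ζ⁻¹)) (x : ℂ)
    (hx : x ∈ Algebra.adjoin ℤ {ζ}) :
    ∃ u ∈ Algebra.adjoin ℤ {θ}, ∃ v ∈ Algebra.adjoin ℤ {θ}, x = u + v * ζ := by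
  have hsq : ζ * ζ = (2 - θ) * ζ - 1 := by rw [hθ]; field_simp; ring
  have ht : θ ∈ Algebra.adjoin ℤ {θ} := Algebra.self_mem_adjoin_singleton ℤ θ
  have h2 : (2 - θ) ∈ Algebra.adjoin ℤ {θ} := sub_mem (ofNat_mem _ 2) ht
  induction hx using Algebra.adjoin_induction with
  | mem x hx =>
    rw [Set.mem_singleton_iff] at hx
    exact ⟨0, zero_mem _, 1, one_mem _, by rw [hx]; ring⟩
  | algebraMap r => exact ⟨_, algebraMap_mem _ r, 0, zero_mem _, by ring⟩
  | add x y _ _ hx hy =>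
    obtain ⟨u, hu, v, hv, rfl⟩ := hx
    obtain ⟨u', hu', v', hv', rfl⟩ := hy
    exact ⟨u + u', add_mem hu hu', v + v', add_mem hv hv', by ring⟩
  | mul x y _ _ hx hy =>
    obtain ⟨u, hu, v, hv, rfl⟩ := hx
    obtain ⟨u', hu', v', hv', rfl⟩ := hy
    refine ⟨u * u' - v * v', sub_mem (mul_mem hu hu') (mul_mem hv hv'),
      u * v' + v * u' + v * v' * (2 - θ),
      add_mem (add_mem (mul_mem hu hv') (mul_mem hv hu')) (mul_mem (mul_mem hv hv') h2), ?_⟩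
    linear_combination (v * v') * hsq

theorem real_of_mem (θ : ℂ) (hθ : θ.im = 0) (x : ℂ) (hx : x ∈ ℚ⟮θ⟯) : x.im = 0 := by
  have : ℚ⟮θ⟯ ≤ (Complex.ofRealAm.restrictScalars ℚ).fieldRange := by
    rw [IntermediateField.adjoin_simple_le_iff]
    exact ⟨θ.re, Complex.ext (by simp) (by simp [hθ])⟩
  obtain ⟨r, rfl⟩ := this hx
  simp

theorem adjoin_int_le (θ : ℂ) (x : ℂ) (hx : x ∈ Algebra.adjoin ℤ {θ}) : x ∈ ℚ⟮θ⟯ := by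
  have : Algebra.adjoin ℤ {θ} ≤ (ℚ⟮θ⟯).toSubalgebra.restrictScalars ℤ := by
    apply Algebra.adjoin_le
    rw [Set.singleton_subset_iff]
    exact mem_adjoin_simple_self ℚ θ
  exact this hx

theorem monogenic_aux (N : ℕ) (hN : Odd N) (ζ θ : ℂ) (h1 : ζ ^ N = 1) (hne : ζ ≠ 1)
    (hθ : θ = 2 - (ζ + ζ⁻¹)) :
    Algebra.adjoin ℤ {IntermediateField.AdjoinSimple.gen ℚ θ} = integralClosure ℤ ℚ⟮θ⟯ := by
  have hNpos : N ≠ 0 := by rintro rfl; exact absurd hN (by decide)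
  have hnorm : ‖ζ‖ = 1 := Complex.norm_eq_one_of_pow_eq_one h1 hNpos
  have h0 : ζ ≠ 0 := by rintro rfl; simp at hnorm
  have hinv : ζ⁻¹ = (starRingEnd ℂ) ζ := Complex.inv_eq_conj hnorm
  have hreal : θ.im = 0 := by rw [hθ, hinv]; simp
  have him : ζ.im ≠ 0 := by
    intro him
    obtain ⟨r, rfl⟩ : ∃ r : ℝ, ζ = r := ⟨ζ.re, Complex.ext (by simp) (by simp [him])⟩
    have hr : r ^ N = 1 := by exact_mod_cast h1
    have hr1 : r = 1 := by
      exact hN.strictMono_pow.injective (by simpa using hr)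
    exact hne (by rw [hr1]; simp)
  have hfin : IsOfFinOrder ζ := isOfFinOrder_iff_pow_eq_one.2 ⟨N, by omega, h1⟩
  haveI : NeZero (orderOf ζ) := ⟨hfin.orderOf_pos.ne'⟩
  have hprim := IsPrimitiveRoot.orderOf ζ
  have hζi : IsIntegral ℤ ζ := hprim.isIntegral (NeZero.pos _)
  have hζi' : IsIntegral ℤ ζ⁻¹ := hprim.inv.isIntegral (NeZero.pos _)
  have hθi : IsIntegral ℤ θ := by
    rw [hθ]; exact (isIntegral_algebraMap (x := (2 : ℤ))).sub (hζi.add hζi')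
  have hθζ : ℚ⟮θ⟯ ≤ ℚ⟮ζ⟯ := by
    rw [IntermediateField.adjoin_simple_le_iff, hθ]
    have := mem_adjoin_simple_self ℚ ζ
    exact sub_mem (ofNat_mem _ 2) (add_mem this (inv_mem this))
  have hinj : Function.Injective ((ℚ⟮θ⟯).val.restrictScalars ℤ) := Subtype.val_injective
  apply le_antisymm
  · apply Algebra.adjoin_le
    rintro _ rfl
    exact (isIntegral_algHom_iff _ hinj).1 hθi
  · intro α hα
    have hα' : IsIntegral ℤ (α : ℂ) := (isIntegral_algHom_iff _ hinj).2 hα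
    have hmem := int_mem hprim (α : ℂ) (hθζ α.2) hα'
    obtain ⟨u, hu, v, hv, huv⟩ := adjoin_decomp ζ θ h0 hθ _ hmem
    have a1 := real_of_mem θ hreal _ α.2
    have a2 := real_of_mem θ hreal _ (adjoin_int_le θ u hu)
    have a3 := real_of_mem θ hreal _ (adjoin_int_le θ v hv)
    rw [huv] at a1
    simp [a2, a3, him] at a1
    have hv0 : v = 0 := Complex.ext a1 a3
    rw [hv0, zero_mul, add_zero] at huv
    have h5 : u ∈ (Algebra.adjoin ℤ {AdjoinSimple.gen ℚ θ}).map
        ((ℚ⟮θ⟯).val.restrictScalars ℤ) := by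
      rw [AlgHom.map_adjoin, Set.image_singleton]
      exact hu
    obtain ⟨y, hy, hyu⟩ := h5
    have : y = α := hinj (hyu.trans huv.symm)
    rw [← this]; exact hy

theorem gal_restrict_eq_one {F E : Type*} [Field F] [Field E] [Algebra F E] (p : F[X])
    [Fact ((p.map (algebraMap F E)).Splits)] (σ : E ≃ₐ[F] E)
    (h : ∀ y : E, aeval y p = 0 → σ y = y) : Gal.restrict p E σ = 1 := by
  apply Gal.ext
  intro x hx
  have hx0 := (mem_rootSet.1 hx).2
  apply (algebraMap p.SplittingField E).injective
  have h1 : algebraMap p.SplittingField E (Gal.restrict p E σ x) =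
      σ (algebraMap p.SplittingField E x) := AlgEquiv.restrictNormal_commutes σ _ x
  rw [h1, h _ (by rw [aeval_algebraMap_apply, hx0, map_zero])]
  rfl

theorem cyclic_aux (N : ℕ) (hN : Odd N) (hC : ConditionC N) (p : ℚ[X]) (hp0 : p ≠ 0)
    (hr : ∀ θ : ℂ, aeval θ p = 0 → ∃ ζ : ℂ, ζ ^ N = 1 ∧ θ = 2 - (ζ + ζ⁻¹)) : IsCyclic p.Gal := by
  have hN0 : N ≠ 0 := by rintro rfl; exact absurd hN (by decide)
  have : NeZero N := ⟨hN0⟩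
  have hμ := Complex.isPrimitiveRoot_exp N hN0
  set μ := Complex.exp (2 * Real.pi * Complex.I / N) with hμdef
  have hcyc := cyc_ext hμ
  have hnf : NumberField ℚ⟮μ⟯ := IsCyclotomicExtension.numberField {N} ℚ ℚ⟮μ⟯
  have hgal : IsGalois ℚ ℚ⟮μ⟯ := IsCyclotomicExtension.isGalois {N} ℚ ℚ⟮μ⟯
  have hmem : ∀ ζ : ℂ, ζ ^ N = 1 → ζ ∈ ℚ⟮μ⟯ := by
    intro ζ hζ
    obtain ⟨i, -, rfl⟩ := hμ.eq_pow_of_pow_eq_one hζ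
    exact pow_mem (mem_adjoin_simple_self ℚ μ) i
  have hsplit : Fact ((p.map (algebraMap ℚ ℚ⟮μ⟯)).Splits) := by
    refine ⟨IntermediateField.splits_of_splits (IsAlgClosed.splits _) ?_⟩
    intro x hx
    obtain ⟨ζ, h1, rfl⟩ := hr x ((mem_rootSet.1 hx).2)
    have := hmem ζ h1
    exact sub_mem (ofNat_mem _ 2) (add_mem this (inv_mem this))
  let e := IsCyclotomicExtension.Rat.galEquivZMod N ℚ⟮μ⟯
  refine cyc_units hN hC ((Gal.restrict p ℚ⟮μ⟯).comp e.symm.toMonoidHom)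
    ((Gal.restrict_surjective p ℚ⟮μ⟯).comp e.symm.surjective) ?_
  set σ := e.symm (-1) with hσ
  have hσe : e σ = -1 := by rw [hσ, e.apply_symm_apply]
  have hσz : ∀ x : ℚ⟮μ⟯, x ^ N = 1 → σ x = x⁻¹ := by
    intro x hx
    have h1 := IsCyclotomicExtension.Rat.galEquivZMod_apply_of_pow_eq N ℚ⟮μ⟯ σ hx
    rw [h1]
    have h2 : (e σ).val.val + 1 ≡ 0 [MOD N] := by
      rw [← ZMod.natCast_eq_natCast_iff]
      rw [hσe]
      simp
    have h3 : N ∣ (e σ).val.val + 1 := (Nat.modEq_zero_iff_dvd).1 h2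
    obtain ⟨k, hk⟩ := h3
    apply eq_inv_of_mul_eq_one_left
    rw [← pow_succ, hk, pow_mul, hx, one_pow]
  change Gal.restrict p ℚ⟮μ⟯ σ = 1
  apply gal_restrict_eq_one
  intro y hy0
  have hy1 : aeval (y : ℂ) p = 0 := by
    have : (y : ℂ) = algebraMap ℚ⟮μ⟯ ℂ y := rfl
    rw [this, aeval_algebraMap_apply, hy0, map_zero]
  obtain ⟨ζ, hζ, hyζ⟩ := hr _ hy1
  let z : ℚ⟮μ⟯ := ⟨ζ, hmem ζ hζ⟩
  have hz : z ^ N = 1 := Subtype.ext hζ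
  have hyz : y = 2 - (z + z⁻¹) := Subtype.ext hyζ
  rw [hyz, map_sub, map_add, map_inv₀, hσz z hz, inv_inv, map_ofNat, add_comm z]

/-- If `n ≥ 2` and `2n−1` satisfies Condition 𝒞, then every monic irreducible factor
`g ∈ ℤ[x]` of `wₙ(x)` is monogenic (for any complex root `θ` of `g`, the ring of integers
of `ℚ(θ)` is `ℤ[θ]`) and has cyclic Galois group over `ℚ`. -/
theorem stmt_17 (n : ℕ) (hn : 2 ≤ n) (hC : ConditionC (2 * n - 1))
    (g : Polynomial ℤ) (hmonic : g.Monic) (hirr : Irreducible g) (hdvd : g ∣ w n) :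
    (∀ θ : ℂ, (Polynomial.aeval θ) g = 0 →
      Algebra.adjoin ℤ {IntermediateField.AdjoinSimple.gen ℚ θ} =
        integralClosure ℤ ℚ⟮θ⟯) ∧
    IsCyclic (g.map (Int.castRingHom ℚ)).Gal := by
  have hN : Odd (2 * n - 1) := ⟨n - 1, by omega⟩
  have hroot : ∀ θ : ℂ, aeval θ g = 0 → aeval θ (w n) = 0 := by
    intro θ h
    obtain ⟨q, hq⟩ := hdvd
    rw [hq, map_mul, h, zero_mul]
  refine ⟨fun θ hθ => ?_, ?_⟩
  · obtain ⟨ζ, h1, hne, h2⟩ := w_root n hn θ (hroot θ hθ)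
    exact monogenic_aux _ hN ζ θ h1 hne h2
  · refine cyclic_aux _ hN hC _ (hmonic.map _).ne_zero ?_
    intro θ hθ
    have : aeval θ g = 0 := by
      rw [← hθ]
      exact (aeval_map_algebraMap (A := ℚ) θ g).symm
    obtain ⟨ζ, h1, -, h2⟩ := w_root n hn θ (hroot θ this)
    exact ⟨ζ, h1, h2⟩
end

section
/- Let N₁ and N₂ be distinct odd integers with N₁, N₂ ≥ 3, both satisfying Condition C, and for i = 1, 2 let ζ_i ∈ ℂ be a primitive N_i-th root of unity. Then the number fields ℚ(ζ_1 + ζ_1^{−1}) and ℚ(ζ_2 + ζ_2^{−1}) are not isomorphic as fields. -/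
open Polynomial IntermediateField

lemma aux_real_s18 (N : ℕ) (h : 3 ≤ N) (z : ℂ) (hz : IsPrimitiveRoot z N) :
    z ∉ ℚ⟮z + z⁻¹⟯ := by
  intro hmem
  have hn : ‖z‖ = 1 := hz.norm'_eq_one (by omega)
  have hinv : z⁻¹ = (starRingEnd ℂ) z := Complex.inv_eq_conj hn
  have hle : ℚ⟮z + z⁻¹⟯ ≤ (IsScalarTower.toAlgHom ℚ ℝ ℂ).fieldRange := by
    rw [adjoin_simple_le_iff, hinv, Complex.add_conj]
    exact ⟨2 * z.re, by simp⟩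
  obtain ⟨r, hr⟩ := hle hmem
  have hr' : (r : ℂ) = z := hr
  have h1 : z⁻¹ = z := by rw [hinv, ← hr', Complex.conj_ofReal]
  have hz0 : z ≠ 0 := hz.ne_zero (by omega)
  have h2 : z ^ 2 = 1 := by
    rw [pow_two]; nth_rewrite 1 [← h1]; exact inv_mul_cancel₀ hz0
  have := Nat.le_of_dvd (by norm_num) (hz.dvd_of_pow_eq_one 2 h2)
  omega

lemma aux_le (z : ℂ) : ℚ⟮z + z⁻¹⟯ ≤ ℚ⟮z⟯ := by
  rw [adjoin_simple_le_iff]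
  exact add_mem (mem_adjoin_simple_self ℚ z) (inv_mem (mem_adjoin_simple_self ℚ z))

lemma aux_quad (F : IntermediateField ℚ ℂ) (z : ℂ) (hz0 : z ≠ 0) (hz : z + z⁻¹ ∈ F) :
    Module.finrank ℚ (F ⊔ ℚ⟮z⟯ : IntermediateField ℚ ℂ) ≤ 2 * Module.finrank ℚ F := by
  rw [← restrictScalars_adjoin_eq_sup]
  have h1 : Module.finrank ℚ F * Module.finrank F F⟮z⟯ = Module.finrank ℚ F⟮z⟯ :=
    Module.finrank_mul_finrank ℚ F F⟮z⟯
  let P : F[X] := X ^ 2 - C (⟨z + z⁻¹, hz⟩ : F) * X + C 1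
  have hP : P.Monic := by unfold P; monicity!
  have hdeg : P.natDegree ≤ 2 := by unfold P; compute_degree
  have hev : aeval z P = 0 := by
    simp only [P, map_add, map_sub, map_mul, map_pow, aeval_X, aeval_C, map_one]
    change z ^ 2 - (z + z⁻¹) * z + 1 = 0
    field_simp; ring
  have hint : IsIntegral F z := ⟨P, hP, hev⟩
  have h2 : Module.finrank F F⟮z⟯ ≤ 2 := by
    rw [adjoin.finrank hint]
    exact (natDegree_le_of_dvd (minpoly.dvd F z hev) hP.ne_zero).trans hdeg
  change Module.finrank ℚ F⟮z⟯ ≤ _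
  rw [← h1, mul_comm]
  exact Nat.mul_le_mul_right _ h2

lemma aux_cyc (N : ℕ) [NeZero N] (z : ℂ) (hz : IsPrimitiveRoot z N) :
    IsCyclotomicExtension {N} ℚ ℚ⟮z⟯ :=
  (IntermediateField.isCyclotomicExtension_singleton_iff_eq_adjoin N ℚ ℂ ℚ⟮z⟯ hz).2 rfl

lemma aux_totient (N : ℕ) (h : 0 < N) (z : ℂ) (hz : IsPrimitiveRoot z N) :
    Module.finrank ℚ ℚ⟮z⟯ = N.totient := by
  have : NeZero N := ⟨by omega⟩
  have := aux_cyc _ _ hz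
  exact IsCyclotomicExtension.Rat.finrank N ℚ⟮z⟯

lemma aux_half (N : ℕ) (h : 3 ≤ N) (z : ℂ) (hz : IsPrimitiveRoot z N) :
    2 * Module.finrank ℚ ℚ⟮z + z⁻¹⟯ = N.totient := by
  rw [← aux_totient N (by omega) z hz]
  have hz0 : z ≠ 0 := hz.ne_zero (by omega)
  apply le_antisymm
  · have h1 := finrank_bot_mul_relfinrank (aux_le z)
    have hpos : 0 < Module.finrank ℚ ℚ⟮z⟯ := by
      rw [aux_totient N (by omega) z hz]; exact Nat.totient_pos.2 (by omega)
    have h0 : relfinrank ℚ⟮z + z⁻¹⟯ ℚ⟮z⟯ ≠ 0 := by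
      intro h0; rw [h0] at h1; omega
    have h2 : relfinrank ℚ⟮z + z⁻¹⟯ ℚ⟮z⟯ ≠ 1 := by
      intro h2
      exact aux_real_s18 N h z hz (relfinrank_eq_one_iff.1 h2 (mem_adjoin_simple_self ℚ z))
    rw [← h1, mul_comm]
    exact Nat.mul_le_mul_left _ (by omega)
  · have := aux_quad ℚ⟮z + z⁻¹⟯ z hz0 (mem_adjoin_simple_self ℚ _)
    rwa [sup_eq_right.2 (aux_le z)] at this

lemma aux_lcm_s18 (M N : ℕ) (hM : 3 ≤ M) (hN : 3 ≤ N) (y z : ℂ) (hy : IsPrimitiveRoot y M)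
    (hz : IsPrimitiveRoot z N) (h : ℚ⟮z + z⁻¹⟯ ≤ ℚ⟮y⟯) :
    (M.lcm N).totient ≤ 2 * M.totient := by
  have : NeZero M := ⟨by omega⟩
  have : NeZero N := ⟨by omega⟩
  have : NeZero (M.lcm N) := ⟨Nat.lcm_ne_zero (by omega) (by omega)⟩
  have i1 := aux_cyc _ _ hy
  have i2 := aux_cyc _ _ hz
  have := IntermediateField.isCyclotomicExtension_lcm_sup (n₁ := M) (n₂ := N) (K := ℚ) (L := ℂ) (F₁ := ℚ⟮y⟯) (F₂ := ℚ⟮z⟯) (h₁ := i1) (h₂ := i2)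
  have h1 := aux_quad ℚ⟮y⟯ z (hz.ne_zero (by omega)) (h (mem_adjoin_simple_self ℚ _))
  have h2 : Module.finrank ℚ (ℚ⟮y⟯ ⊔ ℚ⟮z⟯ : IntermediateField ℚ ℂ) = (M.lcm N).totient :=
    @IsCyclotomicExtension.Rat.finrank (M.lcm N) (ℚ⟮y⟯ ⊔ ℚ⟮z⟯ : IntermediateField ℚ ℂ) _ _ _ this
  rw [aux_totient M (by omega) y hy] at h1
  exact h2.symm.le.trans h1

lemma aux_small (m : ℕ) (h0 : Odd m) (h : m.totient ≤ 2) : m = 1 ∨ m = 3 := by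
  by_contra! hne
  have hm : 5 ≤ m := by
    obtain ⟨k, rfl⟩ := h0; omega
  have hev := Nat.totient_even (n := m) (by omega)
  have hpos : 0 < m.totient := Nat.totient_pos.2 (by omega)
  -- `1`, `2`, `m - 1` are coprime to `m`
  have hsub : ({1, 2, m - 1} : Finset ℕ) ⊆ (Finset.range m).filter (m.Coprime ·) := by
    intro x hx
    simp only [Finset.mem_insert, Finset.mem_singleton] at hx
    simp only [Finset.mem_filter, Finset.mem_range]
    rcases hx with rfl | rfl | rfl
    · exact ⟨by omega, by simp⟩
    · exact ⟨by omega, by simpa using h0⟩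
    · refine ⟨by omega, ?_⟩
      rw [Nat.coprime_comm]
      exact Nat.coprime_self_sub_left (by omega) |>.2 (by simp)
  have hc := Finset.card_le_card hsub
  rw [← Nat.totient_eq_card_coprime, Finset.card_eq_three.2
    ⟨1, 2, m - 1, by omega, by omega, by omega, rfl⟩] at hc
  omega

lemma aux_quot (M L : ℕ) (hM : 0 < M) (hL : Odd L) (hd : M ∣ L)
    (h : L.totient ≤ 2 * M.totient) : L = M ∨ L = 3 * M := by
  obtain ⟨m, rfl⟩ := hd
  have h1 := Nat.totient_super_multiplicative M m
  have h2 : 0 < M.totient := Nat.totient_pos.2 hM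
  have h3 : m.totient ≤ 2 := by
    by_contra! h3
    nlinarith
  rcases aux_small m (Nat.odd_mul.1 hL).2 h3 with rfl | rfl
  · left; simp
  · right; ring

lemma aux_three (M N : ℕ) (hM : 0 < M) (h : N = 3 * M) (ht : N.totient = M.totient) : False := by
  subst h
  have h1 := Nat.totient_super_multiplicative 3 M
  have h2 : 0 < M.totient := Nat.totient_pos.2 hM
  have h3 : Nat.totient 3 = 2 := by decide
  rw [h3] at h1
  omega

lemma aux_eq (N : ℕ) (h : 0 < N) (z : ℂ) (hz : IsPrimitiveRoot z N)
    (K : IntermediateField ℚ ℂ) (e : ℚ⟮z + z⁻¹⟯ ≃+* K) : K = ℚ⟮z + z⁻¹⟯ := by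
  have : NeZero N := ⟨by omega⟩
  have i1 := aux_cyc _ _ hz
  have i2 : IsAbelianGalois ℚ ℚ⟮z⟯ := IsCyclotomicExtension.isAbelianGalois {N} ℚ ℚ⟮z⟯
  have i3 : IsAbelianGalois ℚ ℚ⟮z + z⁻¹⟯ :=
    @IsAbelianGalois.of_algHom _ _ _ _ _ _ _ _ (IntermediateField.inclusion (aux_le z)) i2
  have i4 : @Normal ℚ ℚ⟮z + z⁻¹⟯ _ _ (IntermediateField.algebra' _) := i3.toIsGalois.to_normal
  let f : ℚ⟮z + z⁻¹⟯ →ₐ[ℚ] ℂ := (K.val.toRingHom.comp e.toRingHom).toRatAlgHom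
  have hf := AlgHom.fieldRange_of_normal f
  rw [← hf]
  ext x
  constructor
  · intro hx
    exact ⟨e.symm ⟨x, hx⟩, by
      change ((e (e.symm ⟨x, hx⟩) : K) : ℂ) = x
      simp⟩
  · rintro ⟨y, rfl⟩
    exact (e y).2

/-- If `N₁ ≠ N₂` are odd integers `≥ 3` both satisfying Condition 𝒞, and `ζᵢ` is a
primitive `Nᵢ`-th root of unity in `ℂ`, then `ℚ(ζ₁ + ζ₁⁻¹)` and `ℚ(ζ₂ + ζ₂⁻¹)` are not
isomorphic as fields. -/
theorem stmt_18 (N₁ N₂ : ℕ) (h₁ : 3 ≤ N₁) (h₂ : 3 ≤ N₂) (hodd₁ : Odd N₁)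
    (hodd₂ : Odd N₂) (hne : N₁ ≠ N₂) (hC₁ : ConditionC N₁) (hC₂ : ConditionC N₂)
    (ζ₁ ζ₂ : ℂ) (hζ₁ : IsPrimitiveRoot ζ₁ N₁) (hζ₂ : IsPrimitiveRoot ζ₂ N₂) :
    IsEmpty (ℚ⟮ζ₁ + ζ₁⁻¹⟯ ≃+* ℚ⟮ζ₂ + ζ₂⁻¹⟯) := by
  refine ⟨fun e => ?_⟩
  have hK := aux_eq N₁ (by omega) ζ₁ hζ₁ _ e
  have ht : N₁.totient = N₂.totient := by
    rw [← aux_half N₁ h₁ ζ₁ hζ₁, ← aux_half N₂ h₂ ζ₂ hζ₂, hK]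
  have l1 := aux_lcm_s18 N₁ N₂ h₁ h₂ ζ₁ ζ₂ hζ₁ hζ₂ (hK.le.trans (aux_le ζ₁))
  have l2 : (N₁.lcm N₂).totient ≤ 2 * N₂.totient := ht ▸ l1
  have hL : Odd (N₁.lcm N₂) :=
    (Nat.odd_mul.2 ⟨hodd₁, hodd₂⟩).of_dvd_nat (Nat.lcm_dvd_mul N₁ N₂)
  have q1 := aux_quot N₁ _ (by omega) hL (Nat.dvd_lcm_left _ _) l1
  have q2 := aux_quot N₂ _ (by omega) hL (Nat.dvd_lcm_right _ _) l2
  rcases q1 with q1 | q1 <;> rcases q2 with q2 | q2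
  · omega
  · exact aux_three N₂ N₁ (by omega) (by omega) ht
  · exact aux_three N₁ N₂ (by omega) (by omega) ht.symm
  · omega
end
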